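/- For every ε ∈ (0,1) there exists a positive integer K (depending only on ε) with the following property. Let W, H be positive integers and let R be a finite family of rectangles, each of width at most W, that admits a feasible packing into [0,W]×[0,H]. Then there exists a feasible packing of ALL rectangles of R into [0,W]×[0,⌈(4/3+ε)·H⌉] together with at most K axis-aligned rectangular regions (containers) with pairwise disjoint interiors, each labeled horizontal or vertical and contained in [0,W]×[0,⌈(4/3+ε)·H⌉], such that every rectangle with h_i > ε·H or w_i > ε·W is packed inside one of the containers, any vertical line intersects the interior of at most one rectangle packed in each vertical container, and any horizontal line intersects the interior of at most one rectangle packed in each horizontal container. -/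

import Mathlib

open scoped Classical

/-- Open axis-aligned rectangles `(x₁, x₁+w₁) × (y₁, y₁+h₁)` and `(x₂, x₂+w₂) × (y₂, y₂+h₂)`
are disjoint. -/
def RectDisjoint (x₁ y₁ w₁ h₁ x₂ y₂ w₂ h₂ : ℕ) : Prop :=
  x₁ + w₁ ≤ x₂ ∨ x₂ + w₂ ≤ x₁ ∨ y₁ + h₁ ≤ y₂ ∨ y₂ + h₂ ≤ y₁

/-- A feasible packing of the family of rectangles `(w i, h i)` at positions `(x i, y i)`
inside `[0,W]×[0,H]`. -/
def IsPacking {ι : Type*} (w h x y : ι → ℕ) (W H : ℕ) : Prop :=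
  (∀ i, x i + w i ≤ W ∧ y i + h i ≤ H) ∧
  Pairwise fun i j => RectDisjoint (x i) (y i) (w i) (h i) (x j) (y j) (w j) (h j)

/-- Two axis-aligned rectangular regions (real coordinates) have disjoint interiors. -/
def RegionDisjoint (cx cy cw ch cx' cy' cw' ch' : ℝ) : Prop :=
  cx + cw ≤ cx' ∨ cx' + cw' ≤ cx ∨ cy + ch ≤ cy' ∨ cy' + ch' ≤ cy

/-- The rectangle of width `wi`, height `hi` placed at `(x,y)` lies inside the region with
bottom-left corner `(cx,cy)`, width `cw` and height `ch`. -/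
def InRegion (x y wi hi : ℕ) (cx cy cw ch : ℝ) : Prop :=
  cx ≤ (x : ℝ) ∧ (x : ℝ) + wi ≤ cx + cw ∧ cy ≤ (y : ℝ) ∧ (y : ℝ) + hi ≤ cy + ch


structure Rg where
  x : ℕ
  y : ℕ
  w : ℕ
  h : ℕ

namespace Rg
def Mem (a : Rg) (q r : ℕ) : Prop :=
  a.x ≤ q ∧ q < a.x + a.w ∧ a.y ≤ r ∧ r < a.y + a.h
def CD (a b : Rg) : Prop := ∀ q r, a.Mem q r → b.Mem q r → False
def cells (a : Rg) : Finset (ℕ × ℕ) :=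
  Finset.Ico a.x (a.x + a.w) ×ˢ Finset.Ico a.y (a.y + a.h)
def Sub (a b : Rg) : Prop := ∀ q r, a.Mem q r → b.Mem q r
theorem card_cells (a : Rg) : a.cells.card = a.w * a.h := by
  simp [cells]
theorem mem_cells (a : Rg) (p : ℕ × ℕ) : p ∈ a.cells ↔ a.Mem p.1 p.2 := by
  simp [cells, Mem]; tauto
theorem CD.symm {a b : Rg} (h : a.CD b) : b.CD a := fun q r h1 h2 => h q r h2 h1
theorem CD.mono {a b a' b' : Rg} (h : a.CD b) (h1 : a'.Sub a) (h2 : b'.Sub b) : a'.CD b' :=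
  fun q r h3 h4 => h q r (h1 q r h3) (h2 q r h4)
theorem cells_disj {a b : Rg} (h : a.CD b) : Disjoint a.cells b.cells := by
  rw [Finset.disjoint_left]
  intro p h1 h2
  rw [mem_cells] at h1 h2
  exact h _ _ h1 h2
theorem CD.rect {a b : Rg} (h : a.CD b) (h1 : 0 < a.w) (h2 : 0 < a.h) (h3 : 0 < b.w) (h4 : 0 < b.h) :
    RectDisjoint a.x a.y a.w a.h b.x b.y b.w b.h := by
  by_contra hc
  unfold RectDisjoint at hc
  refine h (max a.x b.x) (max a.y b.y) ?_ ?_ <;> unfold Mem <;> omega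
theorem CD.of_rect {a b : Rg} 
    (h : RectDisjoint a.x a.y a.w a.h b.x b.y b.w b.h) : a.CD b := by
  intro q r h1 h2
  unfold RectDisjoint at h
  unfold Mem at h1 h2
  omega
end Rg

theorem sum_card_le {ι α : Type*} (s : Finset ι) (f : ι → Finset α) (Z : Finset α)
    (hd : ∀ i ∈ s, ∀ j ∈ s, i ≠ j → Disjoint (f i) (f j)) (hZ : ∀ i ∈ s, f i ⊆ Z) :
    ∑ i ∈ s, (f i).card ≤ Z.card := by
  rw [← Finset.card_biUnion hd]
  exact Finset.card_le_card (Finset.biUnion_subset.2 hZ)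

theorem sum_area_le {ι : Type*} (s : Finset ι) (r : ι → Rg) (b : Rg)
    (hd : ∀ i ∈ s, ∀ j ∈ s, i ≠ j → (r i).CD (r j)) (hb : ∀ i ∈ s, (r i).Sub b) :
    ∑ i ∈ s, (r i).w * (r i).h ≤ b.w * b.h := by
  have := sum_card_le s (fun i => (r i).cells) b.cells
    (fun i hi j hj hij => Rg.cells_disj (hd i hi j hj hij))
    (fun i hi p hp => by rw [Rg.mem_cells] at *; exact hb i hi _ _ hp)
  simpa only [Rg.card_cells] using this

theorem stack {ι : Type*} (s : Finset ι) (sz : ι → ℕ) :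
    ∃ pos : ι → ℕ, (∀ i ∈ s, pos i + sz i ≤ ∑ j ∈ s, sz j) ∧
      ∀ i ∈ s, ∀ j ∈ s, i ≠ j → pos i + sz i ≤ pos j ∨ pos j + sz j ≤ pos i := by
  induction s using Finset.induction_on with
  | empty => exact ⟨fun _ => 0, by simp, by simp⟩
  | insert a s ha ih =>
    obtain ⟨pos, h1, h2⟩ := ih
    refine ⟨fun i => if i = a then ∑ j ∈ s, sz j else pos i, ?_, ?_⟩
    · intro i hi
      rw [Finset.sum_insert ha]
      by_cases hia : i = a
      · subst hia; simp; omega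
      · have := h1 i (by simpa [hia] using hi)
        simp [hia]; omega
    · intro i hi j hj hij
      by_cases hia : i = a
      · have hja : j ≠ a := fun h => hij (hia.trans h.symm)
        have := h1 j (by simpa [hja] using hj)
        simp [hia, hja]; omega
      · by_cases hja : j = a
        · have := h1 i (by simpa [hia] using hi)
          simp [hia, hja]; omega
        · simp only [hia, hja, if_false]
          exact h2 i (by simpa [hia] using hi) j (by simpa [hja] using hj) hij

theorem fill_one {ι : Type*} (s : Finset ι) (sz : ι → ℕ) (t cap : ℕ) (hsz : ∀ i ∈ s, sz i ≤ t) :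
    ∃ A ⊆ s, ∑ i ∈ A, sz i ≤ cap ∧ (A = s ∨ cap ≤ ∑ i ∈ A, sz i + t) := by
  induction s using Finset.induction_on with
  | empty => exact ⟨∅, by simp, by simp, by simp⟩
  | insert a s ha ih =>
    obtain ⟨A, hA, h1, h2⟩ := ih (fun i hi => hsz i (Finset.mem_insert_of_mem hi))
    rcases h2 with h2 | h2
    · subst h2
      by_cases h : ∑ i ∈ insert a A, sz i ≤ cap
      · exact ⟨insert a A, subset_rfl, h, Or.inl rfl⟩
      · refine ⟨A, Finset.subset_insert _ _, h1, Or.inr ?_⟩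
        rw [Finset.sum_insert ha] at h
        have := hsz a (Finset.mem_insert_self _ _)
        omega
    · exact ⟨A, hA.trans (Finset.subset_insert _ _), h1, Or.inr h2⟩

theorem fill {ι β : Type*} [Nonempty β] (s : Finset ι) (sz : ι → ℕ) (t : ℕ)
    (hsz : ∀ i ∈ s, sz i ≤ t) (B : Finset β) (cap : β → ℕ) :
    ∃ D ⊆ s, ∃ f : ι → β, (∀ i ∈ s, i ∉ D → f i ∈ B) ∧
      (∀ b ∈ B, ∑ i ∈ s with i ∉ D ∧ f i = b, sz i ≤ cap b) ∧
      (D = ∅ ∨ ∑ i ∈ D, sz i + ∑ b ∈ B, cap b ≤ ∑ i ∈ s, sz i + B.card * t) := by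
  induction B using Finset.induction_on with
  | empty =>
    exact ⟨s, subset_rfl, fun _ => Classical.arbitrary β, by simp, by simp, by simp⟩
  | insert b B hb ih =>
    obtain ⟨D, hD, f, h1, h2, h3⟩ := ih
    obtain ⟨A, hA, h4, h5⟩ := fill_one D sz t (cap b) (fun i hi => hsz i (hD hi))
    refine ⟨D \ A, Finset.sdiff_subset.trans hD, fun i => if i ∈ A then b else f i, ?_, ?_, ?_⟩
    · intro i hi hiD
      by_cases hiA : i ∈ A
      · simp [hiA]
      · simp only [hiA, if_false]
        have : i ∉ D := fun h => hiD (Finset.mem_sdiff.2 ⟨h, hiA⟩)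
        exact Finset.mem_insert_of_mem (h1 i hi this)
    · intro b' hb'
      by_cases hbb : b' = b
      · subst hbb
        refine le_trans (Finset.sum_le_sum_of_subset ?_) h4
        intro i hi
        simp only [Finset.mem_filter, Finset.mem_sdiff, not_and, not_not] at hi
        by_contra hiA
        have hiD : i ∉ D := fun h => hiA (hi.2.1 h)
        have := hi.2.2
        simp only [hiA, if_false] at this
        exact hb (this ▸ h1 i hi.1 hiD)
      · have hb'' : b' ∈ B := by simpa [hbb] using hb'
        refine le_trans (Finset.sum_le_sum_of_subset ?_) (h2 b' hb'')
        intro i hi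
        simp only [Finset.mem_filter, Finset.mem_sdiff, not_and, not_not] at hi ⊢
        by_cases hiA : i ∈ A
        · have := hi.2.2
          simp only [hiA, if_true] at this
          exact absurd this.symm hbb
        · have := hi.2.2
          simp only [hiA, if_false] at this
          exact ⟨hi.1, fun h => hiA (hi.2.1 h), this⟩
    · rcases h5 with h5 | h5
      · left; rw [h5]; simp
      · rcases h3 with h3 | h3
        · left; rw [h3]; simp
        · right
          rw [Finset.sum_insert hb, Finset.card_insert_of_notMem hb]
          have := Finset.sum_sdiff (f := sz) hA
          nlinarith

/-- previous and next line -/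
noncomputable def lo (L : Finset ℕ) (y : ℕ) : ℕ := (L.filter (· ≤ y)).sup id
noncomputable def hi (L : Finset ℕ) (y : ℕ) : ℕ := sInf {z | z ∈ L ∧ y < z}

theorem lo_mem {L : Finset ℕ} (h0 : 0 ∈ L) (y : ℕ) : lo L y ∈ L ∧ lo L y ≤ y := by
  have hne : (L.filter (· ≤ y)).Nonempty := ⟨0, by simp [h0]⟩
  obtain ⟨a, ha, hb⟩ := Finset.exists_mem_eq_sup _ hne (id : ℕ → ℕ)
  unfold lo
  rw [hb]
  simpa using ha
theorem le_lo {L : Finset ℕ} {y z : ℕ} (hz : z ∈ L) (hzy : z ≤ y) : z ≤ lo L y :=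
  Finset.le_sup (f := id) (by simp [hz, hzy])
theorem hi_mem {L : Finset ℕ} {N y : ℕ} (hN : N ∈ L) (hy : y < N) : hi L y ∈ L ∧ y < hi L y := by
  have : sInf {z | z ∈ L ∧ y < z} ∈ {z | z ∈ L ∧ y < z} := Nat.sInf_mem ⟨N, hN, hy⟩
  exact this
theorem hi_le {L : Finset ℕ} {y z : ℕ} (hz : z ∈ L) (hzy : y < z) : hi L y ≤ z :=
  Nat.sInf_le ⟨hz, hzy⟩
theorem lo_eq_of {L : Finset ℕ} (h0 : 0 ∈ L) {y y' : ℕ} (h1 : lo L y ≤ y') (h2 : y' < hi L y) :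
    lo L y' = lo L y := by
  apply le_antisymm
  · by_contra hc
    push Not at hc
    obtain ⟨h3, h4⟩ := lo_mem h0 y'
    have : y < lo L y' := by
      by_contra h5
      have := le_lo h3 (not_lt.1 h5)
      omega
    have := hi_le h3 this
    omega
  · exact le_lo (lo_mem h0 y).1 h1
theorem hi_eq_of {L : Finset ℕ} (h0 : 0 ∈ L) {N y y' : ℕ} (hN : N ∈ L) (hy : y < N) (h1 : lo L y ≤ y') (h2 : y' < hi L y) :
    hi L y' = hi L y := by
  obtain ⟨h3, h4⟩ := hi_mem hN hy
  have h5 : hi L y' ≤ hi L y := hi_le h3 h2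
  apply le_antisymm h5
  obtain ⟨h6, h7⟩ := hi_mem h3 h2
  by_contra hc
  have : y < hi L y' := by
    by_contra h8
    have := le_lo h6 (not_lt.1 h8)
    omega
  have := hi_le h6 this
  omega


theorem geo_aux (n : ℕ) : ∀ (W s : ℝ), 0 ≤ W → 0 ≤ s →
    ∑ k ∈ Finset.range n, (if W / 2 ^ k < s then W / 2 ^ k else 0) ≤ 2 * min s W := by
  induction n with
  | zero => intro W s hW hs; simp [hW, hs]
  | succ n ih =>
    intro W s hW hs
    rw [Finset.sum_range_succ']
    have h1 := ih (W / 2) s (by positivity) hs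
    have h2 : ∀ k : ℕ, W / 2 ^ (k + 1) = W / 2 / 2 ^ k := by
      intro k; rw [pow_succ]; field_simp
    simp only [h2, pow_zero, div_one]
    by_cases h : W < s
    · rw [if_pos h, min_eq_right h.le]
      have : min s (W / 2) ≤ W / 2 := min_le_right _ _
      linarith
    · rw [if_neg h]
      have : min s (W / 2) ≤ min s W := min_le_min le_rfl (by linarith)
      linarith

theorem threshold (P C : ℕ) : ∃ N : ℕ, ∀ (ι : Type) (s : Finset ι) (sz : ι → ℕ) (W : ℕ), 0 < W →
    ∑ i ∈ s, sz i ≤ P * W →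
    ∃ m, C * (C + (s.filter (fun i => m < sz i)).card) * m ≤ W ∧
      (s.filter (fun i => m < sz i)).card ≤ N := by
  set n := C * (2 * P + 2 * C) + 1 with hn
  refine ⟨P * 2 ^ n, ?_⟩
  intro ι s sz W hW hs
  set c : ℕ → ℕ := fun k => (s.filter (fun i => W / 2 ^ k < sz i)).card with hc
  have hbig : ∀ k i, W / 2 ^ k < sz i ↔ (W : ℝ) / 2 ^ k < sz i := by
    intro k i
    rw [Nat.div_lt_iff_lt_mul (by positivity), div_lt_iff₀ (by positivity)]
    exact_mod_cast Iff.rfl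
  have hsR : ∑ i ∈ s, (sz i : ℝ) ≤ P * W := by exact_mod_cast hs
  have hWR : (0 : ℝ) < W := by exact_mod_cast hW
  have hcnt : ∀ k, c k ≤ P * 2 ^ k := by
    intro k
    have h1 : (c k : ℝ) * ((W : ℝ) / 2 ^ k) ≤ P * W := by
      refine le_trans ?_ hsR
      rw [← nsmul_eq_mul]
      refine le_trans ?_ (Finset.sum_le_sum_of_subset_of_nonneg (Finset.filter_subset (fun i => W / 2 ^ k < sz i) s) (fun i _ _ => by positivity))
      apply Finset.card_nsmul_le_sum
      intro i hi
      exact ((hbig k i).1 (Finset.mem_filter.1 hi).2).le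
    have h2 : (c k : ℝ) ≤ P * 2 ^ k := by
      rw [mul_div_assoc', div_le_iff₀ (by positivity)] at h1
      nlinarith
    exact_mod_cast h2
  by_contra hcon
  push Not at hcon
  have hno : ∀ k ∈ Finset.range n, W < C * (C + c k) * (W / 2 ^ k) := by
    intro k hk
    by_contra h
    push Not at h
    have := hcon _ h
    have h3 := hcnt k
    have : P * 2 ^ k ≤ P * 2 ^ n := Nat.mul_le_mul_left _ (Nat.pow_le_pow_right (by norm_num) (Finset.mem_range.1 hk).le)
    simp only [hc] at h3
    omega
  have key : ∀ k ∈ Finset.range n, (W : ℝ) - C * C * (W / 2 ^ k) ≤ C * ((c k : ℝ) * (W / 2 ^ k)) := by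
    intro k hk
    have h1 : (W : ℝ) ≤ (C * (C + c k) * (W / 2 ^ k : ℕ) : ℕ) := by exact_mod_cast (hno k hk).le
    have h2 : ((W / 2 ^ k : ℕ) : ℝ) ≤ W / 2 ^ k := by
      have := @Nat.cast_div_le ℝ _ _ _ W (2 ^ k)
      push_cast at this; exact this
    push_cast at h1
    have h3 : (C : ℝ) * (C + c k) * ((W / 2 ^ k : ℕ) : ℝ) ≤ C * (C + c k) * (W / 2 ^ k) := by gcongr
    nlinarith
  have hgeoW : ∑ k ∈ Finset.range n, (W : ℝ) / 2 ^ k ≤ 2 * W := by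
    have := geo_aux n W (W + 1) hWR.le (by positivity)
    rw [min_eq_right (by linarith)] at this
    refine le_trans (Finset.sum_le_sum fun k _ => ?_) this
    rw [if_pos]
    have : (W : ℝ) / 2 ^ k ≤ W := div_le_self hWR.le (one_le_pow₀ (by norm_num))
    linarith
  have hsum : ∑ k ∈ Finset.range n, (c k : ℝ) * ((W : ℝ) / 2 ^ k) ≤ 2 * (P * W) := by
    have h1 : ∀ k, (c k : ℝ) * ((W : ℝ) / 2 ^ k) = ∑ i ∈ s, (if (W : ℝ) / 2 ^ k < sz i then (W : ℝ) / 2 ^ k else 0) := by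
      intro k
      rw [← Finset.sum_filter, Finset.sum_const, nsmul_eq_mul]
      congr 2
      simp only [hc, hbig]
    simp only [h1]
    rw [Finset.sum_comm]
    calc _ ≤ ∑ i ∈ s, 2 * (sz i : ℝ) := by
          apply Finset.sum_le_sum
          intro i _
          refine (geo_aux n W (sz i) hWR.le (by positivity)).trans ?_
          have := min_le_left (sz i : ℝ) W
          linarith
      _ ≤ _ := by rw [← Finset.mul_sum]; linarith
  have h1 := Finset.sum_le_sum key
  rw [Finset.sum_sub_distrib, Finset.sum_const, Finset.card_range, ← Finset.mul_sum, ← Finset.mul_sum,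
    nsmul_eq_mul] at h1
  have hC : (0 : ℝ) ≤ C := by positivity
  have h2 : (C : ℝ) * ∑ k ∈ Finset.range n, (c k : ℝ) * ((W : ℝ) / 2 ^ k) ≤ C * (2 * (P * W)) := by gcongr
  have h3 : (C : ℝ) * C * ∑ k ∈ Finset.range n, (W : ℝ) / 2 ^ k ≤ C * C * (2 * W) := by gcongr
  have h4 : (n : ℝ) * W ≤ C * (2 * P + 2 * C) * W := by nlinarith
  have h5 : (n : ℝ) ≤ C * (2 * P + 2 * C) := le_of_mul_le_mul_right h4 hWR
  have h6 : (n : ℝ) = C * (2 * P + 2 * C) + 1 := by rw [hn]; push_cast; ring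
  linarith

theorem free_decomp {κ : Type*} (s : Finset κ) (reg : κ → Rg) (W H : ℕ)
    (hin : ∀ k ∈ s, (reg k).x + (reg k).w ≤ W ∧ (reg k).y + (reg k).h ≤ H) :
    ∃ (F : Finset (ℕ × ℕ)) (bx : ℕ × ℕ → Rg), F.card ≤ (2 * s.card + 2) ^ 2 ∧
      (∀ f ∈ F, (bx f).x + (bx f).w ≤ W ∧ (bx f).y + (bx f).h ≤ H) ∧
      (∀ f ∈ F, ∀ f' ∈ F, f ≠ f' → (bx f).CD (bx f')) ∧
      (∀ f ∈ F, ∀ k ∈ s, (bx f).CD (reg k)) ∧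
      W * H ≤ ∑ k ∈ s, (reg k).w * (reg k).h + ∑ f ∈ F, (bx f).w * (bx f).h := by
  set X : Finset ℕ := {0, W} ∪ (s.image (fun k => (reg k).x) ∪ s.image (fun k => (reg k).x + (reg k).w)) with hX
  set Y : Finset ℕ := {0, H} ∪ (s.image (fun k => (reg k).y) ∪ s.image (fun k => (reg k).y + (reg k).h)) with hY
  have hXc : X.card ≤ 2 * s.card + 2 := by
    have h1 := Finset.card_union_le ({0, W} : Finset ℕ) (s.image (fun k => (reg k).x) ∪ s.image (fun k => (reg k).x + (reg k).w))
    have h2 := Finset.card_union_le (s.image (fun k => (reg k).x)) (s.image (fun k => (reg k).x + (reg k).w))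
    have h3 := Finset.card_image_le (s := s) (f := fun k => (reg k).x)
    have h4 := Finset.card_image_le (s := s) (f := fun k => (reg k).x + (reg k).w)
    have h5 := Finset.card_le_two (a := 0) (b := W)
    rw [← hX] at h1
    omega
  have hYc : Y.card ≤ 2 * s.card + 2 := by
    have h1 := Finset.card_union_le ({0, H} : Finset ℕ) (s.image (fun k => (reg k).y) ∪ s.image (fun k => (reg k).y + (reg k).h))
    have h2 := Finset.card_union_le (s.image (fun k => (reg k).y)) (s.image (fun k => (reg k).y + (reg k).h))
    have h3 := Finset.card_image_le (s := s) (f := fun k => (reg k).y)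
    have h4 := Finset.card_image_le (s := s) (f := fun k => (reg k).y + (reg k).h)
    have h5 := Finset.card_le_two (a := 0) (b := H)
    rw [← hY] at h1
    omega
  have hX0 : 0 ∈ X := by simp [hX]
  have hXW : W ∈ X := by simp [hX]
  have hY0 : 0 ∈ Y := by simp [hY]
  have hYH : H ∈ Y := by simp [hY]
  have hXx : ∀ k ∈ s, (reg k).x ∈ X ∧ (reg k).x + (reg k).w ∈ X := by
    intro k hk
    simp only [hX, Finset.mem_union, Finset.mem_image]
    exact ⟨Or.inr (Or.inl ⟨k, hk, rfl⟩), Or.inr (Or.inr ⟨k, hk, rfl⟩)⟩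
  have hYy : ∀ k ∈ s, (reg k).y ∈ Y ∧ (reg k).y + (reg k).h ∈ Y := by
    intro k hk
    simp only [hY, Finset.mem_union, Finset.mem_image]
    exact ⟨Or.inr (Or.inl ⟨k, hk, rfl⟩), Or.inr (Or.inr ⟨k, hk, rfl⟩)⟩
  set bx : ℕ × ℕ → Rg := fun f => ⟨f.1, f.2, hi X f.1 - f.1, hi Y f.2 - f.2⟩ with hbx
  set F : Finset (ℕ × ℕ) := (X ×ˢ Y).filter (fun f => f.1 < W ∧ f.2 < H ∧ ∀ k ∈ s, (bx f).CD (reg k)) with hF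
  refine ⟨F, bx, ?_, ?_, ?_, ?_, ?_⟩
  · refine (Finset.card_filter_le _ _).trans ?_
    rw [Finset.card_product, pow_two]
    exact Nat.mul_le_mul hXc hYc
  · intro f hf
    simp only [hF, Finset.mem_filter] at hf
    have h1 := hi_le hXW hf.2.1
    have h2 := hi_le hYH hf.2.2.1
    have h3 := (hi_mem hXW hf.2.1).2
    have h4 := (hi_mem hYH hf.2.2.1).2
    simp only [hbx]
    omega
  · intro f hf f' hf' hne q r h1 h2
    simp only [hF, Finset.mem_filter, Finset.mem_product] at hf hf'
    simp only [hbx, Rg.Mem] at h1 h2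
    apply hne
    have a1 : f.1 = f'.1 := by
      by_contra hc
      rcases lt_or_gt_of_ne hc with h | h
      · have := hi_le hf'.1.1 h; omega
      · have := hi_le hf.1.1 h; omega
    have a2 : f.2 = f'.2 := by
      by_contra hc
      rcases lt_or_gt_of_ne hc with h | h
      · have := hi_le hf'.1.2 h; omega
      · have := hi_le hf.1.2 h; omega
    exact Prod.ext a1 a2
  · intro f hf k hk
    exact (Finset.mem_filter.1 hf).2.2.2 k hk
  · have hsub : (⟨0, 0, W, H⟩ : Rg).cells ⊆ s.biUnion (fun k => (reg k).cells) ∪ F.biUnion (fun f => (bx f).cells) := by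
      rintro ⟨q, r⟩ hp
      rw [Rg.mem_cells] at hp
      simp only [Rg.Mem] at hp
      by_cases hex : ∃ k ∈ s, (reg k).Mem q r
      · obtain ⟨k, hk, hm⟩ := hex
        apply Finset.mem_union_left
        exact Finset.mem_biUnion.2 ⟨k, hk, (Rg.mem_cells _ _).2 hm⟩
      · apply Finset.mem_union_right
        have hqW : q < W := by omega
        have hrH : r < H := by omega
        have e1 := lo_mem hX0 q
        have e2 := lo_mem hY0 r
        have e3 := hi_mem hXW hqW
        have e4 := hi_mem hYH hrH
        have e5 : hi X (lo X q) = hi X q := hi_eq_of hX0 hXW hqW le_rfl (by omega)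
        have e6 : hi Y (lo Y r) = hi Y r := hi_eq_of hY0 hYH hrH le_rfl (by omega)
        have hmem : (bx (lo X q, lo Y r)).Mem q r := by
          simp only [hbx, Rg.Mem, e5, e6]; omega
        refine Finset.mem_biUnion.2 ⟨(lo X q, lo Y r), ?_, (Rg.mem_cells _ _).2 hmem⟩
        simp only [hF, Finset.mem_filter, Finset.mem_product]
        refine ⟨⟨e1.1, e2.1⟩, by omega, by omega, ?_⟩
        intro k hk q' r' h1 h2
        apply hex
        refine ⟨k, hk, ?_⟩
        simp only [hbx, Rg.Mem, e5, e6] at h1 h2 ⊢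
        obtain ⟨x1, x2⟩ := hXx k hk
        obtain ⟨y1, y2⟩ := hYy k hk
        have b1 : ∀ z ∈ X, z ≤ lo X q ∨ hi X q ≤ z := by
          intro z hz
          rcases le_or_gt z q with h | h
          · exact Or.inl (le_lo hz h)
          · exact Or.inr (hi_le hz h)
        have b2 : ∀ z ∈ Y, z ≤ lo Y r ∨ hi Y r ≤ z := by
          intro z hz
          rcases le_or_gt z r with h | h
          · exact Or.inl (le_lo hz h)
          · exact Or.inr (hi_le hz h)
        have := b1 _ x1
        have := b1 _ x2
        have := b2 _ y1
        have := b2 _ y2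
        omega
    have h1 := Finset.card_le_card hsub
    rw [Rg.card_cells] at h1
    refine h1.trans ((Finset.card_union_le _ _).trans (Nat.add_le_add ?_ ?_))
    · refine Finset.card_biUnion_le.trans (Finset.sum_le_sum fun k _ => by rw [Rg.card_cells])
    · refine Finset.card_biUnion_le.trans (Finset.sum_le_sum fun k _ => by rw [Rg.card_cells])

theorem prefix_exists {ι : Type*} (s : Finset ι) (w h : ι → ℕ) (w0 a : ℕ) (hw : ∀ i ∈ s, w i ≤ w0) :
    ∃ B ⊆ s, (∀ i ∈ B, ∀ j ∈ s, j ∉ B → h j ≤ h i) ∧ ∑ i ∈ B, w i ≤ a ∧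
      (B = s ∨ a ≤ ∑ i ∈ B, w i + w0) := by
  induction s using Finset.induction_on_min_value h with
  | empty => exact ⟨∅, by simp⟩
  | insert b s hb hmin ih =>
    obtain ⟨B, hB, h1, h2, h3⟩ := ih (fun i hi => hw i (Finset.mem_insert_of_mem hi))
    rcases h3 with h3 | h3
    · subst h3
      by_cases hc : ∑ i ∈ insert b B, w i ≤ a
      · exact ⟨insert b B, subset_rfl, fun i _ j hj hj' => absurd hj hj', hc, Or.inl rfl⟩
      · refine ⟨B, Finset.subset_insert _ _, ?_, h2, Or.inr ?_⟩
        · intro i hi j hj hjB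
          have : j = b := by simpa [hjB] using hj
          rw [this]; exact hmin i hi
        · rw [Finset.sum_insert hb] at hc
          have := hw b (Finset.mem_insert_self _ _)
          omega
    · refine ⟨B, hB.trans (Finset.subset_insert _ _), ?_, h2, Or.inr h3⟩
      intro i hi j hj hjB
      rcases Finset.mem_insert.1 hj with rfl | hj
      · exact hmin i (hB hi)
      · exact h1 i hi j hj hjB

theorem nfdh {ι : Type*} (w h : ι → ℕ) (w0 a : ℕ) (n : ℕ) : ∀ (s : Finset ι) (b η : ℕ), s.card ≤ n →
    (∀ i ∈ s, w i ≤ w0) → (∀ i ∈ s, h i ≤ η) →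
    ∃ A ⊆ s, ∃ x y : ι → ℕ, (∀ i ∈ A, x i + w i ≤ a ∧ y i + h i ≤ b) ∧
      (∀ i ∈ A, ∀ j ∈ A, i ≠ j → RectDisjoint (x i) (y i) (w i) (h i) (x j) (y j) (w j) (h j)) ∧
      (A = s ∨ (a - w0) * (b - η) ≤ ∑ i ∈ A, w i * h i) := by
  induction n with
  | zero =>
    intro s b η hs _ _
    have : s = ∅ := Finset.card_eq_zero.1 (by omega)
    subst this
    exact ⟨∅, subset_rfl, fun _ => 0, fun _ => 0, by simp, by simp, Or.inl rfl⟩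
  | succ n ih =>
    intro s b η hs hw hh
    by_cases hb : b < η
    · refine ⟨∅, by simp, fun _ => 0, fun _ => 0, by simp, by simp, Or.inr ?_⟩
      have : b - η = 0 := by omega
      simp [this]
    by_cases ha : a ≤ w0
    · refine ⟨∅, by simp, fun _ => 0, fun _ => 0, by simp, by simp, Or.inr ?_⟩
      have : a - w0 = 0 := by omega
      simp [this]
    push Not at hb ha
    obtain ⟨B, hBs, hB1, hB2, hB3⟩ := prefix_exists s w h w0 a hw
    obtain ⟨pos, hp1, hp2⟩ := stack B w
    by_cases hBeq : B = s
    · subst hBeq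
      refine ⟨B, subset_rfl, pos, fun _ => 0, ?_, ?_, Or.inl rfl⟩
      · intro i hi
        have := hp1 i hi
        have := hh i hi
        simp only
        omega
      · intro i hi j hj hij
        rcases hp2 i hi j hj hij with h | h
        · exact Or.inl h
        · exact Or.inr (Or.inl h)
    · have hB4 : a ≤ ∑ i ∈ B, w i + w0 := hB3.resolve_left hBeq
      have hBne : B.Nonempty := by
        by_contra hc
        rw [Finset.not_nonempty_iff_eq_empty] at hc
        rw [hc] at hB4
        simp at hB4
        omega
      set η' := (s \ B).sup h with hη'
      have hcard : (s \ B).card ≤ n := by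
        have := Finset.card_sdiff_add_card_eq_card hBs
        have := hBne.card_pos
        omega
      obtain ⟨A, hA, x, y, h1, h2, h3⟩ := ih (s \ B) (b - η) η' hcard
        (fun i hi => hw i (Finset.mem_sdiff.1 hi).1) (fun i hi => Finset.le_sup hi)
      have hdisj : Disjoint B A := by
        rw [Finset.disjoint_right]
        intro i hi
        exact (Finset.mem_sdiff.1 (hA hi)).2
      have hnB : ∀ i ∈ A, i ∉ B := fun i hi => (Finset.mem_sdiff.1 (hA hi)).2
      refine ⟨B ∪ A, Finset.union_subset hBs (hA.trans Finset.sdiff_subset),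
        fun i => if i ∈ B then pos i else x i, fun i => if i ∈ B then 0 else η + y i, ?_, ?_, ?_⟩
      · intro i hi
        by_cases hiB : i ∈ B
        · have := hp1 i hiB
          have := hh i (hBs hiB)
          simp only [hiB, if_true]
          omega
        · have := h1 i (by simpa [hiB] using hi)
          simp only [hiB, if_false]
          omega
      · intro i hi j hj hij
        by_cases hiB : i ∈ B
        · by_cases hjB : j ∈ B
          · simp only [hiB, hjB, if_true]
            rcases hp2 i hiB j hjB hij with h | h
            · exact Or.inl h
            · exact Or.inr (Or.inl h)
          · have := hh i (hBs hiB)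
            simp only [hiB, hjB, if_true, if_false, RectDisjoint]
            omega
        · by_cases hjB : j ∈ B
          · have := hh j (hBs hjB)
            simp only [hiB, hjB, if_true, if_false, RectDisjoint]
            omega
          · have := h2 i (by simpa [hiB] using hi) j (by simpa [hjB] using hj) hij
            simp only [hiB, hjB, if_false, RectDisjoint] at this ⊢
            omega
      · rcases h3 with h3 | h3
        · left; rw [h3]; exact Finset.union_sdiff_of_subset hBs
        · right
          rw [Finset.sum_union hdisj]
          have e1 : (∑ i ∈ B, w i) * η' ≤ ∑ i ∈ B, w i * h i := by
            rw [Finset.sum_mul]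
            apply Finset.sum_le_sum
            intro i hi
            apply Nat.mul_le_mul_left
            apply Finset.sup_le
            intro j hj
            exact hB1 i hi j (Finset.mem_sdiff.1 hj).1 (Finset.mem_sdiff.1 hj).2
          have e2 : (a - w0) * η' ≤ (∑ i ∈ B, w i) * η' := Nat.mul_le_mul_right _ (by omega)
          have e3 : (a - w0) * (b - η) ≤ (a - w0) * η' + (a - w0) * (b - η - η') := by
            rw [← mul_add]
            exact Nat.mul_le_mul_left _ (by omega)
          omega

theorem nfdh_multi {ι β : Type*} [Nonempty β] (s : Finset ι) (w h : ι → ℕ) (w0 h0 : ℕ)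
    (hw : ∀ i ∈ s, 0 < w i ∧ w i ≤ w0) (hh : ∀ i ∈ s, 0 < h i ∧ h i ≤ h0)
    (F : Finset β) (bx : β → Rg)
    (hd : ∀ f ∈ F, ∀ f' ∈ F, f ≠ f' → (bx f).CD (bx f'))
    (harea : ∑ i ∈ s, w i * h i ≤ ∑ f ∈ F, ((bx f).w - w0) * ((bx f).h - h0)) :
    ∃ (x y : ι → ℕ) (f : ι → β), (∀ i ∈ s, f i ∈ F ∧ (⟨x i, y i, w i, h i⟩ : Rg).Sub (bx (f i))) ∧
      (∀ i ∈ s, ∀ j ∈ s, i ≠ j → (⟨x i, y i, w i, h i⟩ : Rg).CD ⟨x j, y j, w j, h j⟩) := by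
  have main : ∃ A ⊆ s, ∃ (x y : ι → ℕ) (f : ι → β),
      (∀ i ∈ A, f i ∈ F ∧ (⟨x i, y i, w i, h i⟩ : Rg).Sub (bx (f i))) ∧
      (∀ i ∈ A, ∀ j ∈ A, i ≠ j → (⟨x i, y i, w i, h i⟩ : Rg).CD ⟨x j, y j, w j, h j⟩) ∧
      (A = s ∨ ∑ f ∈ F, ((bx f).w - w0) * ((bx f).h - h0) ≤ ∑ i ∈ A, w i * h i) := by
    clear harea
    induction F using Finset.induction_on with
    | empty => exact ⟨∅, by simp, fun _ => 0, fun _ => 0, fun _ => Classical.arbitrary β, by simp, by simp, by simp⟩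
    | insert b F hb ih =>
      obtain ⟨A, hA, x, y, f, h1, h2, h3⟩ := ih (fun f hf f' hf' => hd f (Finset.mem_insert_of_mem hf) f' (Finset.mem_insert_of_mem hf'))
      obtain ⟨A', hA', x', y', g1, g2, g3⟩ := nfdh w h w0 (bx b).w (s \ A).card (s \ A) (bx b).h h0 le_rfl
        (fun i hi => (hw i (Finset.mem_sdiff.1 hi).1).2) (fun i hi => (hh i (Finset.mem_sdiff.1 hi).1).2)
      have hnA : ∀ i ∈ A', i ∉ A := fun i hi => (Finset.mem_sdiff.1 (hA' hi)).2
      have hsubA' : ∀ i ∈ A', (⟨(bx b).x + x' i, (bx b).y + y' i, w i, h i⟩ : Rg).Sub (bx b) := by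
        intro i hi q r hm
        have := g1 i hi
        simp only [Rg.Mem] at hm ⊢
        omega
      refine ⟨A ∪ A', Finset.union_subset hA (hA'.trans Finset.sdiff_subset),
        fun i => if i ∈ A then x i else (bx b).x + x' i, fun i => if i ∈ A then y i else (bx b).y + y' i,
        fun i => if i ∈ A then f i else b, ?_, ?_, ?_⟩
      · intro i hi
        by_cases hiA : i ∈ A
        · simp only [hiA, if_true]
          exact ⟨Finset.mem_insert_of_mem (h1 i hiA).1, (h1 i hiA).2⟩
        · simp only [hiA, if_false]
          exact ⟨Finset.mem_insert_self _ _, hsubA' i (by simpa [hiA] using hi)⟩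
      · intro i hi j hj hij
        by_cases hiA : i ∈ A
        · by_cases hjA : j ∈ A
          · simp only [hiA, hjA, if_true]
            exact h2 i hiA j hjA hij
          · simp only [hiA, hjA, if_true, if_false]
            have hne : f i ≠ b := fun h => hb (h ▸ (h1 i hiA).1)
            exact (hd (f i) (Finset.mem_insert_of_mem (h1 i hiA).1) b (Finset.mem_insert_self _ _) hne).mono
              (h1 i hiA).2 (hsubA' j (by simpa [hjA] using hj))
        · by_cases hjA : j ∈ A
          · simp only [hiA, hjA, if_true, if_false]
            have hne : b ≠ f j := fun h => hb (h ▸ (h1 j hjA).1)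
            exact (hd b (Finset.mem_insert_self _ _) (f j) (Finset.mem_insert_of_mem (h1 j hjA).1) hne).mono
              (hsubA' i (by simpa [hiA] using hi)) (h1 j hjA).2
          · simp only [hiA, hjA, if_false]
            have := g2 i (by simpa [hiA] using hi) j (by simpa [hjA] using hj) hij
            apply Rg.CD.of_rect
            simp only [RectDisjoint] at this ⊢
            omega
      · rcases h3 with h3 | h3
        · left
          have : A' ⊆ A := by
            intro i hi
            rw [h3]; exact (Finset.mem_sdiff.1 (hA' hi)).1
          rw [Finset.union_eq_left.2 this, h3]
        · rcases g3 with g3 | g3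
          · left; rw [g3]; exact Finset.union_sdiff_of_subset hA
          · right
            rw [Finset.sum_insert hb, Finset.sum_union (by
              rw [Finset.disjoint_right]; exact hnA)]
            omega
  obtain ⟨A, hA, x, y, f, h1, h2, h3⟩ := main
  have hAs : A = s := by
    rcases h3 with h3 | h3
    · exact h3
    · by_contra hne
      obtain ⟨j, hj, hjA⟩ := Finset.exists_of_ssubset (Finset.ssubset_iff_subset_ne.2 ⟨hA, hne⟩)
      have : ∑ i ∈ A, w i * h i < ∑ i ∈ s, w i * h i :=
        Finset.sum_lt_sum_of_subset hA hj hjA (Nat.mul_pos (hw j hj).1 (hh j hj).1) (fun _ _ _ => Nat.zero_le _)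
      omega
  subst hAs
  exact ⟨x, y, f, h1, h2⟩


theorem rounding_core {ι : Type} (r : ι → Rg) (V : ι → Prop) (φ : ℕ → ℕ) (g H : ℕ) (hg : 0 < g)
    (hφ : ∀ y h, φ y + h ≤ φ (y + h)) (hpos : ∀ i, 0 < (r i).w ∧ 0 < (r i).h)
    (hV : ∀ i, V i → g * ((φ (r i).y + g - 1) / g) + (r i).h ≤ g * (φ ((r i).y + (r i).h) / g))
    (hin : ∀ i, (r i).y + (r i).h ≤ H)
    (hd : ∀ i j, i ≠ j → (r i).CD (r j)) :
    ∃ (r' : ι → Rg) (a b : ι → ℕ), (∀ i, (r' i).x = (r i).x ∧ (r' i).w = (r i).w ∧ (r i).h ≤ (r' i).h ∧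
      (r' i).y + (r' i).h ≤ φ H ∧ (¬ V i → (r' i).h = (r i).h) ∧
      (V i → a i < b i ∧ (r' i).y = g * a i ∧ (r' i).y + (r' i).h = g * b i)) ∧
      (∀ i j, i ≠ j → (r' i).CD (r' j)) := by
  have hmono : ∀ y y', y ≤ y' → φ y ≤ φ y' := by
    intro y y' h
    have := hφ y (y' - y)
    rw [Nat.add_sub_cancel' h] at this
    omega
  set a : ι → ℕ := fun i => (φ (r i).y + g - 1) / g with ha
  set b : ι → ℕ := fun i => φ ((r i).y + (r i).h) / g with hb
  set r' : ι → Rg := fun i => if V i then ⟨(r i).x, g * a i, (r i).w, g * b i - g * a i⟩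
    else ⟨(r i).x, φ (r i).y, (r i).w, (r i).h⟩ with hr'
  have key : ∀ i, (r' i).x = (r i).x ∧ (r' i).w = (r i).w ∧ (r i).h ≤ (r' i).h ∧
      φ (r i).y ≤ (r' i).y ∧ (r' i).y + (r' i).h ≤ φ ((r i).y + (r i).h) ∧ (¬ V i → (r' i).h = (r i).h) ∧
      (V i → a i < b i ∧ (r' i).y = g * a i ∧ (r' i).y + (r' i).h = g * b i) := by
    intro i
    by_cases h : V i
    · have h1 := hV i h
      have h2 : g * b i ≤ φ ((r i).y + (r i).h) := Nat.mul_div_le _ _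
      have h3 : φ (r i).y ≤ g * a i := by
        have := Nat.lt_mul_div_succ (φ (r i).y + g - 1) hg
        rw [mul_add] at this
        simp only [ha]; omega
      have h4 : g * a i + (r i).h ≤ g * b i := h1
      have h5 : a i < b i := by
        have := (hpos i).2
        exact lt_of_mul_lt_mul_left (a := g) (by omega) (Nat.zero_le _)
      simp only [hr', h, if_true]
      refine ⟨trivial, trivial, by omega, h3, by omega, by simp, fun _ => ⟨h5, trivial, by omega⟩⟩
    · simp only [hr', h, if_false]
      exact ⟨trivial, trivial, le_rfl, le_rfl, hφ _ _, by simp, by simp⟩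
  refine ⟨r', a, b, fun i => ?_, ?_⟩
  · obtain ⟨k1, k2, k3, k4, k5, k6, k7⟩ := key i
    exact ⟨k1, k2, k3, k5.trans (hmono _ _ (hin i)), k6, k7⟩
  · intro i j hij
    apply Rg.CD.of_rect
    have h1 := (hd i j hij).rect (hpos i).1 (hpos i).2 (hpos j).1 (hpos j).2
    obtain ⟨k1, k2, k3, k4, k5, k6, k7⟩ := key i
    obtain ⟨l1, l2, l3, l4, l5, l6, l7⟩ := key j
    unfold RectDisjoint at *
    rw [k1, k2, l1, l2]
    rcases h1 with h | h | h | h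
    · exact Or.inl h
    · exact Or.inr (Or.inl h)
    · right; right; left
      have := hmono _ _ h
      omega
    · right; right; right
      have := hmono _ _ h
      omega

theorem rounding {ι : Type} (e d W H : ℕ) (he : 0 < e) (hd0 : 0 < d) (hH : 0 < H) (r : ι → Rg)
    (hpos : ∀ i, 0 < (r i).w ∧ 0 < (r i).h)
    (hin : ∀ i, (r i).x + (r i).w ≤ W ∧ (r i).y + (r i).h ≤ H)
    (hd : ∀ i j, i ≠ j → (r i).CD (r j)) :
    ∃ (g H1 : ℕ) (r' : ι → Rg) (a b : ι → ℕ), 0 < g ∧ H ≤ H1 ∧ e * H1 ≤ (e + 1) * H ∧ H1 ≤ g * (16 * d * e) ∧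
      (∀ i, (r' i).x = (r i).x ∧ (r' i).w = (r i).w ∧ (r i).h ≤ (r' i).h ∧
      (r' i).y + (r' i).h ≤ H1 ∧ (¬ (H < d * (r i).h) → (r' i).h = (r i).h) ∧
      ((H < d * (r i).h) → a i < b i ∧ (r' i).y = g * a i ∧ (r' i).y + (r' i).h = g * b i)) ∧
      (∀ i j, i ≠ j → (r' i).CD (r' j)) := by
  set q := H / d with hq
  set g := q / (2 * e) with hg
  have hq1 : H < d * (q + 1) := Nat.lt_mul_div_succ H hd0
  have hg1 : q < 2 * e * (g + 1) := Nat.lt_mul_div_succ q (by omega)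
  by_cases hg0 : g = 0
  · obtain ⟨r', a, b, h1, h2⟩ := rounding_core r (fun i => H < d * (r i).h) id 1 H (by norm_num)
      (by simp) hpos (by simp) (fun i => (hin i).2) hd
    refine ⟨1, H, r', a, b, by norm_num, le_rfl, by nlinarith, ?_, h1, h2⟩
    rw [hg0] at hg1
    have : d * (q + 1) ≤ d * (2 * e) := Nat.mul_le_mul_left _ (by omega)
    nlinarith
  · have hgpos : 0 < g := Nat.pos_of_ne_zero hg0
    have hqpos : 0 < q := by
      by_contra hc
      have : q = 0 := Nat.eq_zero_of_not_pos hc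
      rw [this] at hg
      simp at hg
      omega
    have h2 : 2 * e * g ≤ q := Nat.mul_div_le _ _
    obtain ⟨r', a, b, h3, h4⟩ := rounding_core r (fun i => H < d * (r i).h)
      (fun y => y + 2 * g * (y / q)) g H hgpos
      (by
        intro y h
        have : y / q ≤ (y + h) / q := Nat.div_le_div_right (by omega)
        have := Nat.mul_le_mul_left (2 * g) this
        omega) hpos
      (by
        intro i hi
        have hqh : q ≤ (r i).h := by
          by_contra hc
          have : d * (r i).h ≤ d * q := Nat.mul_le_mul_left _ (by omega)
          have : d * q ≤ H := Nat.mul_div_le _ _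
          omega
        have e1 : (r i).y / q + 1 ≤ ((r i).y + (r i).h) / q := by
          rw [Nat.le_div_iff_mul_le hqpos]
          have := Nat.div_mul_le_self (r i).y q
          rw [add_mul]
          omega
        have e2 := Nat.mul_le_mul_left (2 * g) e1
        rw [mul_add] at e2
        have e3 := Nat.mul_div_le ((r i).y + 2 * g * ((r i).y / q) + g - 1) g
        have e4 := Nat.lt_mul_div_succ ((r i).y + (r i).h + 2 * g * (((r i).y + (r i).h) / q)) hgpos
        rw [mul_add] at e4
        omega) (fun i => (hin i).2) hd
    refine ⟨g, H + 2 * g * (H / q), r', a, b, hgpos, by omega, ?_, ?_, h3, h4⟩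
    · have : H / q * q ≤ H := Nat.div_mul_le_self _ _
      have : H / q * (2 * e * g) ≤ H / q * q := Nat.mul_le_mul_left _ h2
      nlinarith
    · have : H / q * q ≤ H := Nat.div_mul_le_self _ _
      have : H / q * (2 * e * g) ≤ H / q * q := Nat.mul_le_mul_left _ h2
      have h7 : H / q * (2 * g) ≤ H / q * (2 * e * g) := Nat.mul_le_mul_left _ (by nlinarith)
      have h8 : q + 1 ≤ 4 * e * g := by nlinarith
      have h9 : d * (q + 1) ≤ d * (4 * e * g) := Nat.mul_le_mul_left _ h8
      nlinarith


theorem sorted_stack {ι : Type*} (s : Finset ι) (w h : ι → ℕ) :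
    ∃ pos : ι → ℕ, (∀ i ∈ s, pos i + h i ≤ ∑ j ∈ s, h j) ∧
      (∀ i ∈ s, ∀ j ∈ s, i ≠ j → pos i + h i ≤ pos j ∨ pos j + h j ≤ pos i) ∧
      (∀ i ∈ s, ∀ j ∈ s, w j < w i → pos i + h i ≤ pos j) ∧
      (∀ p < ∑ j ∈ s, h j, ∃ i ∈ s, pos i ≤ p ∧ p < pos i + h i) := by
  induction s using Finset.induction_on_min_value w with
  | empty => exact ⟨fun _ => 0, by simp⟩
  | insert a s ha hmin ih =>
    obtain ⟨pos, h1, h2, h3, h4⟩ := ih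
    have hne : ∀ i ∈ s, i ≠ a := fun i hi h => ha (h ▸ hi)
    refine ⟨fun i => if i = a then ∑ j ∈ s, h j else pos i, ?_, ?_, ?_, ?_⟩
    · intro i hi
      rw [Finset.sum_insert ha]
      by_cases hia : i = a
      · subst hia; simp; omega
      · have := h1 i (by simpa [hia] using hi)
        simp [hia]; omega
    · intro i hi j hj hij
      by_cases hia : i = a
      · have hja : j ≠ a := fun h => hij (hia.trans h.symm)
        have := h1 j (by simpa [hja] using hj)
        simp [hia, hja]; omega
      · by_cases hja : j = a
        · have := h1 i (by simpa [hia] using hi)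
          simp [hia, hja]; omega
        · simp only [hia, hja, if_false]
          exact h2 i (by simpa [hia] using hi) j (by simpa [hja] using hj) hij
    · intro i hi j hj hij
      by_cases hia : i = a
      · exfalso
        subst hia
        rcases Finset.mem_insert.1 hj with rfl | hj
        · omega
        · have := hmin j hj; omega
      · by_cases hja : j = a
        · have := h1 i (by simpa [hia] using hi)
          simp [hia, hja]; omega
        · simp only [hia, hja, if_false]
          exact h3 i (by simpa [hia] using hi) j (by simpa [hja] using hj) hij
    · intro p hp
      rw [Finset.sum_insert ha] at hp
      by_cases hps : p < ∑ j ∈ s, h j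
      · obtain ⟨i, hi, h5⟩ := h4 p hps
        exact ⟨i, Finset.mem_insert_of_mem hi, by simpa [hne i hi] using h5⟩
      · exact ⟨a, Finset.mem_insert_self _ _, by simp; omega⟩

theorem sum_union_le' {ι : Type*} (A B : Finset ι) (f : ι → ℕ) :
    ∑ i ∈ A ∪ B, f i ≤ ∑ i ∈ A, f i + ∑ i ∈ B, f i := by
  have := Finset.sum_union_inter (s₁ := A) (s₂ := B) (f := f)
  omega

theorem sum_biUnion_le' {ι β : Type*} (A : Finset β) (D : β → Finset ι) (f : ι → ℕ) :
    ∑ i ∈ A.biUnion D, f i ≤ ∑ k ∈ A, ∑ i ∈ D k, f i := by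
  induction A using Finset.induction_on with
  | empty => simp
  | insert a A ha ih =>
    rw [Finset.biUnion_insert, Finset.sum_insert ha]
    exact (sum_union_le' _ _ _).trans (by omega)

/-- sums over rows regrouped by configuration -/
theorem config_sum {Γ Sg : Type} [DecidableEq Γ] [Fintype Γ] [Fintype Sg] {α : Type*} (rows : Finset α) (cfg : α → Γ)
    (f : Γ → Sg → ℕ) :
    ∑ p : Γ × Sg, (rows.filter (fun y => cfg y = p.1)).card * f p.1 p.2 = ∑ y ∈ rows, ∑ σ, f (cfg y) σ := by
  rw [Fintype.sum_prod_type, Finset.sum_comm]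
  conv_rhs => rw [Finset.sum_comm]
  apply Finset.sum_congr rfl
  intro σ _
  rw [← Finset.sum_fiberwise rows cfg]
  apply Finset.sum_congr rfl
  intro c _
  rw [Finset.card_eq_sum_ones, Finset.sum_mul]
  apply Finset.sum_congr rfl
  intro y hy
  rw [(Finset.mem_filter.1 hy).2]; simp

structure WOut {ι : Type} (s : Finset ι) (r : ι → Rg) (B : Rg) (t M K : ℕ) where
  reg : Fin K → Rg
  c : ι → Fin K
  D : Finset ι
  hD : D ⊆ s
  cd : ∀ k k', k ≠ k' → (reg k).CD (reg k')
  sub : ∀ k, (reg k).Sub B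
  hw : ∀ i ∈ s, i ∉ D → (r i).w ≤ (reg (c i)).w
  hh : ∀ k, ∑ i ∈ s with i ∉ D ∧ c i = k, (r i).h ≤ (reg k).h
  dis : M * ∑ i ∈ D, (r i).h ≤ B.h + M * K * t
  area : ∑ k, (reg k).w * (reg k).h ≤ ∑ i ∈ s, (r i).w * (r i).h

theorem zero_cd_left (a : Rg) (b : Rg) (h : a.w = 0 ∨ a.h = 0) : a.CD b := by
  intro q r h1 _
  unfold Rg.Mem at h1
  omega

theorem wbox (J M : ℕ) (hJ : 0 < J) (hM : 0 < M) : ∃ K : ℕ, 0 < K ∧ ∀ (ι : Type) (s : Finset ι) (r : ι → Rg) (B : Rg) (t : ℕ),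
    (∀ i ∈ s, B.x ≤ (r i).x ∧ (r i).x + (r i).w ≤ B.x + B.w ∧ B.y ≤ (r i).y ∧
      (r i).y + (r i).h ≤ B.y + B.h ∧ 0 < (r i).w ∧ 0 < (r i).h ∧ B.w < J * (r i).w ∧ (r i).h ≤ t) →
    (∀ i ∈ s, ∀ j ∈ s, i ≠ j → (r i).CD (r j)) →
    Nonempty (WOut s r B t M K) := by
  set G := J * M with hG
  have hGpos : 0 < G := Nat.mul_pos hJ hM
  set κ := (Fin J → Fin (G + 1)) × Fin J with hκ
  set Kc := Fintype.card κ with hKc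
  have hKcpos : 0 < Kc := Fintype.card_pos_iff.2 ⟨(fun _ => 0, ⟨0, hJ⟩)⟩
  -- enough regions
  suffices hmain : ∀ (ι : Type) (s : Finset ι) (r : ι → Rg) (B : Rg) (t : ℕ),
      (∀ i ∈ s, B.x ≤ (r i).x ∧ (r i).x + (r i).w ≤ B.x + B.w ∧ B.y ≤ (r i).y ∧
      (r i).y + (r i).h ≤ B.y + B.h ∧ 0 < (r i).w ∧ 0 < (r i).h ∧ B.w < J * (r i).w ∧ (r i).h ≤ t) →
      (∀ i ∈ s, ∀ j ∈ s, i ≠ j → (r i).CD (r j)) →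
      ∃ (reg : κ → Rg) (c : ι → κ) (D : Finset ι), D ⊆ s ∧
        (∀ k k', k ≠ k' → (reg k).CD (reg k')) ∧ (∀ k, (reg k).Sub B) ∧
        (∀ i ∈ s, i ∉ D → (r i).w ≤ (reg (c i)).w) ∧
        (∀ k, ∑ i ∈ s with i ∉ D ∧ c i = k, (r i).h ≤ (reg k).h) ∧
        (M * ∑ i ∈ D, (r i).h ≤ B.h + M * (2 + G * (2 + Kc)) * t) ∧
        (∑ k, (reg k).w * (reg k).h ≤ ∑ i ∈ s, (r i).w * (r i).h) by
    refine ⟨Kc + (2 + G * (2 + Kc)), by omega, ?_⟩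
    intro ι s r B t h1 h2
    obtain ⟨reg, c, D, a1, a2, a3, a4, a5, a6, a7⟩ := hmain ι s r B t h1 h2
    set e : κ ≃ Fin Kc := Fintype.equivFin κ
    set K := Kc + (2 + G * (2 + Kc)) with hK
    set reg' : Fin K → Rg := fun k => if h : (k : ℕ) < Kc then reg (e.symm ⟨k, h⟩) else ⟨0, 0, 0, 0⟩ with hreg'
    have hreg2 : ∀ p : κ, reg' (Fin.castLE (by omega) (e p)) = reg p := by
      intro p
      simp [hreg']
    refine ⟨⟨reg', fun i => Fin.castLE (by omega) (e (c i)), D, a1, ?_, ?_, ?_, ?_, ?_, ?_⟩⟩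
    · intro k k' hkk
      simp only [hreg']
      by_cases h : (k : ℕ) < Kc
      · by_cases h' : (k' : ℕ) < Kc
        · simp only [h, h', dif_pos]
          apply a2
          intro hc
          have := e.symm.injective hc
          apply hkk
          simpa [Fin.ext_iff] using this
        · simp only [h', dif_neg, not_false_eq_true]
          exact (zero_cd_left _ _ (Or.inl rfl)).symm
      · simp only [h, dif_neg, not_false_eq_true]
        exact zero_cd_left _ _ (Or.inl rfl)
    · intro k
      simp only [hreg']
      by_cases h : (k : ℕ) < Kc
      · simp only [h, dif_pos]; exact a3 _
      · simp only [h, dif_neg, not_false_eq_true]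
        intro q r h1
        simp [Rg.Mem] at h1
    · intro i hi hiD
      rw [hreg2]; exact a4 i hi hiD
    · intro k
      by_cases h : (k : ℕ) < Kc
      · have := a5 (e.symm ⟨k, h⟩)
        simp only [hreg', h, dif_pos]
        refine le_trans (Finset.sum_le_sum_of_subset ?_) this
        intro i hi
        simp only [Finset.mem_filter] at hi ⊢
        refine ⟨hi.1, hi.2.1, ?_⟩
        rw [Equiv.eq_symm_apply]
        ext
        simp [← hi.2.2]
      · rw [Finset.sum_eq_zero]
        · exact Nat.zero_le _
        · intro i hi
          simp only [Finset.mem_filter] at hi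
          exfalso; apply h
          rw [← hi.2.2]
          simp
    · refine a6.trans ?_
      have : M * (2 + G * (2 + Kc)) * t ≤ M * K * t := by
        apply Nat.mul_le_mul_right
        apply Nat.mul_le_mul_left
        omega
      omega
    · refine le_trans ?_ a7
      have h5 : ∑ p : κ, (reg p).w * (reg p).h = ∑ k ∈ Finset.univ.image (fun p : κ => (Fin.castLE (by omega) (e p) : Fin K)), (reg' k).w * (reg' k).h := by
        rw [Finset.sum_image]
        · simp only [hreg2]
        · intro p _ p' _ hpp
          exact e.injective (Fin.castLE_injective _ hpp)
      rw [h5]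
      apply le_of_eq
      symm
      apply Finset.sum_subset (Finset.subset_univ _)
      intro k _ hk
      by_cases h : (k : ℕ) < Kc
      · exfalso; apply hk
        rw [Finset.mem_image]
        refine ⟨e.symm ⟨k, h⟩, Finset.mem_univ _, ?_⟩
        ext; simp
      · simp [hreg', h]
  intro ι s r B t hs hcd
  rcases s.eq_empty_or_nonempty with hemp | hne
  · subst hemp
    refine ⟨fun _ => ⟨0, 0, 0, 0⟩, fun _ => (fun _ => 0, ⟨0, hJ⟩), ∅, by simp, ?_, ?_, by simp, by simp, by simp, by simp⟩
    · intro k k' _; exact zero_cd_left _ _ (Or.inl rfl)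
    · intro k q r h1
      simp [Rg.Mem] at h1
  have : Nonempty ι := ⟨hne.choose⟩
  obtain ⟨i0, hi0⟩ := hne
  have ht1 : 1 ≤ t := by have := hs i0 hi0; omega
  have hBw : 0 < B.w := by have := hs i0 hi0; omega
  obtain ⟨pos, hp1, hp2, hp3, hp4⟩ := sorted_stack s (fun i => (r i).w) (fun i => (r i).h)
  set s0 := B.h / M + 1 with hs0
  have hs0M : B.h < M * s0 := Nat.lt_mul_div_succ _ hM
  have hs0M' : M * s0 ≤ B.h + M := by
    have := Nat.mul_div_le B.h M
    rw [hs0, mul_add]; omega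
  set grp : ι → ℕ := fun i => pos i / s0 with hgrp
  have hs0pos : 0 < s0 := Nat.succ_pos _
  have htot : ∑ i ∈ s, (r i).h ≤ J * B.h := by
    have h1 := sum_area_le s r B hcd (fun i hi q r' h => by
      have := hs i hi; unfold Rg.Mem at *; omega)
    have h2 : B.w * ∑ i ∈ s, (r i).h ≤ J * ∑ i ∈ s, (r i).w * (r i).h := by
      rw [Finset.mul_sum, Finset.mul_sum]
      apply Finset.sum_le_sum
      intro i hi
      have := hs i hi
      nlinarith
    have h3 : B.w * ∑ i ∈ s, (r i).h ≤ B.w * (J * B.h) := by nlinarith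
    exact le_of_mul_le_mul_left h3 hBw
  have hgrpG : ∀ i ∈ s, grp i < G := by
    intro i hi
    simp only [hgrp]
    rw [Nat.div_lt_iff_lt_mul hs0pos]
    have h1 := hp1 i hi
    have h2 := hs i hi
    have h3 : J * B.h ≤ J * (M * s0) := Nat.mul_le_mul_left _ hs0M.le
    rw [hG, mul_assoc]
    omega
  have hgrp_w : ∀ i ∈ s, ∀ j ∈ s, grp j < grp i → (r i).w ≤ (r j).w := by
    intro i hi j hj hij
    by_contra hc
    push Not at hc
    have h1 := hp3 i hi j hj hc
    have : grp i ≤ grp j := Nat.div_le_div_right (by omega)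
    omega
  have hgl : ∀ i, grp i * s0 ≤ pos i ∧ pos i < (grp i + 1) * s0 := by
    intro i
    refine ⟨Nat.div_mul_le_self _ _, ?_⟩
    have := Nat.lt_mul_div_succ (pos i) hs0pos
    rw [mul_comm]; exact this
  have hup : ∀ k, ∑ i ∈ s with grp i = k, (r i).h ≤ s0 + t := by
    intro k
    have := sum_card_le (s.filter (fun i => grp i = k)) (fun i => Finset.Ico (pos i) (pos i + (r i).h))
      (Finset.Ico (k * s0) ((k + 1) * s0 + t))
      (by
        intro i hi j hj hij
        have := hp2 i (Finset.mem_filter.1 hi).1 j (Finset.mem_filter.1 hj).1 hij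
        rw [Finset.disjoint_left]
        intro p h1 h2
        simp only [Finset.mem_Ico] at h1 h2
        omega)
      (by
        intro i hi p hp
        obtain ⟨hi, hk⟩ := Finset.mem_filter.1 hi
        have h1 := hgl i
        have h2 := hs i hi
        rw [hk] at h1
        simp only [Finset.mem_Ico] at hp ⊢
        omega)
    simp only [Nat.card_Ico] at this
    have e1 : (k + 1) * s0 + t - k * s0 = s0 + t := by rw [add_mul]; omega
    rw [e1] at this
    refine le_trans (le_of_eq ?_) this
    apply Finset.sum_congr rfl
    intro i _; omega
  have hlow : ∀ k, (∃ i ∈ s, grp i = k + 1) → s0 ≤ ∑ i ∈ s with grp i = k, (r i).h + t := by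
    rintro k ⟨i, hi, hik⟩
    have h1 := hgl i
    rw [hik] at h1
    have h2 := hp1 i hi
    have hsub : Finset.Ico (k * s0 + t) ((k + 1) * s0) ⊆ (s.filter (fun i => grp i = k)).biUnion
        (fun i => Finset.Ico (pos i) (pos i + (r i).h)) := by
      intro p hp
      rw [Finset.mem_Ico] at hp
      obtain ⟨j, hj, h3, h4⟩ := hp4 p (by omega)
      refine Finset.mem_biUnion.2 ⟨j, Finset.mem_filter.2 ⟨hj, ?_⟩, Finset.mem_Ico.2 ⟨h3, h4⟩⟩
      have := hs j hj
      simp only [hgrp]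
      rw [Nat.div_eq_iff hs0pos]
      rw [add_mul] at hp
      omega
    have := (Finset.card_le_card hsub).trans Finset.card_biUnion_le
    simp only [Nat.card_Ico] at this
    have e1 : (k + 1) * s0 - (k * s0 + t) = s0 - t := by rw [add_mul]; omega
    rw [e1] at this
    have e2 : ∑ i ∈ s with grp i = k, (pos i + (r i).h - pos i) = ∑ i ∈ s with grp i = k, (r i).h := by
      apply Finset.sum_congr rfl
      intro i _; omega
    omega
  -- slots
  set Dw := B.w / J + 1 with hDw
  have hDwpos : 0 < Dw := Nat.succ_pos _
  have hDwi : ∀ i ∈ s, Dw ≤ (r i).w := by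
    intro i hi
    have h1 := hs i hi
    have : B.w / J < (r i).w := by
      rw [Nat.div_lt_iff_lt_mul hJ]
      rw [mul_comm]; omega
    omega
  have hslot : ∀ i ∈ s, ((r i).x - B.x) / Dw < J := by
    intro i hi
    rw [Nat.div_lt_iff_lt_mul hDwpos]
    have := hs i hi
    have h2 : B.w < J * Dw := Nat.lt_mul_div_succ _ hJ
    omega
  set slot : ι → Fin J := fun i => if h : ((r i).x - B.x) / Dw < J then ⟨_, h⟩ else ⟨0, hJ⟩ with hslotd
  have hslot_inj : ∀ i ∈ s, ∀ j ∈ s, ∀ y, (r i).y ≤ y → y < (r i).y + (r i).h → (r j).y ≤ y →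
      y < (r j).y + (r j).h → slot i = slot j → i = j := by
    intro i hi j hj y h1 h2 h3 h4 h5
    by_contra hij
    have hc := (hcd i hi j hj hij).rect (by have := hs i hi; omega) (by have := hs i hi; omega)
      (by have := hs j hj; omega) (by have := hs j hj; omega)
    simp only [hslotd, hslot i hi, hslot j hj, dif_pos, Fin.mk.injEq] at h5
    have h6 := hs i hi
    have h7 := hs j hj
    have a1 := Nat.div_mul_le_self ((r i).x - B.x) Dw
    have a2 := Nat.lt_mul_div_succ ((r i).x - B.x) hDwpos
    have a3 := Nat.div_mul_le_self ((r j).x - B.x) Dw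
    have a4 := Nat.lt_mul_div_succ ((r j).x - B.x) hDwpos
    rw [← h5] at a3 a4
    have a5 := hDwi i hi
    have a6 := hDwi j hj
    rw [mul_add, mul_comm Dw] at a2 a4
    unfold RectDisjoint at hc
    omega
  -- configurations
  set Q : ℕ → Fin J → ι → Prop := fun y σ j => j ∈ s ∧ slot j = σ ∧ (r j).y ≤ y ∧ y < (r j).y + (r j).h with hQ
  have hQuniq : ∀ y σ i j, Q y σ i → Q y σ j → i = j := by
    intro y σ i j h1 h2
    exact hslot_inj i h1.1 j h2.1 y h1.2.2.1 h1.2.2.2 h2.2.2.1 h2.2.2.2 (h1.2.1.trans h2.2.1.symm)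
  set jt : ℕ → Fin J → ι := fun y σ => Classical.epsilon (Q y σ) with hjt
  have hjtQ : ∀ y σ, (∃ j, Q y σ j) → Q y σ (jt y σ) := fun y σ h => Classical.epsilon_spec h
  set cfg : ℕ → Fin J → Fin (G + 1) := fun y σ =>
    if (∃ j, Q y σ j) then ⟨min (grp (jt y σ)) G, by omega⟩ else Fin.last G with hcfg
  have hcfgQ : ∀ y σ j, Q y σ j → ((cfg y σ : Fin (G+1)) : ℕ) = grp j := by
    intro y σ j hj
    have h1 : ∃ j, Q y σ j := ⟨j, hj⟩
    have h2 := hQuniq y σ _ _ (hjtQ y σ h1) hj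
    simp only [hcfg, h1, if_true, h2]
    have := hgrpG j hj.1
    omega
  have hcfgN : ∀ y σ, ((cfg y σ : Fin (G+1)) : ℕ) < G → Q y σ (jt y σ) := by
    intro y σ h
    by_contra hc
    have h1 : ¬ ∃ j, Q y σ j := fun h1 => hc (hjtQ y σ h1)
    simp [hcfg, h1] at h
  set rows := Finset.Ico B.y (B.y + B.h) with hrows
  set Nc : (Fin J → Fin (G + 1)) → ℕ := fun c => (rows.filter (fun y => cfg y = c)).card with hNc
  have star : ∀ f : ℕ → ℕ, f G = 0 → ∑ p : κ, Nc p.1 * f (p.1 p.2) = ∑ j ∈ s, (r j).h * f (grp j) := by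
    intro f hf
    have h1 := config_sum rows cfg (fun c σ => f (c σ))
    refine Eq.trans h1 ?_
    have h2 : ∀ y ∈ rows, ∑ σ, f (cfg y σ) = ∑ j ∈ s, if (r j).y ≤ y ∧ y < (r j).y + (r j).h then f (grp j) else 0 := by
      intro y _
      have h3 : ∀ σ, f (cfg y σ) = ∑ j ∈ s, if slot j = σ then (if (r j).y ≤ y ∧ y < (r j).y + (r j).h then f (grp j) else 0) else 0 := by
        intro σ
        by_cases h4 : ∃ j, Q y σ j
        · obtain ⟨j, hj⟩ := h4
          rw [hcfgQ y σ j hj]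
          rw [Finset.sum_eq_single j]
          · simp only [hQ] at hj
            simp [hj]
          · intro i hi hij
            by_contra hc
            apply hij
            apply hQuniq y σ i j _ hj
            refine ⟨hi, ?_⟩
            by_cases h5 : slot i = σ
            · refine ⟨h5, ?_⟩
              by_contra h6
              simp [h6] at hc
            · simp [h5] at hc
          · intro h; exact absurd hj.1 h
        · have h5 : cfg y σ = Fin.last G := by simp only [hcfg, h4, if_false]
          rw [h5]
          simp only [Fin.val_last, hf]
          symm
          apply Finset.sum_eq_zero
          intro j hj
          by_contra hc
          apply h4
          refine ⟨j, hj, ?_⟩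
          by_cases h5 : slot j = σ
          · refine ⟨h5, ?_⟩
            by_contra h6
            simp [h6] at hc
          · simp [h5] at hc
      simp only [h3]
      rw [Finset.sum_comm]
      apply Finset.sum_congr rfl
      intro j _
      simp
    rw [Finset.sum_congr rfl h2, Finset.sum_comm]
    apply Finset.sum_congr rfl
    intro j hj
    rw [← Finset.sum_filter, Finset.sum_const, smul_eq_mul]
    congr 1
    have : rows.filter (fun y => (r j).y ≤ y ∧ y < (r j).y + (r j).h) = Finset.Ico (r j).y ((r j).y + (r j).h) := by
      ext y
      have := hs j hj
      simp only [hrows, Finset.mem_filter, Finset.mem_Ico]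
      omega
    rw [this, Nat.card_Ico]; omega
  -- regions
  set ω : ℕ → ℕ := fun k => (s.filter (fun i => grp i = k)).sup (fun i => (r i).w) with hω
  have hωle : ∀ j ∈ s, ω (grp j + 1) ≤ (r j).w := by
    intro j hj
    apply Finset.sup_le
    intro i hi
    obtain ⟨hi, hik⟩ := Finset.mem_filter.1 hi
    exact hgrp_w i hi j hj (by omega)
  set yrep : (Fin J → Fin (G + 1)) → ℕ := fun c => Classical.epsilon (fun y => y ∈ rows ∧ cfg y = c) with hyrep
  have hyrepS : ∀ c, 0 < Nc c → yrep c ∈ rows ∧ cfg (yrep c) = c := by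
    intro c hc
    obtain ⟨y, hy⟩ := Finset.card_pos.1 hc
    exact Classical.epsilon_spec (p := fun y => y ∈ rows ∧ cfg y = c) ⟨y, Finset.mem_filter.1 hy⟩
  set code := Fintype.equivFin (Fin J → Fin (G + 1)) with hcode
  set base : (Fin J → Fin (G + 1)) → ℕ := fun c => (rows.filter (fun y => code (cfg y) < code c)).card with hbase
  have hbase1 : ∀ c c', code c < code c' → base c + Nc c ≤ base c' := by
    intro c c' h
    simp only [hbase, hNc]
    rw [← Finset.card_union_of_disjoint]
    · apply Finset.card_le_card
      intro y hy
      simp only [Finset.mem_union, Finset.mem_filter] at hy ⊢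
      rcases hy with ⟨h1, h2⟩ | ⟨h1, h2⟩
      · exact ⟨h1, h2.trans h⟩
      · exact ⟨h1, h2 ▸ h⟩
    · rw [Finset.disjoint_left]
      intro y h1 h2
      simp only [Finset.mem_filter] at h1 h2
      rw [h2.2] at h1
      exact lt_irrefl _ h1.2
  have hbase2 : ∀ c, base c + Nc c ≤ B.h := by
    intro c
    simp only [hbase, hNc]
    rw [← Finset.card_union_of_disjoint]
    · have : rows.card = B.h := by simp [hrows]
      rw [← this]
      apply Finset.card_le_card
      intro y hy
      simp only [Finset.mem_union, Finset.mem_filter] at hy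
      rcases hy with h | h
      · exact h.1
      · exact h.1
    · rw [Finset.disjoint_left]
      intro y h1 h2
      simp only [Finset.mem_filter] at h1 h2
      rw [h2.2] at h1
      exact lt_irrefl _ h1.2
  set Ω : ℕ → ℕ := fun k => if k < G then ω (k + 1) else 0 with hΩ
  set reg : κ → Rg := fun p => ⟨(r (jt (yrep p.1) p.2)).x, B.y + base p.1, Ω (p.1 p.2), Nc p.1⟩ with hreg
  have hregQ : ∀ p : κ, 0 < Nc p.1 → 0 < Ω (p.1 p.2) → Q (yrep p.1) p.2 (jt (yrep p.1) p.2) ∧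
      Ω (p.1 p.2) ≤ (r (jt (yrep p.1) p.2)).w := by
    intro p h1 h2
    have h3 := (hyrepS p.1 h1).2
    have h4 : ((p.1 p.2 : Fin (G+1)) : ℕ) < G := by
      by_contra hc
      simp [hΩ, hc] at h2
    have h5 : Q (yrep p.1) p.2 (jt (yrep p.1) p.2) := by
      apply hcfgN
      rw [h3]; exact h4
    refine ⟨h5, ?_⟩
    have h6 := hcfgQ _ _ _ h5
    rw [h3] at h6
    have h7 : Ω (p.1 p.2) = ω (grp (jt (yrep p.1) p.2) + 1) := by
      simp only [hΩ]
      rw [if_pos h4, h6]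
    rw [h7]
    exact hωle _ h5.1
  -- fill
  have : Nonempty κ := ⟨(fun _ => 0, ⟨0, hJ⟩)⟩
  have hfill := fun k : ℕ => fill (s.filter (fun i => grp i = k + 1)) (fun i => (r i).h) t
    (fun i hi => by have := hs i (Finset.mem_filter.1 hi).1; omega)
    (Finset.univ.filter (fun p : κ => ((p.1 p.2 : Fin (G+1)) : ℕ) = k)) (fun p => Nc p.1)
  choose DD hDDs ff hff1 hff2 hff3 using hfill
  set D0 := s.filter (fun i => grp i = 0) with hD0
  set D : Finset ι := D0 ∪ (Finset.range G).biUnion DD with hDdef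
  have hDD : ∀ i ∈ s, i ∉ D → ∃ k, grp i = k + 1 ∧ k < G ∧ i ∉ DD k := by
    intro i hi hiD
    simp only [hDdef, hD0, Finset.mem_union, Finset.mem_filter, Finset.mem_biUnion, Finset.mem_range, not_or,
      not_and, not_exists] at hiD
    obtain ⟨k, hk⟩ : ∃ k, grp i = k + 1 := ⟨grp i - 1, by have := hiD.1 hi; omega⟩
    have := hgrpG i hi
    exact ⟨k, hk, by omega, hiD.2 k (by omega)⟩
  have hsum : ∀ p : κ, ∑ i ∈ s with i ∉ D ∧ ff (grp i - 1) i = p, (r i).h ≤ Nc p.1 := by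
    intro p
    have := hff2 (p.1 p.2) p (by simp)
    refine le_trans (Finset.sum_le_sum_of_subset ?_) this
    intro i hi
    simp only [Finset.mem_filter] at hi ⊢
    obtain ⟨hi, hiD, hip⟩ := hi
    obtain ⟨k, hk, hkG, hkD⟩ := hDD i hi hiD
    have h1 := hff1 k i (Finset.mem_filter.2 ⟨hi, hk⟩) hkD
    simp only [Finset.mem_filter] at h1
    have h2 : grp i - 1 = k := by omega
    rw [h2] at hip
    rw [hip] at h1
    rw [h1.2]
    exact ⟨⟨hi, hk⟩, hkD, hip⟩
  refine ⟨reg, fun i => ff (grp i - 1) i, D, ?_, ?_, ?_, ?_, ?_, ?_, ?_⟩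
  · apply Finset.union_subset (Finset.filter_subset _ _)
    apply Finset.biUnion_subset.2
    intro k _
    exact (hDDs k).trans (Finset.filter_subset _ _)
  · rintro p p' hpp q y h1 h2
    simp only [Rg.Mem, hreg] at h1 h2
    obtain ⟨q1, q2⟩ := hregQ p (by omega) (by omega)
    obtain ⟨q1', q2'⟩ := hregQ p' (by omega) (by omega)
    have hcc : p.1 = p'.1 := by
      by_contra hc
      have : code p.1 ≠ code p'.1 := fun h => hc (code.injective h)
      rcases lt_or_gt_of_ne this with h | h
      · have := hbase1 _ _ h; omega
      · have := hbase1 _ _ h; omega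
    rw [← hcc] at q1' q2' h2
    have hσ : p.2 ≠ p'.2 := fun h => hpp (Prod.ext hcc h)
    have hj : jt (yrep p.1) p.2 ≠ jt (yrep p.1) p'.2 := by
      intro h
      apply hσ
      have e1 := q1.2.1
      have e2 := q1'.2.1
      rw [← e1, ← e2, h]
    have := hcd _ q1.1 _ q1'.1 hj q (yrep p.1)
    apply this
    · have := q1.2.2
      unfold Rg.Mem; omega
    · have := q1'.2.2
      unfold Rg.Mem; omega
  · intro p q y h1
    simp only [Rg.Mem, hreg] at h1
    obtain ⟨q1, q2⟩ := hregQ p (by omega) (by omega)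
    have := hs _ q1.1
    have := hbase2 p.1
    unfold Rg.Mem
    omega
  · intro i hi hiD
    obtain ⟨k, hk, hkG, hkD⟩ := hDD i hi hiD
    have h1 := hff1 k i (Finset.mem_filter.2 ⟨hi, hk⟩) hkD
    have h2 : grp i - 1 = k := by omega
    simp only [hreg, h2]
    rw [(Finset.mem_filter.1 h1).2]
    simp only [hΩ, hkG, if_true]
    exact Finset.le_sup (f := fun i => (r i).w) (Finset.mem_filter.2 ⟨hi, hk⟩)
  · intro p
    exact hsum p
  · have hk : ∀ k ∈ Finset.range G, ∑ i ∈ DD k, (r i).h ≤ (2 + Kc) * t := by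
      intro k hk
      rcases hff3 k with h | h
      · rw [h]; simp
      · by_cases hex : ∃ i ∈ s, grp i = k + 1
        · have h1 := hlow k hex
          have h2 := hup (k + 1)
          have h3 := star (fun j => if j = k then 1 else 0) (by simp at hk; simp; omega)
          have h4 : ∑ p ∈ Finset.univ.filter (fun p : κ => ((p.1 p.2 : Fin (G+1)) : ℕ) = k), Nc p.1 = ∑ i ∈ s with grp i = k, (r i).h := by
            simp only [mul_ite, mul_one, mul_zero] at h3
            rw [← Finset.sum_filter, ← Finset.sum_filter] at h3
            exact h3
          have h5 : (Finset.univ.filter (fun p : κ => ((p.1 p.2 : Fin (G+1)) : ℕ) = k)).card * t ≤ Kc * t :=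
            Nat.mul_le_mul_right _ (Finset.card_le_univ _)
          rw [add_mul]
          omega
        · have : DD k = ∅ := by
            rw [Finset.eq_empty_iff_forall_notMem]
            intro i hi
            have := Finset.mem_filter.1 (hDDs k hi)
            exact hex ⟨i, this⟩
          rw [this]; simp
    have h1 : ∑ i ∈ D, (r i).h ≤ (s0 + t) + G * ((2 + Kc) * t) := by
      have h2 : ∑ i ∈ D, (r i).h ≤ ∑ i ∈ D0, (r i).h + ∑ i ∈ (Finset.range G).biUnion DD, (r i).h :=
        sum_union_le' _ _ _
      have h3 : ∑ i ∈ (Finset.range G).biUnion DD, (r i).h ≤ ∑ k ∈ Finset.range G, ∑ i ∈ DD k, (r i).h :=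
        sum_biUnion_le' _ _ _
      have h4 := Finset.sum_le_card_nsmul (Finset.range G) _ _ hk
      have h5 := hup 0
      rw [← hD0] at h5
      simp only [Finset.card_range, smul_eq_mul] at h4
      omega
    have h2 := Nat.mul_le_mul_left M h1
    have h3 : M ≤ M * t := Nat.le_mul_of_pos_right _ ht1
    nlinarith
  · have h1 := star Ω (by simp [hΩ])
    have h2 : ∑ p : κ, (reg p).w * (reg p).h = ∑ p : κ, Nc p.1 * Ω (p.1 p.2) := by
      apply Finset.sum_congr rfl
      intro p _
      simp only [hreg]; ring
    rw [h2, h1]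
    apply Finset.sum_le_sum
    intro j hj
    rw [mul_comm]
    apply Nat.mul_le_mul_right
    simp only [hΩ, hgrpG j hj, if_true]
    exact hωle j hj


noncomputable def runL (F : ℕ → Prop) (q : ℕ) : ℕ := sInf {a | ∀ c, a ≤ c → c ≤ q → F c}
noncomputable def runR (F : ℕ → Prop) (W q : ℕ) : ℕ := sInf {b | q ≤ b ∧ (¬ F b ∨ W ≤ b)}

theorem runL_le {F : ℕ → Prop} {a q : ℕ} (h : ∀ c, a ≤ c → c ≤ q → F c) : runL F q ≤ a := Nat.sInf_le h
theorem runL_spec (F : ℕ → Prop) (q : ℕ) : ∀ c, runL F q ≤ c → c ≤ q → F c := by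
  have : runL F q ∈ {a | ∀ c, a ≤ c → c ≤ q → F c} :=
    Nat.sInf_mem ⟨q + 1, fun c h1 h2 => by omega⟩
  exact this
theorem runR_spec (F : ℕ → Prop) (W q : ℕ) (hq : q < W) :
    q ≤ runR F W q ∧ (¬ F (runR F W q) ∨ W ≤ runR F W q) ∧ runR F W q ≤ W := by
  have : runR F W q ∈ {b | q ≤ b ∧ (¬ F b ∨ W ≤ b)} := Nat.sInf_mem ⟨W, hq.le, Or.inr le_rfl⟩
  exact ⟨this.1, this.2, Nat.sInf_le ⟨hq.le, Or.inr le_rfl⟩⟩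
theorem runR_free {F : ℕ → Prop} {W q c : ℕ} (h1 : q ≤ c) (h2 : c < runR F W q) : F c ∧ c < W := by
  by_contra hc
  have : runR F W q ≤ c := Nat.sInf_le ⟨h1, by
    by_cases hF : F c
    · right; by_contra h; exact hc ⟨hF, by omega⟩
    · exact Or.inl hF⟩
  omega
theorem runR_ge {F : ℕ → Prop} {W q b : ℕ} (hq : q < W) (hb : b ≤ W) (h : ∀ c, q ≤ c → c < b → F c) : b ≤ runR F W q := by
  by_contra hc
  obtain ⟨h1, h2, h3⟩ := runR_spec F W q hq
  rcases h2 with h2 | h2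
  · exact h2 (h _ h1 (by omega))
  · omega

theorem run_free {F : ℕ → Prop} {W q c : ℕ} (h1 : runL F q ≤ c) (h2 : c < runR F W q) : F c := by
  rcases le_total c q with h | h
  · exact runL_spec F q c h1 h
  · exact (runR_free h h2).1
theorem run_eq {F : ℕ → Prop} {W q c : ℕ} (hq : q < W) (hF : F q) (h1 : runL F q ≤ c) (h2 : c < runR F W q) :
    runL F c = runL F q ∧ runR F W c = runR F W q := by
  have hR := runR_spec F W q hq
  have hcW : c < W := by omega
  have hLq : runL F q ≤ q := runL_le (fun x h3 h4 => by have : x = q := by omega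
                                                        rw [this]; exact hF)
  constructor
  · apply le_antisymm
    · apply runL_le
      intro x h3 h4
      exact run_free h3 (by omega : x < runR F W q)
    · apply runL_le
      intro x h3 h4
      rcases le_total x c with h5 | h5
      · exact runL_spec F c x h3 h5
      · exact runL_spec F q x (by omega) h4
  · have hRc := runR_spec F W c hcW
    apply le_antisymm
    · by_contra hc
      have h3 := runR_free (F := F) (W := W) (q := c) (c := runR F W q) (by omega) (by omega)
      rcases hR.2.1 with h | h
      · exact h h3.1
      · omega
    · apply runR_ge hcW hR.2.2
      intro x h3 h4
      exact run_free (by omega) h4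

theorem count_wide {ι : Type*} (T : Finset ι) (J W : ℕ) (x w : ι → ℕ)
    (hin : ∀ i ∈ T, x i + w i ≤ W ∧ W < J * w i)
    (hd : ∀ i ∈ T, ∀ j ∈ T, i ≠ j → x i + w i ≤ x j ∨ x j + w j ≤ x i) : T.card ≤ J := by
  rcases T.eq_empty_or_nonempty with h | ⟨i0, hi0⟩
  · simp [h]
  have hW : 0 < W := by
    have := hin i0 hi0
    by_contra hc
    have h2 : w i0 = 0 := by omega
    rw [h2] at this
    omega
  have h1 : ∑ i ∈ T, w i ≤ W := by
    have := sum_card_le T (fun i => Finset.Ico (x i) (x i + w i)) (Finset.range W)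
      (by
        intro i hi j hj hij
        rw [Finset.disjoint_left]
        intro p h1 h2
        simp only [Finset.mem_Ico] at h1 h2
        have := hd i hi j hj hij
        omega)
      (by
        intro i hi p hp
        have := hin i hi
        simp only [Finset.mem_Ico, Finset.mem_range] at *
        omega)
    simpa using this
  have h2 : T.card * W ≤ J * ∑ i ∈ T, w i := by
    rw [Finset.mul_sum, ← smul_eq_mul]
    exact Finset.card_nsmul_le_sum _ _ _ (fun i hi => (hin i hi).2.le)
  have h3 : T.card * W ≤ J * W := by nlinarith
  exact le_of_mul_le_mul_right h3 hW

/-- Wide items output. -/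
structure WTot {ι : Type} [Fintype ι] (r : ι → Rg) (V Wd : ι → Prop) (W H1 M K : ℕ) where
  κo : Type
  κ : Type
  fo : Fintype κo
  fκ : Fintype κ
  cardo : Fintype.card κo ≤ K
  cardk : Fintype.card κ ≤ K
  obs : κo → Rg
  reg : κ → Rg
  c : ι → κ
  D : Finset ι
  hD : ∀ i ∈ D, Wd i
  obsV : ∀ i, V i → ∀ k, (obs k).CD (r i)
  sub : ∀ k, (reg k).w = 0 ∨ ∃ k', (reg k).Sub (obs k')
  cd : ∀ k k', k ≠ k' → (reg k).CD (reg k')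
  inn : ∀ k, (reg k).Sub ⟨0, 0, W, H1⟩
  hw : ∀ i, Wd i → i ∉ D → (r i).w ≤ (reg (c i)).w
  hh : ∀ k, ∑ i with Wd i ∧ i ∉ D ∧ c i = k, (r i).h ≤ (reg k).h
  dis : M * ∑ i ∈ D, (r i).h ≤ H1
  area : ∑ k, (reg k).w * (reg k).h ≤ ∑ i with Wd i, (r i).w * (r i).h

set_option maxHeartbeats 1000000 in
theorem wtotal (J M R : ℕ) (hJ : 0 < J) (hM : 0 < M) : ∃ K : ℕ, ∀ (ι : Type) [Fintype ι] (r : ι → Rg) (V Wd : ι → Prop)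
    (W H1 g : ℕ), 0 < W → 0 < H1 → 0 < g → H1 ≤ g * R →
    (∀ i, 0 < (r i).w ∧ 0 < (r i).h ∧ (r i).x + (r i).w ≤ W ∧ (r i).y + (r i).h ≤ H1) →
    (∀ i j, i ≠ j → (r i).CD (r j)) → (∀ i, V i → ¬ Wd i) → (∀ i, Wd i → W < J * (r i).w) →
    (∀ i, V i → g ∣ (r i).y ∧ g ∣ (r i).y + (r i).h) →
    Nonempty (WTot r V Wd W H1 M K) := by
  obtain ⟨K0, hK0, hbox⟩ := wbox J (2 * J * M) hJ (by positivity)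
  set A := 2 * M * J * (K0 + 1) with hA
  set C := 2 * A + R + 3 with hC
  obtain ⟨N, hN⟩ := threshold J C
  refine ⟨1 + N + (R + 3 + 2 * N) * J * (K0 + 1), ?_⟩
  intro ι _ r V Wd W H1 g hW hH1 hg hHR hin hcd hVW hwide hal
  have hwS : ∑ i with Wd i, (r i).h ≤ J * H1 := by
    have h1 := sum_area_le (Finset.univ.filter Wd) r ⟨0, 0, W, H1⟩ (fun i _ j _ => hcd i j)
      (fun i _ q r' h => by have := hin i; unfold Rg.Mem at *; simp only; omega)
    have h2 : W * ∑ i with Wd i, (r i).h ≤ J * ∑ i with Wd i, (r i).w * (r i).h := by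
      rw [Finset.mul_sum, Finset.mul_sum]
      apply Finset.sum_le_sum
      intro i hi
      have := hwide i (Finset.mem_filter.1 hi).2
      nlinarith
    simp only at h1
    have h3 : W * ∑ i with Wd i, (r i).h ≤ W * (J * H1) := by nlinarith
    exact le_of_mul_le_mul_left h3 hW
  obtain ⟨t, ht1, ht2⟩ := hN ι (Finset.univ.filter Wd) (fun i => (r i).h) H1 hH1 hwS
  rw [Finset.filter_filter] at ht1 ht2
  set Hi := Finset.univ.filter (fun i => Wd i ∧ t < (r i).h) with hHi
  set n := Hi.card with hn
  -- lines
  set Y : Finset ℕ := {0, H1} ∪ ((Finset.range (R + 1)).image (fun k => g * k) ∪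
    (Hi.image (fun i => (r i).y) ∪ Hi.image (fun i => (r i).y + (r i).h))) with hY
  have hYc : Y.card ≤ R + 3 + 2 * n := by
    have h1 := Finset.card_union_le ({0, H1} : Finset ℕ) ((Finset.range (R + 1)).image (fun k => g * k) ∪
      (Hi.image (fun i => (r i).y) ∪ Hi.image (fun i => (r i).y + (r i).h)))
    have h2 := Finset.card_union_le ((Finset.range (R + 1)).image (fun k => g * k))
      (Hi.image (fun i => (r i).y) ∪ Hi.image (fun i => (r i).y + (r i).h))
    have h3 := Finset.card_union_le (Hi.image (fun i => (r i).y)) (Hi.image (fun i => (r i).y + (r i).h))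
    have h4 := Finset.card_image_le (s := Hi) (f := fun i => (r i).y)
    have h5 := Finset.card_image_le (s := Hi) (f := fun i => (r i).y + (r i).h)
    have h6 := Finset.card_image_le (s := Finset.range (R + 1)) (f := fun k => g * k)
    have h7 := Finset.card_le_two (a := 0) (b := H1)
    rw [← hY] at h1
    rw [Finset.card_range] at h6
    omega
  have hY0 : 0 ∈ Y := by simp [hY]
  have hYH : H1 ∈ Y := by simp [hY]
  have hYhi : ∀ i ∈ Hi, (r i).y ∈ Y ∧ (r i).y + (r i).h ∈ Y := by
    intro i hi
    simp only [hY, Finset.mem_union, Finset.mem_image]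
    exact ⟨Or.inr (Or.inr (Or.inl ⟨i, hi, rfl⟩)), Or.inr (Or.inr (Or.inr ⟨i, hi, rfl⟩))⟩
  have hYmul : ∀ z, g ∣ z → z ≤ H1 → z ∈ Y := by
    rintro z ⟨k, rfl⟩ hz
    simp only [hY, Finset.mem_union, Finset.mem_image]
    refine Or.inr (Or.inl ⟨k, ?_, rfl⟩)
    rw [Finset.mem_range]
    have : g * k ≤ g * R := hz.trans hHR
    have := le_of_mul_le_mul_left this hg
    omega
  have hYV : ∀ i, V i → (r i).y ∈ Y ∧ (r i).y + (r i).h ∈ Y := by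
    intro i hi
    have h1 := hal i hi
    have h2 := hin i
    exact ⟨hYmul _ h1.1 (by omega), hYmul _ h1.2 (by omega)⟩
  have hsep : ∀ y < H1, ∀ z ∈ Y, z ≤ lo Y y ∨ hi Y y ≤ z := by
    intro y hy z hz
    rcases le_or_gt z y with h | h
    · exact Or.inl (le_lo hz h)
    · exact Or.inr (hi_le hz h)
  -- free columns
  set Bk : ι → Prop := fun j => V j ∨ j ∈ Hi with hBk
  have hYB : ∀ i, Bk i → (r i).y ∈ Y ∧ (r i).y + (r i).h ∈ Y := by
    rintro i (h | h)
    · exact hYV i h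
    · exact hYhi i h
  set Fr : ℕ → ℕ → Prop := fun y c => ∀ j, Bk j → ¬ (r j).Mem c y with hFr
  have hFr_eq : ∀ y < H1, ∀ y', lo Y y ≤ y' → y' < hi Y y → Fr y' = Fr y := by
    intro y hy y' h1 h2
    funext c
    have e1 := lo_mem hY0 y
    have e2 := hi_mem hYH hy
    apply propext
    simp only [hFr]
    refine forall_congr' fun j => forall_congr' fun hj => not_congr ?_
    obtain ⟨b1, b2⟩ := hYB j hj
    have := hsep y hy _ b1
    have := hsep y hy _ b2
    unfold Rg.Mem
    omega
  -- low items
  set Low := Finset.univ.filter (fun i => Wd i ∧ (r i).h ≤ t) with hLow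
  set D1 := Low.filter (fun i => ∃ l ∈ Y, (r i).y < l ∧ l < (r i).y + (r i).h) with hD1
  set Lw := Low.filter (fun i => ¬ ∃ l ∈ Y, (r i).y < l ∧ l < (r i).y + (r i).h) with hLw
  have hLwW : ∀ i ∈ Lw, Wd i ∧ (r i).h ≤ t ∧ lo Y (r i).y ≤ (r i).y ∧ (r i).y + (r i).h ≤ hi Y (r i).y := by
    intro i hi
    simp only [hLw, hLow, Finset.mem_filter, Finset.mem_univ, true_and] at hi
    refine ⟨hi.1.1, hi.1.2, (lo_mem hY0 _).2, ?_⟩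
    have h1 := hin i
    obtain ⟨h2, h3⟩ := hi_mem hYH (show (r i).y < H1 by omega)
    by_contra hc
    exact hi.2 ⟨_, h2, h3, by omega⟩
  have hD1c : D1.card ≤ Y.card * J := by
    have hsub : D1 ⊆ Y.biUnion (fun l => D1.filter (fun i => (r i).y < l ∧ l < (r i).y + (r i).h)) := by
      intro i hi
      obtain ⟨l, hl, h1⟩ := (Finset.mem_filter.1 hi).2
      exact Finset.mem_biUnion.2 ⟨l, hl, Finset.mem_filter.2 ⟨hi, h1⟩⟩
    refine (Finset.card_le_card hsub).trans (Finset.card_biUnion_le_card_mul _ _ _ ?_)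
    intro l _
    apply count_wide _ J W (fun i => (r i).x) (fun i => (r i).w)
    · intro i hi
      simp only [hD1, hLow, Finset.mem_filter, Finset.mem_univ, true_and] at hi
      exact ⟨(hin i).2.2.1, hwide i hi.1.1.1⟩
    · intro i hi j hj hij
      have h1 := (Finset.mem_filter.1 hi).2
      have h2 := (Finset.mem_filter.1 hj).2
      have h3 := (hcd i j hij).rect (hin i).1 (hin i).2.1 (hin j).1 (hin j).2.1
      unfold RectDisjoint at h3
      omega
  have hD1s : ∑ i ∈ D1, (r i).h ≤ Y.card * J * t := by
    have := Finset.sum_le_card_nsmul D1 (fun i => (r i).h) t (by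
      intro i hi
      simp only [hD1, hLow, Finset.mem_filter, Finset.mem_univ, true_and] at hi
      exact hi.1.2)
    rw [smul_eq_mul] at this
    exact this.trans (Nat.mul_le_mul_right _ hD1c)
  -- boxes
  set box : ι → Rg := fun i => ⟨runL (Fr (r i).y) (r i).x, lo Y (r i).y,
    runR (Fr (r i).y) W (r i).x - runL (Fr (r i).y) (r i).x, hi Y (r i).y - lo Y (r i).y⟩ with hboxd
  have hLwFr : ∀ i ∈ Lw, ∀ c, (r i).x ≤ c → c < (r i).x + (r i).w → Fr (r i).y c := by
    intro i hi c h1 h2 j hj hm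
    have hij : i ≠ j := by
      rintro rfl
      have h3 := hLwW i hi
      rcases hj with hj | hj
      · exact hVW i hj h3.1
      · simp only [hHi, Finset.mem_filter, Finset.mem_univ, true_and] at hj
        omega
    have := (hin i)
    exact hcd i j hij c (r i).y (by unfold Rg.Mem; omega) hm
  have hboxin : ∀ i ∈ Lw, runL (Fr (r i).y) (r i).x ≤ (r i).x ∧ (r i).x + (r i).w ≤ runR (Fr (r i).y) W (r i).x ∧
      runR (Fr (r i).y) W (r i).x ≤ W ∧ (box i).w = runR (Fr (r i).y) W (r i).x - runL (Fr (r i).y) (r i).x := by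
    intro i hi
    have h1 := hin i
    refine ⟨runL_le fun c h2 h3 => ?_, runR_ge (by omega) (by omega) ?_, (runR_spec _ W _ (by omega)).2.2, rfl⟩
    · exact hLwFr i hi c h2 (by omega)
    · exact hLwFr i hi
  have hboxFr : ∀ i ∈ Lw, ∀ c y, (box i).Mem c y → Fr (r i).y c ∧ Fr y = Fr (r i).y ∧ y < H1 ∧ c < W ∧
      lo Y y = lo Y (r i).y ∧ hi Y y = hi Y (r i).y := by
    intro i hi c y hm
    have h1 := hin i
    have h2 := hboxin i hi
    have h3 := hi_le hYH (show (r i).y < H1 by omega)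
    simp only [hboxd, Rg.Mem] at hm
    refine ⟨run_free (W := W) hm.1 (by omega), hFr_eq _ (by omega) y (by omega) (by omega), by omega, by omega, ?_, ?_⟩
    · exact lo_eq_of hY0 (by omega) (by omega)
    · exact hi_eq_of hY0 hYH (show (r i).y < H1 by omega) (by omega) (by omega)
  have hboxeq : ∀ i ∈ Lw, ∀ j ∈ Lw, box i ≠ box j → (box i).CD (box j) := by
    intro i hi j hj hne c y h1 h2
    apply hne
    obtain ⟨a1, a2, a3, a4, a5, a6⟩ := hboxFr i hi c y h1
    obtain ⟨b1, b2, b3, b4, b5, b6⟩ := hboxFr j hj c y h2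
    have hF : Fr (r i).y = Fr (r j).y := a2.symm.trans b2
    have h3 := hin i
    have h4 := hin j
    simp only [hboxd, Rg.Mem] at h1 h2
    have c1 := run_eq (F := Fr (r i).y) (W := W) (q := (r i).x) (c := c) (by omega)
      (hLwFr i hi _ le_rfl (by omega)) (by omega) (by omega)
    have c2 := run_eq (F := Fr (r j).y) (W := W) (q := (r j).x) (c := c) (by omega)
      (hLwFr j hj _ le_rfl (by omega)) (by omega) (by omega)
    rw [← hF] at c2
    simp only [hboxd]
    rw [← hF, ← c1.1, ← c1.2, ← c2.1, ← c2.2, ← a5, ← a6, ← b5, ← b6]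
  set Bx := Lw.image box with hBx
  have hBxi : ∀ b ∈ Bx, ∃ i ∈ Lw, box i = b := fun b hb => Finset.mem_image.1 hb
  have hBxcd : ∀ b ∈ Bx, ∀ b' ∈ Bx, b ≠ b' → b.CD b' := by
    intro b hb b' hb' hne
    obtain ⟨i, hi, rfl⟩ := hBxi b hb
    obtain ⟨j, hj, rfl⟩ := hBxi b' hb'
    exact hboxeq i hi j hj hne
  have hBxin : ∀ b ∈ Bx, b.Sub ⟨0, 0, W, H1⟩ ∧ b.x + b.w ≤ W ∧ W < J * b.w ∧ b.y ∈ Y ∧ 0 < b.h ∧ b.w ≤ W := by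
    intro b hb
    obtain ⟨i, hi, rfl⟩ := hBxi b hb
    have h1 := hboxin i hi
    have h2 := hin i
    have h3 := hwide i (hLwW i hi).1
    have h4 := hLwW i hi
    refine ⟨?_, ?_, ?_, (lo_mem hY0 _).1, ?_, by omega⟩
    · intro c y hm
      have := hboxFr i hi c y hm
      unfold Rg.Mem; simp only; omega
    · simp only [hboxd]; omega
    · have h5 : (r i).w ≤ (box i).w := by omega
      exact lt_of_lt_of_le h3 (Nat.mul_le_mul_left _ h5)
    · simp only [hboxd]; omega
  have hBxc : Bx.card ≤ Y.card * J := by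
    have h1 : Bx.card ≤ J * (Bx.image Rg.y).card := by
      apply Finset.card_le_mul_card_image
      intro l _
      apply count_wide _ J W Rg.x Rg.w
      · intro b hb
        have := hBxin b (Finset.mem_filter.1 hb).1
        exact ⟨this.2.1, this.2.2.1⟩
      · intro b hb b' hb' hne
        obtain ⟨hb, hl⟩ := Finset.mem_filter.1 hb
        obtain ⟨hb', hl'⟩ := Finset.mem_filter.1 hb'
        have h1 := hBxin b hb
        have h2 := hBxin b' hb'
        have hp : 0 < b.w := by
          rcases Nat.eq_zero_or_pos b.w with h | h
          · have := h1.2.2.1; rw [h] at this; omega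
          · exact h
        have hp' : 0 < b'.w := by
          rcases Nat.eq_zero_or_pos b'.w with h | h
          · have := h2.2.2.1; rw [h] at this; omega
          · exact h
        have h3 := (hBxcd b hb b' hb' hne).rect hp h1.2.2.2.2.1 hp' h2.2.2.2.2.1
        unfold RectDisjoint at h3
        omega
    have h2 : (Bx.image Rg.y).card ≤ Y.card := by
      apply Finset.card_le_card
      intro l hl
      obtain ⟨b, hb, rfl⟩ := Finset.mem_image.1 hl
      exact (hBxin b hb).2.2.2.1
    calc _ ≤ _ := h1
      _ ≤ J * Y.card := Nat.mul_le_mul_left _ h2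
      _ = _ := by ring
  have hBxh : ∑ b ∈ Bx, b.h ≤ J * H1 := by
    have h1 := sum_area_le Bx id ⟨0, 0, W, H1⟩ hBxcd (fun b hb => (hBxin b hb).1)
    simp only [id] at h1
    have h2 : W * ∑ b ∈ Bx, b.h ≤ J * ∑ b ∈ Bx, b.w * b.h := by
      rw [Finset.mul_sum, Finset.mul_sum]
      apply Finset.sum_le_sum
      intro b hb
      have := (hBxin b hb).2.2.1
      nlinarith
    have h3 : W * ∑ b ∈ Bx, b.h ≤ W * (J * H1) := by nlinarith
    exact le_of_mul_le_mul_left h3 hW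
  -- apply box lemma
  have hout : ∀ b : Bx, Nonempty (WOut (Lw.filter (fun i => box i = b.1)) r b.1 t (2 * J * M) K0) := by
    rintro ⟨b, hb⟩
    apply hbox
    · intro i hi
      obtain ⟨hi, hib⟩ := Finset.mem_filter.1 hi
      simp only at hib
      have h1 := hin i
      have h2 := hboxin i hi
      have h3 := hLwW i hi
      have h4 := hwide i h3.1
      have h5 := hBxin b hb
      subst hib
      refine ⟨by simp only [hboxd]; omega, by simp only [hboxd]; omega, by simp only [hboxd]; omega, by simp only [hboxd]; omega, by omega, by omega, lt_of_le_of_lt h5.2.2.2.2.2 h4, by omega⟩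
    · intro i _ j _ hij
      exact hcd i j hij
  obtain ⟨out⟩ : Nonempty (∀ b : Bx, _) := ⟨fun b => (hout b).some⟩
  have hK0' : Inhabited (Fin K0) := ⟨⟨0, hK0⟩⟩
  let κo := {i // i ∈ Hi} ⊕ {b // b ∈ Bx}
  let κ := Option ({i // i ∈ Hi} ⊕ ({b // b ∈ Bx} × Fin K0))
  let obs : κo → Rg := fun k => match k with
    | Sum.inl i => r i.1
    | Sum.inr b => b.1
  let reg : κ → Rg := fun k => match k with
    | none => ⟨0, 0, 0, 0⟩
    | some (Sum.inl i) => r i.1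
    | some (Sum.inr p) => (out p.1).reg p.2
  let c : ι → κ := fun i => if h : i ∈ Hi then some (Sum.inl ⟨i, h⟩) else
    if h : box i ∈ Bx then some (Sum.inr (⟨box i, h⟩, (out ⟨box i, h⟩).c i)) else none
  have hc1 : ∀ i (h : i ∈ Hi), c i = some (Sum.inl ⟨i, h⟩) := fun i h => dif_pos h
  have hc2 : ∀ i (_ : i ∉ Hi) (h : box i ∈ Bx), c i = some (Sum.inr (⟨box i, h⟩, (out ⟨box i, h⟩).c i)) :=
    fun i h0 h => (dif_neg h0).trans (dif_pos h)
  set D2 : Finset ι := Finset.univ.biUnion (fun b : Bx => (out b).D) with hD2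
  have hBkCD : ∀ i, Bk i → ∀ b ∈ Bx, b.CD (r i) := by
    intro i hi b hb q y h1 h2
    obtain ⟨j, hj, rfl⟩ := hBxi b hb
    obtain ⟨a1, a2, a3, a4, a5, a6⟩ := hboxFr j hj q y h1
    rw [← a2] at a1
    exact a1 i hi h2
  have hnotD : ∀ i, Wd i → i ∉ D1 ∪ D2 → i ∉ Hi → ∃ h : box i ∈ Bx, i ∈ Lw ∧ i ∉ (out ⟨box i, h⟩).D := by
    intro i hiW hiD hiH
    rw [Finset.mem_union, not_or] at hiD
    have hLi : i ∈ Low := by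
      simp only [hHi, hLow, Finset.mem_filter, Finset.mem_univ, true_and] at hiH ⊢
      refine ⟨hiW, ?_⟩
      by_contra h
      exact hiH ⟨hiW, by omega⟩
    have hLw' : i ∈ Lw := by
      apply Finset.mem_filter.2
      refine ⟨hLi, fun h => hiD.1 (Finset.mem_filter.2 ⟨hLi, h⟩)⟩
    have hb : box i ∈ Bx := Finset.mem_image_of_mem _ hLw'
    refine ⟨hb, hLw', fun h => hiD.2 ?_⟩
    exact Finset.mem_biUnion.2 ⟨⟨box i, hb⟩, Finset.mem_univ _, h⟩
  have hnN : n ≤ N := ht2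
  have hYN : Y.card * J ≤ (R + 3 + 2 * N) * J := Nat.mul_le_mul_right _ (by omega)
  have hBcard : Bx.card ≤ (R + 3 + 2 * N) * J := hBxc.trans hYN
  have hD2s : 2 * J * M * ∑ i ∈ D2, (r i).h ≤ J * H1 + Bx.card * (2 * J * M * K0 * t) := by
    have h1 : ∑ i ∈ D2, (r i).h ≤ ∑ b : Bx, ∑ i ∈ (out b).D, (r i).h := sum_biUnion_le' _ _ _
    calc _ ≤ 2 * J * M * ∑ b : Bx, ∑ i ∈ (out b).D, (r i).h := Nat.mul_le_mul_left _ h1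
      _ = ∑ b : Bx, 2 * J * M * ∑ i ∈ (out b).D, (r i).h := by rw [Finset.mul_sum]
      _ ≤ ∑ b : Bx, (b.1.h + 2 * J * M * K0 * t) := Finset.sum_le_sum fun b _ => (out b).dis
      _ = ∑ b ∈ Bx, b.h + Bx.card * (2 * J * M * K0 * t) := by
        rw [Finset.sum_add_distrib, Finset.sum_const, smul_eq_mul, Finset.card_univ, Fintype.card_coe]
        congr 1
        exact Finset.sum_coe_sort Bx (fun b => b.h)
      _ ≤ _ := by omega
  refine ⟨⟨κo, κ, inferInstance, inferInstance, ?_, ?_, obs, reg, c, D1 ∪ D2, ?_, ?_, ?_, ?_, ?_, ?_, ?_, ?_, ?_⟩⟩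
  · simp only [κo, Fintype.card_sum, Fintype.card_coe]
    have : (R + 3 + 2 * N) * J ≤ (R + 3 + 2 * N) * J * (K0 + 1) := Nat.le_mul_of_pos_right _ (by omega)
    omega
  · simp only [κ, Fintype.card_option, Fintype.card_sum, Fintype.card_prod, Fintype.card_coe, Fintype.card_fin]
    have : Bx.card * K0 ≤ (R + 3 + 2 * N) * J * (K0 + 1) := Nat.mul_le_mul hBcard (by omega)
    omega
  · intro i hi
    rcases Finset.mem_union.1 hi with h | h
    · simp only [hD1, hLow, Finset.mem_filter, Finset.mem_univ, true_and] at h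
      exact h.1.1
    · obtain ⟨b, _, hb⟩ := Finset.mem_biUnion.1 h
      have := Finset.mem_filter.1 ((out b).hD hb)
      exact (hLwW i this.1).1
  · intro i hi k
    rcases k with k | k
    · apply hcd
      intro h
      have h2 := k.2
      simp only [hHi, Finset.mem_filter, Finset.mem_univ, true_and] at h2
      exact hVW i hi (h ▸ h2.1)
    · exact hBkCD i (Or.inl hi) k.1 k.2
  · intro k
    rcases k with _ | k | k
    · left; rfl
    · right; exact ⟨Sum.inl k, fun q y h => h⟩
    · right; exact ⟨Sum.inr k.1, (out k.1).sub k.2⟩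
  · intro k k' hkk
    rcases k with _ | k | ⟨b, k⟩
    · exact zero_cd_left _ _ (Or.inl rfl)
    · rcases k' with _ | k' | ⟨b', k'⟩
      · exact (zero_cd_left _ _ (Or.inl rfl)).symm
      · apply hcd
        intro h
        apply hkk
        rw [Subtype.ext h]
      · exact ((hBkCD k.1 (Or.inr k.2) b'.1 b'.2).symm).mono (fun q y h => h) ((out b').sub k')
    · rcases k' with _ | k' | ⟨b', k'⟩
      · exact (zero_cd_left _ _ (Or.inl rfl)).symm
      · exact ((hBkCD k'.1 (Or.inr k'.2) b.1 b.2)).mono ((out b).sub k) (fun q y h => h)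
      · by_cases hbb : b = b'
        · subst hbb
          apply (out b).cd
          intro h
          apply hkk
          have h' : k = k' := h
          rw [h']
        · have : b.1 ≠ b'.1 := fun h => hbb (Subtype.ext h)
          exact (hBxcd b.1 b.2 b'.1 b'.2 this).mono ((out b).sub k) ((out b').sub k')
  · intro k
    rcases k with _ | k | ⟨b, k⟩
    · intro q y h
      simp [reg, Rg.Mem] at h
    · intro q y h
      have := hin k.1
      simp only [reg, Rg.Mem] at h ⊢
      omega
    · intro q y h
      exact (hBxin b.1 b.2).1 q y ((out b).sub k q y h)
  · intro i hiW hiD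
    by_cases hH : i ∈ Hi
    · simp only [c, hH, dif_pos, reg]; exact le_rfl
    · obtain ⟨hb, hL, hD⟩ := hnotD i hiW hiD hH
      simp only [c, hH, hb, dif_pos, reg, dif_neg, not_false_eq_true]
      exact (out ⟨box i, hb⟩).hw i (Finset.mem_filter.2 ⟨hL, rfl⟩) hD
  · intro k
    rcases k with _ | k | ⟨b, k⟩
    · rw [Finset.sum_eq_zero]
      · intro i hi
        exfalso
        simp only [Finset.mem_filter, Finset.mem_univ, true_and] at hi
        obtain ⟨h1, h2, h3⟩ := hi
        by_cases hH : i ∈ Hi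
        · rw [hc1 i hH] at h3; exact Option.some_ne_none _ h3
        · obtain ⟨hb, hL, hD⟩ := hnotD i h1 h2 hH
          rw [hc2 i hH hb] at h3; exact Option.some_ne_none _ h3
    · have hsub : ∀ i ∈ (Finset.univ.filter (fun i => Wd i ∧ i ∉ D1 ∪ D2 ∧ c i = some (Sum.inl k))), i ∈ ({k.1} : Finset ι) := by
        intro i hi
        simp only [Finset.mem_filter, Finset.mem_univ, true_and] at hi
        obtain ⟨h1, h2, h3⟩ := hi
        by_cases hH : i ∈ Hi
        · rw [hc1 i hH] at h3
          have h4 := Sum.inl.inj (Option.some.inj h3)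
          rw [← h4]; exact Finset.mem_singleton_self _
        · obtain ⟨hb, hL, hD⟩ := hnotD i h1 h2 hH
          rw [hc2 i hH hb] at h3
          exact absurd (Option.some.inj h3) Sum.inr_ne_inl
      have h7 := Finset.sum_le_sum_of_subset (f := fun i => (r i).h) hsub
      rw [Finset.sum_singleton] at h7
      refine le_trans (le_of_eq ?_) h7
      apply Finset.sum_congr _ (fun _ _ => rfl)
      ext i
      simp only [Finset.mem_filter]
    · refine le_trans (Finset.sum_le_sum_of_subset ?_) ((out b).hh k)
      intro i hi
      simp only [Finset.mem_filter, Finset.mem_univ, true_and] at hi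
      obtain ⟨h1, h2, h3⟩ := hi
      by_cases hH : i ∈ Hi
      · rw [hc1 i hH] at h3
        exact absurd (Option.some.inj h3) Sum.inl_ne_inr
      · obtain ⟨hb, hL, hD⟩ := hnotD i h1 h2 hH
        rw [hc2 i hH hb] at h3
        have h6 := Sum.inr.inj (Option.some.inj h3)
        have h4 : (⟨box i, hb⟩ : {b // b ∈ Bx}) = b := congrArg Prod.fst h6
        have h5 : (out ⟨box i, hb⟩).c i = k := congrArg Prod.snd h6
        subst h4
        exact Finset.mem_filter.2 ⟨Finset.mem_filter.2 ⟨hL, rfl⟩, hD, h5⟩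
  · have h1 := sum_union_le' D1 D2 (fun i => (r i).h)
    have h2 : 2 * J * (M * ∑ i ∈ D1 ∪ D2, (r i).h) ≤ 2 * J * H1 := by
      have h3 : 2 * J * M * ∑ i ∈ D1, (r i).h ≤ 2 * J * M * (Y.card * J * t) := Nat.mul_le_mul_left _ hD1s
      have h4 : Bx.card * (2 * J * M * K0 * t) ≤ Y.card * J * (2 * J * M * K0 * t) := Nat.mul_le_mul_right _ hBxc
      have h5 : Y.card * (A * t) ≤ (R + 3 + 2 * n) * (A * t) := Nat.mul_le_mul_right _ hYc
      have h6 : (R + 3 + 2 * n) * (A * t) ≤ C * (C + n) * t := by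
        have : (R + 3 + 2 * n) * A ≤ C * (C + n) := by
          calc _ = (R + 3) * A + (2 * A) * n := by ring
            _ ≤ C * C + C * n := Nat.add_le_add (Nat.mul_le_mul (by omega) (by omega)) (Nat.mul_le_mul_right _ (by omega))
            _ = _ := by ring
        calc _ = (R + 3 + 2 * n) * A * t := by ring
          _ ≤ _ := Nat.mul_le_mul_right _ this
      have h7 : Y.card * (A * t) ≤ H1 := by omega
      have h8 : 2 * J * M * (Y.card * J * t) + Y.card * J * (2 * J * M * K0 * t) = J * (Y.card * (A * t)) := by
        rw [hA]; ring
      have h9 : J * (Y.card * (A * t)) ≤ J * H1 := Nat.mul_le_mul_left _ h7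
      calc 2 * J * (M * ∑ i ∈ D1 ∪ D2, (r i).h) = 2 * J * M * ∑ i ∈ D1 ∪ D2, (r i).h := by ring
        _ ≤ 2 * J * M * (∑ i ∈ D1, (r i).h + ∑ i ∈ D2, (r i).h) := Nat.mul_le_mul_left _ h1
        _ = 2 * J * M * ∑ i ∈ D1, (r i).h + 2 * J * M * ∑ i ∈ D2, (r i).h := by ring
        _ ≤ 2 * J * H1 := by
          have : 2 * J * H1 = J * H1 + J * H1 := by ring
          omega
    exact le_of_mul_le_mul_left h2 (by omega)
  · have h1 : ∑ k : κ, (reg k).w * (reg k).h = ∑ i ∈ Hi, (r i).w * (r i).h +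
        ∑ b : Bx, ∑ k, ((out b).reg k).w * ((out b).reg k).h := by
      rw [Fintype.sum_option, Fintype.sum_sum_type, Fintype.sum_prod_type]
      simp only [reg, zero_mul, zero_add]
      congr 1
      exact Finset.sum_coe_sort Hi (fun i => (r i).w * (r i).h)
    have h2 : ∑ b : Bx, ∑ k, ((out b).reg k).w * ((out b).reg k).h ≤ ∑ i ∈ Lw, (r i).w * (r i).h := by
      calc _ ≤ ∑ b : Bx, ∑ i ∈ Lw.filter (fun i => box i = b.1), (r i).w * (r i).h :=
            Finset.sum_le_sum fun b _ => (out b).area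
        _ = ∑ b ∈ Bx, ∑ i ∈ Lw.filter (fun i => box i = b), (r i).w * (r i).h :=
            Finset.sum_coe_sort Bx (fun b => ∑ i ∈ Lw.filter (fun i => box i = b), (r i).w * (r i).h)
        _ = _ := Finset.sum_fiberwise_of_maps_to (fun i hi => Finset.mem_image_of_mem _ hi) _
    have h3 : ∑ i ∈ Hi, (r i).w * (r i).h + ∑ i ∈ Lw, (r i).w * (r i).h ≤ ∑ i with Wd i, (r i).w * (r i).h := by
      rw [← Finset.sum_union]
      · apply Finset.sum_le_sum_of_subset
        intro i hi
        rcases Finset.mem_union.1 hi with h | h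
        · simp only [hHi, Finset.mem_filter, Finset.mem_univ, true_and] at h ⊢
          exact h.1
        · simp only [Finset.mem_filter, Finset.mem_univ, true_and]
          exact (hLwW i h).1
      · rw [Finset.disjoint_left]
        intro i h1 h2
        have := (hLwW i h2).2.1
        simp only [hHi, Finset.mem_filter, Finset.mem_univ, true_and] at h1
        omega
    calc _ = _ := h1
      _ ≤ _ := by omega


def SS (R : ℕ) (f g : ℕ → ℕ) (cf cg : ℕ → Prop) (x x' : ℕ) : Prop :=
  ¬ cf x ∧ (cg x → ∀ z, x ≤ z → z < x' → f z + g x ≤ R)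

def EE (R : ℕ) (f g : ℕ → ℕ) (cf cg : ℕ → Prop) (x x' : ℕ) : Prop :=
  ¬ cf x' ∧ (cg x' → ∀ z, x ≤ z → z < x' → f z + g (x' - 1) ≤ R)

def AC (R : ℕ) (f g : ℕ → ℕ) (x x' : ℕ) : Prop :=
  ∀ z z', x ≤ z → z < x' → x ≤ z' → z' < x' → f z + g z' ≤ R

def HL (R : ℕ) (f g : ℕ → ℕ) (cf cg : ℕ → Prop) (x x' : ℕ) : Prop :=
  SS R f g cf cg x x' ∧ EE R g f cg cf x x'

def GoodP (R : ℕ) (f g : ℕ → ℕ) (cf cg : ℕ → Prop) (x x' : ℕ) : Prop :=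
  AC R f g x x' ∨ HL R f g cf cg x x' ∨ HL R g f cg cf x x'

theorem AC.swap {R f g x x'} (h : AC R f g x x') : AC R g f x x' := by
  intro z z' h1 h2 h3 h4
  have := h z' z h3 h4 h1 h2
  omega

theorem GoodP.swap {R f g cf cg x x'} (h : GoodP R f g cf cg x x') : GoodP R g f cg cf x x' := by
  rcases h with h | h | h
  · exact Or.inl h.swap
  · exact Or.inr (Or.inr h)
  · exact Or.inr (Or.inl h)

theorem split_HH {R f g cf cg x x'} (hx : x < x') (hfg : ∀ z, f z + g z ≤ R)
    (hcf : ∀ z, cf z → f (z - 1) = f z) (hcg : ∀ z, cg z → g (z - 1) = g z)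
    (h1 : SS R f g cf cg x x') (h2 : EE R f g cf cg x x') :
    ∃ q, x ≤ q ∧ q < x' ∧ (x < q → GoodP R f g cf cg x q) ∧ GoodP R f g cf cg q x' := by
  have hex : ∃ q, x ≤ q ∧ q < x' ∧ ∀ z, x ≤ z → z < x' → g z ≤ g q := by
    obtain ⟨q, hq, hm⟩ := Finset.exists_max_image (Finset.Ico x x') g ⟨x, by simp [hx]⟩
    rw [Finset.mem_Ico] at hq
    exact ⟨q, hq.1, hq.2, fun z a b => hm z (Finset.mem_Ico.2 ⟨a, b⟩)⟩
  obtain ⟨q, ⟨hq1, hq2, hq3⟩, hmin⟩ : ∃ q, (x ≤ q ∧ q < x' ∧ ∀ z, x ≤ z → z < x' → g z ≤ g q) ∧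
      ∀ z, z < q → ¬ (x ≤ z ∧ z < x' ∧ ∀ y, x ≤ y → y < x' → g y ≤ g z) :=
    ⟨Nat.find hex, Nat.find_spec hex, fun z hz => Nat.find_min hex hz⟩
  have hlt : ∀ z, x ≤ z → z < q → g z < g q := by
    intro z h3 h4
    by_contra hc
    apply hmin z h4
    refine ⟨h3, by omega, fun y h5 h6 => ?_⟩
    have := hq3 y h5 h6
    omega
  refine ⟨q, hq1, hq2, ?_, ?_⟩
  · intro hxq
    have hnc : ¬ cg q := by
      intro h
      have h3 := hcg q h
      have := hlt (q - 1) (by omega) (by omega)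
      omega
    refine Or.inr (Or.inl ⟨⟨h1.1, fun h z h3 h4 => h1.2 h z h3 (by omega)⟩, hnc, fun h z h3 h4 => ?_⟩)
    have h5 := hcf q h
    have h6 := hfg q
    have := hlt z h3 h4
    omega
  · rcases Nat.eq_or_lt_of_le hq1 with h | h
    · subst h
      by_cases hc : cg x
      · left
        intro z z' h3 h4 h5 h6
        have := h1.2 hc z h3 h4
        have := hq3 z' h5 h6
        omega
      · exact Or.inr (Or.inr ⟨⟨hc, fun h => absurd h h1.1⟩, h2⟩)
    · have hnc : ¬ cg q := by
        intro h
        have h3 := hcg q h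
        have := hlt (q - 1) (by omega) (by omega)
        omega
      refine Or.inr (Or.inr ⟨⟨hnc, fun hf z h3 h4 => ?_⟩, h2.1, fun hg z h3 h4 => h2.2 hg z (by omega) h4⟩)
      have := hq3 z (by omega) h4
      have := hfg q
      omega

/-- left records -/
noncomputable def LR (X : Finset ℕ) (W : ℕ) (f : ℕ → ℕ) : Finset ℕ :=
  (Finset.range W).filter (fun z => ∀ y, lo X z ≤ y → y < z → f y < f z)

noncomputable def RR (X : Finset ℕ) (W : ℕ) (f : ℕ → ℕ) : Finset ℕ :=
  (Finset.range W).filter (fun z => ∀ y, z < y → y < hi X z → f y < f z)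

theorem LR_card {X : Finset ℕ} {W R : ℕ} (h0 : 0 ∈ X) (f : ℕ → ℕ) (hf : ∀ z, f z ≤ R) :
    (LR X W f).card ≤ X.card * (R + 1) := by
  rw [← Finset.card_range (R + 1), ← Finset.card_product]
  apply Finset.card_le_card_of_injOn (fun z => (lo X z, f z))
  · intro z hz
    simp only [Finset.coe_product, Set.mem_prod, Finset.mem_coe, Finset.mem_range]
    exact ⟨(lo_mem h0 z).1, Nat.lt_succ_of_le (hf z)⟩
  · intro z hz z' hz' he
    simp only [LR, Finset.coe_filter, Set.mem_setOf_eq, Finset.mem_range] at hz hz'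
    simp only [Prod.mk.injEq] at he
    have e1 := (lo_mem h0 z).2
    have e2 := (lo_mem h0 z').2
    rcases lt_trichotomy z z' with h | h | h
    · have := hz'.2 z (by omega) h; omega
    · exact h
    · have := hz.2 z' (by omega) h; omega

theorem RR_card {X : Finset ℕ} {W R : ℕ} (h0 : 0 ∈ X) (hW : W ∈ X) (f : ℕ → ℕ) (hf : ∀ z, f z ≤ R) :
    (RR X W f).card ≤ X.card * (R + 1) := by
  rw [← Finset.card_range (R + 1), ← Finset.card_product]
  apply Finset.card_le_card_of_injOn (fun z => (hi X z, f z))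
  · intro z hz
    simp only [RR, Finset.coe_filter, Set.mem_setOf_eq, Finset.mem_range] at hz
    simp only [Finset.coe_product, Set.mem_prod, Finset.mem_coe, Finset.mem_range]
    exact ⟨(hi_mem hW hz.1).1, Nat.lt_succ_of_le (hf z)⟩
  · intro z hz z' hz' he
    simp only [RR, Finset.coe_filter, Set.mem_setOf_eq, Finset.mem_range] at hz hz'
    simp only [Prod.mk.injEq] at he
    have e1 := (hi_mem hW hz.1).2
    have e2 := (hi_mem hW hz'.1).2
    rcases lt_trichotomy z z' with h | h | h
    · have := hz.2 z' h (by omega); omega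
    · exact h
    · have := hz'.2 z h (by omega); omega

section
variable {R W : ℕ} {X0 X1 : Finset ℕ} {f g : ℕ → ℕ} {cf cg : ℕ → Prop} {x x' : ℕ}

/-- no left record inside implies bound from the prefix -/
theorem noLR_bound (h0 : 0 ∈ X0) (hW : x' ≤ hi X0 x) (hxW : x' ≤ W) (hWX : W ∈ X0)
    (hno : ∀ z ∈ LR X0 W f, x < z → z < x' → False) (M : ℕ)
    (hM : ∀ y, lo X0 x ≤ y → y ≤ x → f y ≤ M) : ∀ z, x ≤ z → z < x' → f z ≤ M := by
  intro z
  induction z using Nat.strong_induction_on with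
  | _ z ih =>
    intro h1 h2
    by_contra hc
    rcases Nat.eq_or_lt_of_le h1 with h | h
    · subst h
      have := hM x (lo_mem h0 x).2 le_rfl
      omega
    · refine hno z ?_ h h2
      have e1 := (lo_mem h0 x).2
      have e : lo X0 z = lo X0 x := lo_eq_of h0 (by omega) (by omega)
      simp only [LR, Finset.mem_filter, Finset.mem_range]
      refine ⟨by omega, fun y h3 h4 => ?_⟩
      rw [e] at h3
      rcases le_or_gt y x with h5 | h5
      · have := hM y h3 h5; omega
      · have := ih y h4 h5.le (by omega); omega

theorem noRR_bound (h0 : 0 ∈ X0) (hx : x < x') (hW : x' ≤ hi X0 x) (hxW : x' ≤ W) (hWX : W ∈ X0)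
    (hno : ∀ z ∈ RR X0 W f, x < z + 1 → z + 1 < x' → False) (M : ℕ)
    (hM : ∀ y, x' - 1 ≤ y → y < hi X0 x → f y ≤ M) : ∀ z, x ≤ z → z < x' → f z ≤ M := by
  have key : ∀ d z, x' - z = d → x ≤ z → z < x' → f z ≤ M := by
    intro d
    induction d using Nat.strong_induction_on with
    | _ d ih =>
      intro z hd h1 h2
      by_contra hc
      rcases Nat.lt_or_ge (z + 1) x' with h | h
      · refine hno z ?_ (by omega) h
        have e1 := (lo_mem h0 x).2
        have e : hi X0 z = hi X0 x := hi_eq_of h0 hWX (by omega) (by omega) (by omega)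
        simp only [RR, Finset.mem_filter, Finset.mem_range]
        refine ⟨by omega, fun y h3 h4 => ?_⟩
        rw [e] at h4
        rcases Nat.lt_or_ge y (x' - 1) with h5 | h5
        · have := ih (x' - y) (by omega) y rfl (by omega) (by omega); omega
        · have := hM y h5 h4; omega
      · have := hM z (by omega) (by omega); omega
  intro z
  exact key _ z rfl

theorem start_L (hx : x < x') (h0 : 0 ∈ X0) (hW : x' ≤ hi X0 x) (hxW : x' ≤ W) (hWX : W ∈ X0)
    (hfg : ∀ z, f z + g z ≤ R) (hcf : ∀ z, cf z → f (z - 1) = f z)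
    (hno : ∀ z ∈ LR X0 W f, x < z → z < x' → False) (hxX : x ∉ X0)
    (hr : x ∈ LR X0 W f) : SS R f g cf cg x x' := by
  simp only [LR, Finset.mem_filter, Finset.mem_range] at hr
  have e1 := lo_mem h0 x
  have e2 : lo X0 x ≠ x := fun h => hxX (h ▸ e1.1)
  refine ⟨fun h => ?_, fun _ z h1 h2 => ?_⟩
  · have := hcf x h
    have := hr.2 (x - 1) (by omega) (by omega)
    omega
  · have := noLR_bound h0 hW hxW hWX hno (f x) (fun y h3 h4 => by
      rcases Nat.eq_or_lt_of_le h4 with h | h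
      · rw [h]
      · exact (hr.2 y h3 h).le) z h1 h2
    have := hfg x
    omega

theorem start_R (hx : x < x') (h0 : 0 ∈ X0) (hW : x' ≤ hi X0 x) (hxW : x' ≤ W) (hWX : W ∈ X0)
    (hfg : ∀ z, f z + g z ≤ R) (hcf : ∀ z, cf z → f (z - 1) = f z) (hcg : ∀ z, cg z → g (z - 1) = g z)
    (hxX : x ∉ X0) (t : ℕ) (ht : x = t + 1)
    (hr : t ∈ RR X0 W f) : SS R f g cf cg x x' := by
  simp only [RR, Finset.mem_filter, Finset.mem_range] at hr
  have e1 := lo_mem h0 x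
  have e2 : lo X0 x ≠ x := fun h => hxX (h ▸ e1.1)
  have e : hi X0 t = hi X0 x := hi_eq_of h0 hWX (by omega) (by omega) (by omega)
  rw [e] at hr
  subst ht
  refine ⟨fun h => ?_, fun h z h1 h2 => ?_⟩
  · have := hcf _ h
    have := hr.2 (t + 1) (by omega) (by omega)
    simp only [Nat.add_sub_cancel] at *
    omega
  · have := hcg _ h
    have := hr.2 z (by omega) (by omega)
    have := hfg t
    simp only [Nat.add_sub_cancel] at *
    omega

theorem end_L (hx : x < x') (h0 : 0 ∈ X0) (hW : x' < hi X0 x) (hWX : W ∈ X0)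
    (hfg : ∀ z, f z + g z ≤ R) (hcf : ∀ z, cf z → f (z - 1) = f z) (hcg : ∀ z, cg z → g (z - 1) = g z)
    (hr : x' ∈ LR X0 W f) : EE R f g cf cg x x' := by
  simp only [LR, Finset.mem_filter, Finset.mem_range] at hr
  have e1 := lo_mem h0 x
  have e : lo X0 x' = lo X0 x := lo_eq_of h0 (by omega) (by omega)
  rw [e] at hr
  refine ⟨fun h => ?_, fun h z h1 h2 => ?_⟩
  · have := hcf _ h
    have := hr.2 (x' - 1) (by omega) (by omega)
    omega
  · have := hcg _ h
    have := hr.2 z (by omega) (by omega)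
    have := hfg x'
    omega

theorem end_R (hx : x < x') (h0 : 0 ∈ X0) (hW : x' < hi X0 x) (hxW : x' ≤ W) (hWX : W ∈ X0)
    (hfg : ∀ z, f z + g z ≤ R) (hcf : ∀ z, cf z → f (z - 1) = f z)
    (hno : ∀ z ∈ RR X0 W f, x < z + 1 → z + 1 < x' → False) (t : ℕ) (ht : x' = t + 1)
    (hr : t ∈ RR X0 W f) : EE R f g cf cg x x' := by
  simp only [RR, Finset.mem_filter, Finset.mem_range] at hr
  have e1 := lo_mem h0 x
  have e : hi X0 t = hi X0 x := hi_eq_of h0 hWX (by omega) (by omega) (by omega)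
  rw [e] at hr
  subst ht
  refine ⟨fun h => ?_, fun h z h1 h2 => ?_⟩
  · have := hcf _ h
    have := hr.2 (t + 1) (by omega) (by omega)
    simp only [Nat.add_sub_cancel] at *
    omega
  · have := noRR_bound h0 hx hW.le hxW hWX hno (f t) (fun y h3 h4 => by
      rcases Nat.eq_or_lt_of_le h3 with h | h
      · simp only [Nat.add_sub_cancel] at h; rw [h]
      · exact (hr.2 y (by omega) h4).le) z h1 h2
    have := hfg t
    simp only [Nat.add_sub_cancel] at *
    omega

end

theorem cuts (R W : ℕ) (X0 : Finset ℕ) (h0 : 0 ∈ X0) (hWX : W ∈ X0) (hX0 : ∀ z ∈ X0, z ≤ W)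
    (f g : ℕ → ℕ) (cf cg : ℕ → Prop) (hfg : ∀ z, f z + g z ≤ R)
    (hcf : ∀ z, cf z → f (z - 1) = f z) (hcg : ∀ z, cg z → g (z - 1) = g z) :
    ∃ X2 : Finset ℕ, X0 ⊆ X2 ∧ (∀ z ∈ X2, z ≤ W) ∧ X2.card ≤ 10 * (R + 1) * X0.card ∧
      ∀ z < W, GoodP R f g cf cg (lo X2 z) (hi X2 z) := by
  set X1 : Finset ℕ := X0 ∪ (LR X0 W f ∪ (LR X0 W g ∪ ((RR X0 W f).image (· + 1) ∪ (RR X0 W g).image (· + 1)))) with hX1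
  have hc1 : X1.card ≤ X0.card + 4 * (X0.card * (R + 1)) := by
    have a1 := LR_card (W := W) h0 f (fun z => (show f z ≤ R by have := hfg z; omega))
    have a2 := LR_card (W := W) h0 g (fun z => (show g z ≤ R by have := hfg z; omega))
    have a3 := RR_card (W := W) h0 hWX f (fun z => (show f z ≤ R by have := hfg z; omega))
    have a4 := RR_card (W := W) h0 hWX g (fun z => (show g z ≤ R by have := hfg z; omega))
    have b1 := Finset.card_union_le X0 (LR X0 W f ∪ (LR X0 W g ∪ ((RR X0 W f).image (· + 1) ∪ (RR X0 W g).image (· + 1))))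
    have b2 := Finset.card_union_le (LR X0 W f) (LR X0 W g ∪ ((RR X0 W f).image (· + 1) ∪ (RR X0 W g).image (· + 1)))
    have b3 := Finset.card_union_le (LR X0 W g) ((RR X0 W f).image (· + 1) ∪ (RR X0 W g).image (· + 1))
    have b4 := Finset.card_union_le ((RR X0 W f).image (· + 1)) ((RR X0 W g).image (· + 1))
    have b5 := Finset.card_image_le (s := RR X0 W f) (f := (· + 1))
    have b6 := Finset.card_image_le (s := RR X0 W g) (f := (· + 1))
    rw [← hX1] at b1
    omega
  have hsub : X0 ⊆ X1 := Finset.subset_union_left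
  have h01 : 0 ∈ X1 := hsub h0
  have hW1 : W ∈ X1 := hsub hWX
  have hmem : ∀ z, z ∈ X1 ↔ z ∈ X0 ∨ z ∈ LR X0 W f ∨ z ∈ LR X0 W g ∨ (∃ t ∈ RR X0 W f, t + 1 = z) ∨
      (∃ t ∈ RR X0 W g, t + 1 = z) := by
    intro z
    simp only [hX1, Finset.mem_union, Finset.mem_image]
  have hX1W : ∀ z ∈ X1, z ≤ W := by
    intro z hz
    rcases (hmem z).1 hz with h | h | h | ⟨t, h, rfl⟩ | ⟨t, h, rfl⟩
    · exact hX0 z h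
    all_goals
      simp only [LR, RR, Finset.mem_filter, Finset.mem_range] at h
      omega
  have hpiece : ∀ z < W, ∃ q, lo X1 z ≤ q ∧ q < hi X1 z ∧ (lo X1 z < q → GoodP R f g cf cg (lo X1 z) q) ∧
      GoodP R f g cf cg q (hi X1 z) := by
    intro z hz
    obtain ⟨a1, a2⟩ := lo_mem h01 z
    obtain ⟨b1, b2⟩ := hi_mem hW1 hz
    set x := lo X1 z with hxd
    set x' := hi X1 z with hxd'
    have hx : x < x' := by omega
    have hno : ∀ y ∈ X1, x < y → y < x' → False := by
      intro y hy h1 h2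
      rcases le_or_gt y z with h | h
      · have := le_lo hy h; omega
      · have := hi_le hy h; omega
    have hx'W := hX1W x' b1
    have hxhi : x' ≤ hi X0 x := by
      obtain ⟨c1, c2⟩ := hi_mem hWX (show x < W by omega)
      by_contra hc
      exact hno _ (hsub c1) c2 (by omega)
    have hfg' : ∀ z, g z + f z ≤ R := fun z => by have := hfg z; omega
    have n1 : ∀ y ∈ LR X0 W f, x < y → y < x' → False := fun y hy => hno y ((hmem y).2 (Or.inr (Or.inl hy)))
    have n2 : ∀ y ∈ LR X0 W g, x < y → y < x' → False := fun y hy => hno y ((hmem y).2 (Or.inr (Or.inr (Or.inl hy))))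
    have n3 : ∀ y ∈ RR X0 W f, x < y + 1 → y + 1 < x' → False :=
      fun y hy => hno (y + 1) ((hmem _).2 (Or.inr (Or.inr (Or.inr (Or.inl ⟨y, hy, rfl⟩)))))
    have n4 : ∀ y ∈ RR X0 W g, x < y + 1 → y + 1 < x' → False :=
      fun y hy => hno (y + 1) ((hmem _).2 (Or.inr (Or.inr (Or.inr (Or.inr ⟨y, hy, rfl⟩)))))
    have hstart : AC R f g x x' ∨ SS R f g cf cg x x' ∨ SS R g f cg cf x x' := by
      by_cases hxX : x ∈ X0
      · left
        have e : lo X0 x = x := le_antisymm (lo_mem h0 x).2 (le_lo hxX le_rfl)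
        intro y y' h1 h2 h3 h4
        have k1 := noLR_bound h0 hxhi hx'W hWX n1 (f x) (fun t h5 h6 => by
          rw [e] at h5; rw [le_antisymm h6 h5]) y h1 h2
        have k2 := noLR_bound h0 hxhi hx'W hWX n2 (g x) (fun t h5 h6 => by
          rw [e] at h5; rw [le_antisymm h6 h5]) y' h3 h4
        have := hfg x
        omega
      · right
        rcases (hmem x).1 a1 with h | h | h | ⟨t, h, ht⟩ | ⟨t, h, ht⟩
        · exact absurd h hxX
        · exact Or.inl (start_L hx h0 hxhi hx'W hWX hfg hcf n1 hxX h)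
        · exact Or.inr (start_L hx h0 hxhi hx'W hWX hfg' hcg n2 hxX h)
        · exact Or.inl (start_R hx h0 hxhi hx'W hWX hfg hcf hcg hxX t ht.symm h)
        · exact Or.inr (start_R hx h0 hxhi hx'W hWX hfg' hcg hcf hxX t ht.symm h)
    have hend : AC R f g x x' ∨ EE R f g cf cg x x' ∨ EE R g f cg cf x x' := by
      by_cases hxX : x' = hi X0 x
      · left
        intro y y' h1 h2 h3 h4
        have k1 := noRR_bound h0 hx hxhi hx'W hWX n3 (f (x' - 1)) (fun t h5 h6 => by
          rw [← hxX] at h6; rw [show t = x' - 1 by omega]) y h1 h2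
        have k2 := noRR_bound h0 hx hxhi hx'W hWX n4 (g (x' - 1)) (fun t h5 h6 => by
          rw [← hxX] at h6; rw [show t = x' - 1 by omega]) y' h3 h4
        have := hfg (x' - 1)
        omega
      · right
        have hlt : x' < hi X0 x := by omega
        rcases (hmem x').1 b1 with h | h | h | ⟨t, h, ht⟩ | ⟨t, h, ht⟩
        · have := hi_le h hx
          omega
        · exact Or.inl (end_L hx h0 hlt hWX hfg hcf hcg h)
        · exact Or.inr (end_L hx h0 hlt hWX hfg' hcg hcf h)
        · exact Or.inl (end_R hx h0 hlt hx'W hWX hfg hcf n3 t ht.symm h)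
        · exact Or.inr (end_R hx h0 hlt hx'W hWX hfg' hcg n4 t ht.symm h)
    rcases hstart with hs | hs | hs
    · exact ⟨x, le_rfl, hx, fun h => absurd h (lt_irrefl _), Or.inl hs⟩
    · rcases hend with he | he | he
      · exact ⟨x, le_rfl, hx, fun h => absurd h (lt_irrefl _), Or.inl he⟩
      · exact split_HH hx hfg hcf hcg hs he
      · exact ⟨x, le_rfl, hx, fun h => absurd h (lt_irrefl _), Or.inr (Or.inl ⟨hs, he⟩)⟩
    · rcases hend with he | he | he
      · exact ⟨x, le_rfl, hx, fun h => absurd h (lt_irrefl _), Or.inl he⟩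
      · exact ⟨x, le_rfl, hx, fun h => absurd h (lt_irrefl _), Or.inr (Or.inr ⟨hs, he⟩)⟩
      · obtain ⟨q, q1, q2, q3, q4⟩ := split_HH hx hfg' hcg hcf hs he
        exact ⟨q, q1, q2, fun h => (q3 h).swap, q4.swap⟩
  choose! q hq1 hq2 hq3 hq4 using hpiece
  have hlt1 : ∀ x ∈ X1.erase W, x < W := by
    intro x hx
    have := hX1W x (Finset.mem_of_mem_erase hx)
    have := Finset.ne_of_mem_erase hx
    omega
  set X2 := X1 ∪ (X1.erase W).image q with hX2
  have hm2 : ∀ y ∈ X2, y ∈ X1 ∨ ∃ x ∈ X1, x < W ∧ q x = y := by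
    intro y hy
    rcases Finset.mem_union.1 hy with h | h
    · exact Or.inl h
    · obtain ⟨x, hx, rfl⟩ := Finset.mem_image.1 h
      exact Or.inr ⟨x, Finset.mem_of_mem_erase hx, hlt1 x hx, rfl⟩
  have hlox : ∀ x ∈ X1, lo X1 x = x := fun x hx => le_antisymm (lo_mem h01 x).2 (le_lo hx le_rfl)
  have h12 : X1 ⊆ X2 := Finset.subset_union_left
  refine ⟨X2, hsub.trans h12, ?_, ?_, ?_⟩
  · intro y hy
    rcases hm2 y hy with h | ⟨x, hx, hxW, rfl⟩
    · exact hX1W y h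
    · have := hq2 x hxW
      have := hX1W _ (hi_mem hW1 hxW).1
      omega
  · have b1 := Finset.card_union_le X1 ((X1.erase W).image q)
    have b2 := Finset.card_image_le (s := X1.erase W) (f := q)
    have b3 := Finset.card_erase_le (s := X1) (a := W)
    rw [← hX2] at b1
    have : X2.card ≤ 2 * (X0.card + 4 * (X0.card * (R + 1))) := by omega
    nlinarith
  · intro z hz
    obtain ⟨a1, a2⟩ := lo_mem h01 z
    obtain ⟨b1, b2⟩ := hi_mem hW1 hz
    set x := lo X1 z with hxd
    set x' := hi X1 z with hxd'
    have hxW : x < W := by omega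
    have hx'W := hX1W x' b1
    have e1 : lo X1 x = x := hlox x a1
    have e2 : hi X1 x = x' := hi_eq_of h01 hW1 hz (by omega) (by omega)
    have p1 := hq1 x hxW
    have p2 := hq2 x hxW
    have p3 := hq3 x hxW
    have p4 := hq4 x hxW
    rw [e1] at p1 p3
    rw [e2] at p2 p4
    have hqm : q x ∈ X2 := by
      apply Finset.mem_union_right
      exact Finset.mem_image_of_mem _ (Finset.mem_erase.2 ⟨by omega, a1⟩)
    have hno : ∀ y ∈ X2, x < y → y < x' → y = q x := by
      intro y hy h1 h2
      have hno1 : ∀ y ∈ X1, x < y → y < x' → False := by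
        intro y hy h1 h2
        rcases le_or_gt y z with h | h
        · have := le_lo hy h; omega
        · have := hi_le hy h; omega
      rcases hm2 y hy with h | ⟨t, ht, htW, rfl⟩
      · exact (hno1 y h h1 h2).elim
      · have r1 := hq1 t htW
        have r2 := hq2 t htW
        rw [hlox t ht] at r1
        rcases lt_trichotomy t x with h | h | h
        · have := hi_le a1 h
          omega
        · rw [h]
        · exact (hno1 t ht h (by omega)).elim
    have h02 : 0 ∈ X2 := h12 h01
    have hW2 : W ∈ X2 := h12 hW1
    obtain ⟨c1, c2⟩ := lo_mem h02 z
    obtain ⟨d1, d2⟩ := hi_mem hW2 hz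
    have f1 := le_lo (h12 a1) a2
    have f2 := hi_le (h12 b1) b2
    rcases Nat.lt_or_ge z (q x) with h | h
    · have g1 : lo X2 z = x := by
        rcases Nat.eq_or_lt_of_le f1 with h' | h'
        · exact h'.symm
        · have := hno _ c1 h' (by omega)
          omega
      have g2 : hi X2 z = q x := by
        have := hi_le hqm h
        exact hno _ d1 (by omega) (by omega)
      rw [g1, g2]
      exact p3 (by omega)
    · have g1 : lo X2 z = q x := by
        have := le_lo hqm h
        rcases Nat.eq_or_lt_of_le f1 with h' | h'
        · omega
        · exact hno _ c1 h' (by omega)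
      have g2 : hi X2 z = x' := by
        rcases Nat.eq_or_lt_of_le f2 with h' | h'
        · exact h'
        · have := hno _ d1 (by omega) h'
          omega
      rw [g1, g2]
      exact p4


noncomputable def cnt (P : Finset ℕ) (κ : ℕ → ℕ) (k : ℕ) : ℕ := (P.filter (fun z => κ z < k)).card
noncomputable def cntE (P : Finset ℕ) (κ : ℕ → ℕ) (k : ℕ) : ℕ := (P.filter (fun z => κ z = k)).card

theorem cnt_succ (P κ k) : cnt P κ (k + 1) = cnt P κ k + cntE P κ k := by
  unfold cnt cntE
  rw [← Finset.card_union_of_disjoint]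
  · congr 1
    ext z
    simp only [Finset.mem_filter, Finset.mem_union, Nat.lt_succ_iff_lt_or_eq]
    tauto
  · rw [Finset.disjoint_left]
    intro z h1 h2
    simp only [Finset.mem_filter] at h1 h2
    omega

theorem cnt_mono (P κ) {k l : ℕ} (h : k ≤ l) : cnt P κ k ≤ cnt P κ l := by
  apply Finset.card_le_card
  intro z hz
  simp only [Finset.mem_filter] at *
  exact ⟨hz.1, by omega⟩

theorem cnt_le (P κ k) : cnt P κ k ≤ P.card := Finset.card_filter_le _ _

theorem cnt_all {P : Finset ℕ} {κ : ℕ → ℕ} {K : ℕ} (h : ∀ z ∈ P, κ z < K) : cnt P κ K = P.card := by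
  unfold cnt
  rw [Finset.filter_true_of_mem h]

theorem cnt_zero (P κ) : cnt P κ 0 = 0 := by simp [cnt]

theorem run_mem {P κ k q} (h1 : cnt P κ k ≤ q) (h2 : q < cnt P κ (k + 1)) : ∃ z ∈ P, κ z = k := by
  rw [cnt_succ] at h2
  have : 0 < cntE P κ k := by omega
  obtain ⟨z, hz⟩ := Finset.card_pos.1 this
  exact ⟨z, (Finset.mem_filter.1 hz).1, (Finset.mem_filter.1 hz).2⟩

theorem run_unique {P κ k k' q} (h1 : cnt P κ k ≤ q) (h2 : q < cnt P κ (k + 1))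
    (h3 : cnt P κ k' ≤ q) (h4 : q < cnt P κ (k' + 1)) : k = k' := by
  rcases lt_trichotomy k k' with h | h | h
  · have := cnt_mono P κ (show k + 1 ≤ k' by omega); omega
  · exact h
  · have := cnt_mono P κ (show k' + 1 ≤ k by omega); omega

theorem cnt_div {P : Finset ℕ} {κ κ' : ℕ → ℕ} {T : ℕ} (hT : 0 < T) (h : ∀ z ∈ P, κ' z = κ z / T) (k : ℕ) :
    cnt P κ' k = cnt P κ (k * T) := by
  unfold cnt
  congr 1
  apply Finset.filter_congr
  intro z hz
  rw [h z hz, Nat.div_lt_iff_lt_mul hT]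

theorem run_div {P : Finset ℕ} {κ κ' : ℕ → ℕ} {T : ℕ} (hT : 0 < T) (h : ∀ z ∈ P, κ' z = κ z / T) (k : ℕ) :
    cnt P κ' (k / T) ≤ cnt P κ k ∧ cnt P κ (k + 1) ≤ cnt P κ' (k / T + 1) := by
  rw [cnt_div hT h, cnt_div hT h]
  refine ⟨cnt_mono _ _ (Nat.div_mul_le_self k T), cnt_mono _ _ ?_⟩
  have := Nat.lt_div_mul_add (a := k) hT
  rw [Nat.add_mul, one_mul]
  omega

noncomputable def rk (P : Finset ℕ) (kB : ℕ → ℕ) (j z0 : ℕ) : ℕ := (P.filter (fun x => x < z0 ∧ kB x = j)).card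
noncomputable def CC (P : Finset ℕ) (kA kB : ℕ → ℕ) (j k : ℕ) : ℕ := (P.filter (fun x => kB x = j ∧ kA x < k)).card

theorem CC_mono (P kA kB j) {k l : ℕ} (h : k ≤ l) : CC P kA kB j k ≤ CC P kA kB j l := by
  apply Finset.card_le_card
  intro z hz
  simp only [Finset.mem_filter] at *
  exact ⟨hz.1, hz.2.1, by omega⟩

theorem CC_le (P kA kB j k) : CC P kA kB j k ≤ cntE P kB j := by
  apply Finset.card_le_card
  intro z hz
  simp only [Finset.mem_filter] at *
  exact ⟨hz.1, hz.2.1⟩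

noncomputable def gam (P : Finset ℕ) (kA kB zB : ℕ → ℕ) (N z : ℕ) : ℕ :=
  if kB z = 0 then 0 else if kB z = N - 1 then N else
    sInf {k | rk P kB (kB z) (zB z) < CC P kA kB (kB z) (k + 1)}

theorem rk_lt {P : Finset ℕ} {kB : ℕ → ℕ} {z z' : ℕ} (hz : z ∈ P) (h : z < z') :
    rk P kB (kB z) z < rk P kB (kB z) z' := by
  apply Finset.card_lt_card
  rw [Finset.ssubset_iff_of_subset]
  · exact ⟨z, by simp [hz, h], by simp⟩
  · intro x hx
    simp only [Finset.mem_filter] at *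
    exact ⟨hx.1, by omega, hx.2.2⟩

theorem rk_mono (P : Finset ℕ) (kB : ℕ → ℕ) (j : ℕ) {z z' : ℕ} (h : z ≤ z') : rk P kB j z ≤ rk P kB j z' := by
  apply Finset.card_le_card
  intro x hx
  simp only [Finset.mem_filter] at *
  exact ⟨hx.1, by omega, hx.2.2⟩

theorem rk_lt_card {P : Finset ℕ} {kB : ℕ → ℕ} {z : ℕ} (hz : z ∈ P) :
    rk P kB (kB z) z < cntE P kB (kB z) := by
  apply Finset.card_lt_card
  rw [Finset.ssubset_iff_of_subset]
  · exact ⟨z, by simp [hz], by simp⟩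
  · intro x hx
    simp only [Finset.mem_filter] at *
    exact ⟨hx.1, hx.2.2⟩

theorem rk_sub (P : Finset ℕ) (kB : ℕ → ℕ) (j : ℕ) {z z' : ℕ} (h : z ≤ z') :
    rk P kB j z' ≤ rk P kB j z + (z' - z) := by
  rw [← Nat.card_Ico z z']
  refine (Finset.card_le_card ?_).trans (Finset.card_union_le _ _)
  intro x hx
  simp only [Finset.mem_filter, Finset.mem_union, Finset.mem_Ico] at *
  rcases Nat.lt_or_ge x z with h1 | h1
  · exact Or.inl ⟨hx.1, h1, hx.2.2⟩
  · exact Or.inr ⟨h1, hx.2.1⟩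

theorem rank_inj (P : Finset ℕ) (kB : ℕ → ℕ) (j : ℕ) :
    Set.InjOn (rk P kB j) {z | z ∈ P ∧ kB z = j} := by
  rintro z ⟨h1, rfl⟩ z' ⟨h3, h4⟩ he
  rcases lt_trichotomy z z' with h | h | h
  · have := rk_lt (kB := kB) h1 h; omega
  · exact h
  · have := rk_lt (kB := kB) h3 h
    rw [h4] at this
    omega

theorem rank_upper (P : Finset ℕ) (kB : ℕ → ℕ) (j c : ℕ) :
    (P.filter (fun z => kB z = j ∧ rk P kB j z < c)).card ≤ c := by
  conv_rhs => rw [← Finset.card_range c]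
  apply Finset.card_le_card_of_injOn (rk P kB j)
  · intro z hz
    simp only [Finset.coe_filter, Set.mem_setOf_eq] at hz
    simpa using hz.2.2
  · apply (rank_inj P kB j).mono
    intro z hz
    simp only [Finset.coe_filter, Set.mem_setOf_eq] at hz
    exact ⟨hz.1, hz.2.1⟩

theorem rank_lower (P : Finset ℕ) (kB : ℕ → ℕ) (j c : ℕ) (hc : c ≤ cntE P kB j) :
    c ≤ (P.filter (fun z => kB z = j ∧ rk P kB j z < c)).card := by
  have h1 : (P.filter (fun z => kB z = j ∧ ¬ rk P kB j z < c)).card ≤ cntE P kB j - c := by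
    rw [← Nat.card_Ico c]
    apply Finset.card_le_card_of_injOn (rk P kB j)
    · intro z hz
      simp only [Finset.coe_filter, Set.mem_setOf_eq] at hz
      have := rk_lt_card (kB := kB) hz.1
      rw [hz.2.1] at this
      simp only [Finset.coe_Ico, Set.mem_Ico]
      omega
    · apply (rank_inj P kB j).mono
      intro z hz
      simp only [Finset.coe_filter, Set.mem_setOf_eq] at hz
      exact ⟨hz.1, hz.2.1⟩
  have h2 : cntE P kB j = (P.filter (fun z => kB z = j ∧ rk P kB j z < c)).card +
      (P.filter (fun z => kB z = j ∧ ¬ rk P kB j z < c)).card := by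
    unfold cntE
    rw [← Finset.filter_filter, ← Finset.filter_filter, Finset.card_filter_add_card_filter_not]
  omega

/-- the arrangement data -/
structure Arr (P : Finset ℕ) (kA kB zB : ℕ → ℕ) (N m : ℕ) : Prop where
  hN : 2 ≤ N
  hA : ∀ z ∈ P, kA z < N
  hB : ∀ z ∈ P, kB z < N
  zle : ∀ z ∈ P, zB z ≤ z
  zm : ∀ z ∈ P, kB z ≠ 0 → kB z ≠ N - 1 → z ≤ zB z + m
  c0 : cntE P kB 0 ≤ m
  c1 : cntE P kB (N - 1) ≤ m

namespace Arr
variable {P : Finset ℕ} {kA kB zB : ℕ → ℕ} {N m : ℕ}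

theorem gam_lt (X : Arr P kA kB zB N m) {z : ℕ} (_hz : z ∈ P) (h0 : kB z ≠ 0) (h1 : kB z ≠ N - 1) (k : ℕ) :
    gam P kA kB zB N z < k ↔ rk P kB (kB z) (zB z) < CC P kA kB (kB z) k := by
  have hz := _hz
  have hne : {k | rk P kB (kB z) (zB z) < CC P kA kB (kB z) (k + 1)}.Nonempty := by
    refine ⟨N, ?_⟩
    have h2 := rk_mono P kB (kB z) (X.zle z hz)
    have h3 := rk_lt_card (kB := kB) hz
    have h4 : CC P kA kB (kB z) (N + 1) = cntE P kB (kB z) := by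
      unfold CC cntE
      congr 1
      apply Finset.filter_congr
      intro x hx
      have := X.hA x hx
      constructor
      · exact fun h => h.1
      · exact fun h => ⟨h, by omega⟩
    simp only [Set.mem_setOf_eq]
    omega
  unfold gam
  rw [if_neg h0, if_neg h1]
  constructor
  · intro h
    have h2 := Nat.sInf_mem hne
    simp only [Set.mem_setOf_eq] at h2
    exact lt_of_lt_of_le h2 (CC_mono _ _ _ _ (by omega))
  · intro h
    have hk : 0 < k := by
      rcases Nat.eq_zero_or_pos k with h2 | h2
      · subst h2; simp [CC] at h
      · exact h2
    have : sInf {k | rk P kB (kB z) (zB z) < CC P kA kB (kB z) (k + 1)} ≤ k - 1 := by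
      apply Nat.sInf_le
      simp only [Set.mem_setOf_eq]
      rwa [Nat.sub_add_cancel hk]
    omega

theorem gam_ex (X : Arr P kA kB zB N m) {z : ℕ} (hz : z ∈ P) (h0 : kB z ≠ 0) (h1 : kB z ≠ N - 1) :
    ∃ x ∈ P, kB x = kB z ∧ kA x = gam P kA kB zB N z := by
  have a1 := (X.gam_lt hz h0 h1 (gam P kA kB zB N z)).not.1 (lt_irrefl _)
  have a2 := (X.gam_lt hz h0 h1 (gam P kA kB zB N z + 1)).1 (Nat.lt_succ_self _)
  by_contra hc
  push Not at hc
  have : CC P kA kB (kB z) (gam P kA kB zB N z + 1) ≤ CC P kA kB (kB z) (gam P kA kB zB N z) := by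
    apply Finset.card_le_card
    intro x hx
    simp only [Finset.mem_filter] at *
    have := hc x hx.1 hx.2.1
    exact ⟨hx.1, hx.2.1, by omega⟩
  omega

theorem G_lower (X : Arr P kA kB zB N m) (j k : ℕ) (hj : j ≠ N - 1) :
    CC P kA kB j k ≤ CC P (gam P kA kB zB N) kB j k := by
  by_cases h0 : j = 0
  · subst h0
    rcases Nat.eq_zero_or_pos k with hk | hk
    · subst hk; simp [CC]
    · apply Finset.card_le_card
      intro x hx
      simp only [Finset.mem_filter] at *
      refine ⟨hx.1, hx.2.1, ?_⟩
      unfold gam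
      rw [if_pos hx.2.1]
      exact hk
  · refine (rank_lower P kB j _ (CC_le P kA kB j k)).trans (Finset.card_le_card ?_)
    intro x hx
    simp only [Finset.mem_filter] at *
    obtain ⟨h1, rfl, h3⟩ := hx
    refine ⟨h1, rfl, (X.gam_lt h1 h0 hj k).2 ?_⟩
    exact lt_of_le_of_lt (rk_mono P kB _ (X.zle x h1)) h3

theorem G_upper (X : Arr P kA kB zB N m) (j k : ℕ) (hk : k ≤ N) :
    CC P (gam P kA kB zB N) kB j k ≤ CC P kA kB j k + m := by
  by_cases h0 : j = 0
  · subst h0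
    have := CC_le P (gam P kA kB zB N) kB 0 k
    have := X.c0
    omega
  by_cases h1 : j = N - 1
  · subst h1
    have := CC_le P (gam P kA kB zB N) kB (N - 1) k
    have := X.c1
    omega
  refine (Finset.card_le_card ?_).trans (rank_upper P kB j _)
  intro x hx
  simp only [Finset.mem_filter] at *
  obtain ⟨h2, rfl, h4⟩ := hx
  refine ⟨h2, rfl, ?_⟩
  have h5 := (X.gam_lt h2 h0 h1 k).1 h4
  have h6 := rk_sub P kB (kB x) (X.zle x h2)
  have := X.zm x h2 h0 h1
  omega

theorem G_dev (X : Arr P kA kB zB N m) (j k : ℕ) :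
    CC P kA kB j k ≤ CC P (gam P kA kB zB N) kB j k + m := by
  by_cases h1 : j = N - 1
  · subst h1
    have := CC_le P kA kB (N - 1) k
    have := X.c1
    omega
  · have := X.G_lower j k h1
    omega

theorem cnt_key (X : Arr P kA kB zB N m) (γ : ℕ → ℕ) (k j : ℕ) (hj : j ≤ N) :
    cnt P (fun z => γ z * N + kB z) (k * N + j) =
      ∑ i ∈ Finset.range N, CC P γ kB i (if i < j then k + 1 else k) := by
  unfold cnt
  rw [Finset.card_eq_sum_card_fiberwise (f := kB) (t := Finset.range N)]
  · apply Finset.sum_congr rfl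
    intro i hi
    rw [Finset.mem_range] at hi
    unfold CC
    rw [Finset.filter_filter]
    congr 1
    apply Finset.filter_congr
    intro z hz
    rw [and_comm]
    apply and_congr_right
    rintro rfl
    have e0 : γ z * N + kB z < k * N + j ↔ (fun z => γ z * N + kB z) z < k * N + j := Iff.rfl
    rw [← e0]
    split_ifs with h
    · constructor
      · intro h2
        by_contra hc
        have : (k + 1) * N ≤ γ z * N := Nat.mul_le_mul_right _ (by omega)
        rw [Nat.add_mul] at this
        omega
      · intro h2
        have : γ z * N ≤ k * N := Nat.mul_le_mul_right _ (by omega)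
        omega
    · constructor
      · intro h2
        by_contra hc
        have : k * N ≤ γ z * N := Nat.mul_le_mul_right _ (by omega)
        omega
      · intro h2
        have : (γ z + 1) * N ≤ k * N := Nat.mul_le_mul_right _ (by omega)
        rw [Nat.add_mul] at this
        omega
  · intro z hz
    simp only [Finset.coe_filter, Set.mem_setOf_eq] at hz
    simpa using X.hB z hz.1

theorem dev1 (X : Arr P kA kB zB N m) (k j : ℕ) (hj : j ≤ N) (hk : k < N) :
    cnt P (fun z => gam P kA kB zB N z * N + kB z) (k * N + j) ≤
      cnt P (fun z => kA z * N + kB z) (k * N + j) + N * m := by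
  rw [X.cnt_key _ k j hj, X.cnt_key _ k j hj]
  have : N * m = ∑ i ∈ Finset.range N, m := by simp
  rw [this, ← Finset.sum_add_distrib]
  apply Finset.sum_le_sum
  intro i _
  apply X.G_upper
  split_ifs <;> omega

theorem dev2 (X : Arr P kA kB zB N m) (k j : ℕ) (hj : j ≤ N) :
    cnt P (fun z => kA z * N + kB z) (k * N + j) ≤
      cnt P (fun z => gam P kA kB zB N z * N + kB z) (k * N + j) + N * m := by
  rw [X.cnt_key _ k j hj, X.cnt_key _ k j hj]
  have : N * m = ∑ i ∈ Finset.range N, m := by simp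
  rw [this, ← Finset.sum_add_distrib]
  apply Finset.sum_le_sum
  intro i _
  apply X.G_dev

theorem cnt_low (X : Arr P kA kB zB N m) (h : ∀ z ∈ P, kB z ≠ N - 1) (k : ℕ) :
    cnt P kA k ≤ cnt P (fun z => gam P kA kB zB N z * N + kB z) (k * N) := by
  have h1 : cnt P kA k = cnt P (fun z => kA z * N + kB z) (k * N) := by
    apply cnt_div (by have := X.hN; omega)
    intro z hz
    have := X.hB z hz
    rw [Nat.add_comm, Nat.add_mul_div_right _ _ (by omega), Nat.div_eq_of_lt this, Nat.zero_add]
  rw [h1]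
  have a := X.cnt_key kA k 0 (Nat.zero_le _)
  have b := X.cnt_key (gam P kA kB zB N) k 0 (Nat.zero_le _)
  rw [Nat.add_zero] at a b
  rw [a, b]
  apply Finset.sum_le_sum
  intro i _
  by_cases hi : i = N - 1
  · subst hi
    have : CC P kA kB (N - 1) (if N - 1 < 0 then k + 1 else k) = 0 := by
      unfold CC
      rw [Finset.card_eq_zero, Finset.filter_eq_empty_iff]
      intro z hz h2
      exact h z hz h2.1
    omega
  · exact X.G_lower _ _ hi

theorem compat (X : Arr P kA kB zB N m) {comp : ℕ → ℕ → Prop}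
    (hc : (∀ z ∈ P, ∀ z' ∈ P, comp z' z) ∨ ((∀ z ∈ P, kB z ≠ N - 1) ∧
      (∀ z ∈ P, ∀ z' ∈ P, kA z ≤ kA z' → comp z' z) ∧ (∀ z ∈ P, ∀ z' ∈ P, kB z = 0 → comp z' z)))
    {i e q : ℕ} (h1 : cnt P kA i ≤ q) (h2 : q < cnt P kA (i + 1))
    (h3 : cnt P (fun z => gam P kA kB zB N z * N + kB z) e ≤ q)
    (h4 : q < cnt P (fun z => gam P kA kB zB N z * N + kB z) (e + 1)) :
    ∃ z ∈ P, ∃ z' ∈ P, kA z' = i ∧ kB z = e % N ∧ comp z' z := by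
  obtain ⟨z', hz', rfl⟩ := run_mem h1 h2
  obtain ⟨z, hz, rfl⟩ := run_mem h3 h4
  have hN := X.hN
  have hBz := X.hB z hz
  have hmod : (gam P kA kB zB N z * N + kB z) % N = kB z := by
    rw [Nat.add_comm, Nat.add_mul_mod_self_right, Nat.mod_eq_of_lt hBz]
  rw [hmod]
  rcases hc with hc | ⟨c1, c2, c3⟩
  · exact ⟨z, hz, z', hz', rfl, rfl, hc z hz z' hz'⟩
  · by_cases h0 : kB z = 0
    · exact ⟨z, hz, z', hz', rfl, rfl, c3 z hz z' hz' h0⟩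
    · obtain ⟨x, hx, hx1, hx2⟩ := X.gam_ex hz h0 (c1 z hz)
      refine ⟨x, hx, z', hz', rfl, hx1, c2 x hx z' hz' ?_⟩
      rw [hx2]
      by_contra hlt
      have a1 := X.cnt_low c1 (gam P kA kB zB N z)
      have a2 := cnt_mono P (fun z => gam P kA kB zB N z * N + kB z)
        (show gam P kA kB zB N z * N ≤ gam P kA kB zB N z * N + kB z by omega)
      have a3 := cnt_mono P kA (show kA z' + 1 ≤ gam P kA kB zB N z by omega)
      omega

theorem gam_le (X : Arr P kA kB zB N m) (z : ℕ) (hz : z ∈ P) : gam P kA kB zB N z ≤ N := by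
  by_cases h0 : kB z = 0
  · simp [gam, h0]
  by_cases h1 : kB z = N - 1
  · unfold gam; rw [if_neg h0, if_pos h1]
  obtain ⟨x, hx, _, h2⟩ := X.gam_ex hz h0 h1
  rw [← h2]
  exact (X.hA x hx).le

end Arr


structure VD (ι : Type) where
  x : ι → ℕ
  w : ι → ℕ
  a : ι → ℕ
  b : ι → ℕ
  val : ι → ℕ

namespace VD
variable {ι : Type} (d : VD ι)

def C (i : ι) (z : ℕ) : Prop := d.x i ≤ z ∧ z < d.x i + d.w i

noncomputable def col (φ : ι → ℕ) (T : Finset ι) (z : ℕ) : ℕ := T.sup (fun i => if d.C i z then φ i else 0)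

def cut (T : Finset ι) (z : ℕ) : Prop := ∃ i ∈ T, d.x i < z ∧ z < d.x i + d.w i

def Uq (T : Finset ι) : Prop := ∀ i ∈ T, ∀ j ∈ T, ∀ z, d.C i z → d.C j z → i = j

theorem col_eq {T : Finset ι} (hT : d.Uq T) (φ : ι → ℕ) {i : ι} {z : ℕ} (hi : i ∈ T) (hz : d.C i z) :
    d.col φ T z = φ i := by
  unfold col
  apply le_antisymm
  · apply Finset.sup_le
    intro j hj
    split_ifs with h
    · rw [hT j hj i hi z h hz]
    · exact Nat.zero_le _
  · refine le_trans (by rw [if_pos hz]) (Finset.le_sup (f := fun i => if d.C i z then φ i else 0) hi)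

theorem col_none {T : Finset ι} (φ : ι → ℕ) {z : ℕ} (h : ∀ i ∈ T, ¬ d.C i z) : d.col φ T z = 0 := by
  unfold col
  apply Nat.le_zero.1
  apply Finset.sup_le
  intro j hj
  rw [if_neg (h j hj)]

theorem col_le {T : Finset ι} (φ : ι → ℕ) (M z : ℕ) (h : ∀ i ∈ T, φ i ≤ M) : d.col φ T z ≤ M := by
  unfold col
  apply Finset.sup_le
  intro j hj
  split_ifs
  · exact h j hj
  · exact Nat.zero_le _

theorem col_ex {T : Finset ι} (hT : d.Uq T) (φ : ι → ℕ) {z : ℕ} (h : 0 < d.col φ T z) :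
    ∃ i ∈ T, d.C i z ∧ ∀ ψ, d.col ψ T z = ψ i := by
  by_contra hc
  rw [d.col_none φ] at h
  · omega
  · intro i hi hC
    exact hc ⟨i, hi, hC, fun ψ => d.col_eq hT ψ hi hC⟩

theorem cut_eq {T : Finset ι} (hT : d.Uq T) (φ : ι → ℕ) {z : ℕ} (h : d.cut T z) :
    d.col φ T (z - 1) = d.col φ T z := by
  obtain ⟨i, hi, h1, h2⟩ := h
  rw [d.col_eq hT φ hi (z := z - 1) ⟨by omega, by omega⟩, d.col_eq hT φ hi ⟨h1.le, h2⟩]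

def NN (R : ℕ) : ℕ := (R + 1) ^ 3 + 2

noncomputable def nkey (R : ℕ) (T : Finset ι) (z : ℕ) : ℕ :=
  1 + (((R - d.col d.val T z) * (R + 1) + d.col d.a T z) * (R + 1) + d.col d.b T z)

noncomputable def key (R : ℕ) (T : Finset ι) (u v z : ℕ) : ℕ :=
  if ∃ i ∈ T, d.C i z ∧ d.x i < u then 0 else
  if ∃ i ∈ T, d.C i z ∧ v < d.x i + d.w i then NN R - 1 else d.nkey R T z

theorem nkey_bd {R : ℕ} {T : Finset ι} (ha : ∀ i ∈ T, d.a i ≤ R) (hb : ∀ i ∈ T, d.b i ≤ R) (z : ℕ) :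
    0 < d.nkey R T z ∧ d.nkey R T z < NN R - 1 := by
  have h1 := d.col_le d.a R z ha
  have h2 := d.col_le d.b R z hb
  unfold nkey NN
  refine ⟨by omega, ?_⟩
  have h3 : (R - d.col d.val T z) * (R + 1) ≤ R * (R + 1) := Nat.mul_le_mul_right _ (by omega)
  have h4 : ((R - d.col d.val T z) * (R + 1) + d.col d.a T z) * (R + 1) ≤ (R * (R + 1) + R) * (R + 1) :=
    Nat.mul_le_mul_right _ (by omega)
  have h5 : (R + 1) ^ 3 = (R * (R + 1) + R) * (R + 1) + R + 1 := by ring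
  omega

theorem digits {n p q p' q' : ℕ} (h1 : q < n) (h2 : q' < n) (h : p * n + q ≤ p' * n + q') :
    p ≤ p' ∧ (p * n + q = p' * n + q' → p = p' ∧ q = q') := by
  have aux : ∀ {p q p' q' : ℕ}, q < n → q' < n → p * n + q ≤ p' * n + q' → p ≤ p' := by
    intro p q p' q' h1 h2 h
    by_contra hc
    have : (p' + 1) * n ≤ p * n := Nat.mul_le_mul_right _ (by omega)
    rw [Nat.add_mul] at this
    omega
  refine ⟨aux h1 h2 h, fun he => ?_⟩
  have e : p = p' := le_antisymm (aux h1 h2 he.le) (aux h2 h1 he.ge)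
  subst e
  exact ⟨rfl, by omega⟩

theorem nkey_le {R : ℕ} {T : Finset ι} (ha : ∀ i ∈ T, d.a i ≤ R) (hb : ∀ i ∈ T, d.b i ≤ R)
    (hv : ∀ i ∈ T, d.val i ≤ R) {z z' : ℕ} (h : d.nkey R T z ≤ d.nkey R T z') :
    d.col d.val T z' ≤ d.col d.val T z := by
  have h1 := d.col_le d.a R z ha
  have h2 := d.col_le d.b R z hb
  have h3 := d.col_le d.a R z' ha
  have h4 := d.col_le d.b R z' hb
  have h5 := d.col_le d.val R z' hv
  have h6 := d.col_le d.val R z hv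
  unfold nkey at h
  have e1 := (digits (by omega) (by omega) (Nat.le_of_add_le_add_left h)).1
  have e2 := (digits (by omega) (by omega) e1).1
  omega

theorem nkey_inj {R : ℕ} {T : Finset ι} (ha : ∀ i ∈ T, d.a i ≤ R) (hb : ∀ i ∈ T, d.b i ≤ R)
    {z z' : ℕ} (h : d.nkey R T z = d.nkey R T z') :
    d.col d.a T z = d.col d.a T z' ∧ d.col d.b T z = d.col d.b T z' := by
  have h1 := d.col_le d.a R z ha
  have h2 := d.col_le d.b R z hb
  have h3 := d.col_le d.a R z' ha
  have h4 := d.col_le d.b R z' hb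
  unfold nkey at h
  have e := Nat.add_left_cancel h
  have e1 := (digits (by omega) (by omega) e.le).2 e
  have e2 := (digits (by omega) (by omega) e1.1.le).2 e1.1
  exact ⟨e2.2, e1.2⟩

section key
variable {d}
variable {R : ℕ} {T : Finset ι} {u v : ℕ}

theorem key_lt (ha : ∀ i ∈ T, d.a i ≤ R) (hb : ∀ i ∈ T, d.b i ≤ R) (z : ℕ) :
    d.key R T u v z < NN R := by
  have := d.nkey_bd ha hb z
  unfold key
  split_ifs
  · unfold NN; omega
  · omega
  · omega

theorem key_zero (ha : ∀ i ∈ T, d.a i ≤ R) (hb : ∀ i ∈ T, d.b i ≤ R) {z : ℕ} :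
    d.key R T u v z = 0 ↔ ∃ i ∈ T, d.C i z ∧ d.x i < u := by
  have := d.nkey_bd ha hb z
  have h2 : 2 ≤ NN R := by unfold NN; omega
  unfold key
  split_ifs with h h'
  · simp [h]
  · exact ⟨fun h3 => by omega, fun h3 => absurd h3 h⟩
  · exact ⟨fun h3 => by omega, fun h3 => absurd h3 h⟩

theorem key_last (ha : ∀ i ∈ T, d.a i ≤ R) (hb : ∀ i ∈ T, d.b i ≤ R) {z : ℕ} :
    d.key R T u v z = NN R - 1 ↔ ((¬ ∃ i ∈ T, d.C i z ∧ d.x i < u) ∧ ∃ i ∈ T, d.C i z ∧ v < d.x i + d.w i) := by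
  have := d.nkey_bd ha hb z
  have h2 : 2 ≤ NN R := by unfold NN; omega
  unfold key
  split_ifs with h h'
  · exact ⟨fun h3 => by omega, fun h3 => absurd h h3.1⟩
  · simp [h, h']
  · exact ⟨fun h3 => by omega, fun h3 => absurd h3.2 h'⟩

theorem key_norm (ha : ∀ i ∈ T, d.a i ≤ R) (hb : ∀ i ∈ T, d.b i ≤ R) {z : ℕ}
    (h0 : d.key R T u v z ≠ 0) (h1 : d.key R T u v z ≠ NN R - 1) :
    d.key R T u v z = d.nkey R T z ∧ ∀ i ∈ T, d.C i z → u ≤ d.x i ∧ d.x i + d.w i ≤ v := by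
  rw [Ne, key_zero ha hb] at h0
  rw [Ne, key_last ha hb] at h1
  have h2 : ¬ ∃ i ∈ T, d.C i z ∧ v < d.x i + d.w i := fun h => h1 ⟨h0, h⟩
  refine ⟨by unfold key; rw [if_neg h0, if_neg h2], fun i hi hC => ⟨?_, ?_⟩⟩
  · by_contra hc
    exact h0 ⟨i, hi, hC, by omega⟩
  · by_contra hc
    exact h2 ⟨i, hi, hC, by omega⟩

theorem key_rows (ha : ∀ i ∈ T, d.a i ≤ R) (hb : ∀ i ∈ T, d.b i ≤ R) (hT : d.Uq T) {z z' : ℕ}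
    (hz : u ≤ z ∧ z < v) (hz' : u ≤ z' ∧ z' < v)
    (h : d.key R T u v z = d.key R T u v z') :
    d.col d.a T z = d.col d.a T z' ∧ d.col d.b T z = d.col d.b T z' := by
  by_cases h0 : d.key R T u v z = 0
  · obtain ⟨i, hi, hC, hx⟩ := (key_zero ha hb).1 h0
    rw [h] at h0
    obtain ⟨j, hj, hC', hx'⟩ := (key_zero ha hb).1 h0
    unfold C at hC hC'
    have : i = j := hT i hi j hj u ⟨by omega, by omega⟩ ⟨by omega, by omega⟩
    subst this
    simp only [d.col_eq hT _ hi hC, d.col_eq hT _ hi hC', and_self]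
  by_cases h1 : d.key R T u v z = NN R - 1
  · obtain ⟨_, i, hi, hC, hx⟩ := (key_last ha hb).1 h1
    rw [h] at h1
    obtain ⟨_, j, hj, hC', hx'⟩ := (key_last ha hb).1 h1
    unfold C at hC hC'
    have : i = j := hT i hi j hj (v - 1) ⟨by omega, by omega⟩ ⟨by omega, by omega⟩
    subst this
    simp only [d.col_eq hT _ hi hC, d.col_eq hT _ hi hC', and_self]
  have e1 := (key_norm ha hb h0 h1).1
  rw [h] at h0 h1
  have e2 := (key_norm ha hb h0 h1).1
  rw [e1, e2] at h
  exact d.nkey_inj ha hb h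

theorem key_item (hT : d.Uq T) {i : ι} (hi : i ∈ T) {z z' : ℕ} (h1 : d.C i z) (h2 : d.C i z') :
    d.key R T u v z = d.key R T u v z' := by
  have e1 : ∀ p : ι → Prop, (∃ j ∈ T, d.C j z ∧ p j) ↔ p i := by
    intro p
    constructor
    · rintro ⟨j, hj, h3, h4⟩
      rwa [hT i hi j hj z h1 h3]
    · intro h; exact ⟨i, hi, h1, h⟩
  have e2 : ∀ p : ι → Prop, (∃ j ∈ T, d.C j z' ∧ p j) ↔ p i := by
    intro p
    constructor
    · rintro ⟨j, hj, h3, h4⟩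
      rwa [hT i hi j hj z' h2 h3]
    · intro h; exact ⟨i, hi, h2, h⟩
  unfold key nkey
  simp only [e1 (fun j => d.x j < u), e1 (fun j => v < d.x j + d.w j), e2 (fun j => d.x j < u),
    e2 (fun j => v < d.x j + d.w j), d.col_eq hT _ hi h1, d.col_eq hT _ hi h2]

end key
end VD

theorem run_first {u v q : ℕ} (κ : ℕ → ℕ) (hq : u ≤ q ∧ q < v) (h : ∀ z, u ≤ z → z ≤ q → κ z = 0) :
    cnt (Finset.Ico u v) κ 0 ≤ q - u ∧ q - u < cnt (Finset.Ico u v) κ (0 + 1) := by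
  rw [cnt_zero]
  refine ⟨Nat.zero_le _, ?_⟩
  have : (Finset.Ico u (q + 1)).card ≤ cnt (Finset.Ico u v) κ (0 + 1) := by
    apply Finset.card_le_card
    intro z hz
    simp only [Finset.mem_Ico, Finset.mem_filter] at *
    refine ⟨⟨hz.1, by omega⟩, ?_⟩
    rw [h z hz.1 (by omega)]
    omega
  rw [Nat.card_Ico] at this
  omega

theorem run_last {u v q K : ℕ} (κ : ℕ → ℕ) (hq : u ≤ q ∧ q < v) (h : ∀ z, q ≤ z → z < v → κ z = K)
    (hK : ∀ z, u ≤ z → z < v → κ z ≤ K) :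
    cnt (Finset.Ico u v) κ K ≤ q - u ∧ q - u < cnt (Finset.Ico u v) κ (K + 1) := by
  constructor
  · rw [← Nat.card_Ico u q]
    apply Finset.card_le_card
    intro z hz
    simp only [Finset.mem_Ico, Finset.mem_filter] at *
    refine ⟨hz.1.1, ?_⟩
    by_contra hc
    rw [h z (by omega) hz.1.2] at hz
    omega
  · rw [cnt_all]
    · rw [Nat.card_Ico]; omega
    · intro z hz
      rw [Finset.mem_Ico] at hz
      have := hK z hz.1 hz.2
      omega

/-- Vertical item systems. -/
structure VS {ι : Type} (d : VD ι) (s A B Nn : Finset ι) (R W m : ℕ) : Prop where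
  hs : ∀ i, i ∈ s ↔ i ∈ A ∨ i ∈ B ∨ i ∈ Nn
  pos : ∀ i ∈ s, 0 < d.w i ∧ d.w i ≤ m ∧ d.x i + d.w i ≤ W ∧ d.a i < d.b i ∧ d.b i ≤ R
  dis : ∀ i ∈ s, ∀ j ∈ s, ∀ z r, d.C i z → d.C j z → d.a i ≤ r → r < d.b i → d.a j ≤ r → r < d.b j → i = j
  dA : d.Uq A
  dB : d.Uq B
  nAB : ∀ i, i ∈ A → i ∉ B
  nA : ∀ i, i ∈ A → i ∉ Nn
  nB : ∀ i, i ∈ B → i ∉ Nn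
  valA : ∀ i ∈ A, 1 ≤ d.val i ∧ d.val i ≤ R
  valB : ∀ i ∈ B, 1 ≤ d.val i ∧ d.val i ≤ R
  vAB : ∀ i ∈ A, ∀ j ∈ B, ∀ z, d.C i z → d.C j z → d.val i + d.val j ≤ R
  vdis : ∀ i ∈ A, ∀ j ∈ B, d.val i + d.val j ≤ R → d.b i ≤ d.a j ∨ d.b j ≤ d.a i

theorem VS.swap {ι : Type} {d : VD ι} {s A B Nn : Finset ι} {R W m : ℕ} (h : VS d s A B Nn R W m) :
    VS d s B A Nn R W m where
  hs := fun i => by rw [h.hs i]; tauto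
  pos := h.pos
  dis := h.dis
  dA := h.dB
  dB := h.dA
  nAB := fun i h1 h2 => h.nAB i h2 h1
  nA := h.nB
  nB := h.nA
  valA := h.valB
  valB := h.valA
  vAB := fun i hi j hj z h1 h2 => by have := h.vAB j hj i hi z h2 h1; omega
  vdis := fun i hi j hj h1 => (h.vdis j hj i hi (by omega)).symm


namespace VD
variable {ι : Type} (d : VD ι)

noncomputable def zst (B : Finset ι) (z : ℕ) : ℕ := if ∃ i ∈ B, d.C i z then d.col d.x B z else z

/-- the arrangement code of the second track -/
noncomputable def kapB (A B : Finset ι) (R u v z : ℕ) : ℕ :=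
  gam (Finset.Ico u v) (d.key R A u v) (d.key R B u v) (d.zst B) (NN R) z * NN R + d.key R B u v z

noncomputable def kapAB (A B : Finset ι) (R u v z : ℕ) : ℕ :=
  d.key R A u v z * NN R + d.key R B u v z

noncomputable def TT (R : ℕ) : ℕ := Fintype.card (Finset (Fin (R + 1) × Fin (R + 1)))

noncomputable def nu (Nn : Finset ι) (R u v z : ℕ) : ℕ :=
  (Fintype.equivFin (Finset (Fin (R + 1) × Fin (R + 1)))
    (Finset.univ.filter (fun p => ∃ i ∈ Nn, u ≤ d.x i ∧ d.x i + d.w i ≤ v ∧ d.C i z ∧ d.a i = p.1.val ∧ d.b i = p.2.val))).val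

noncomputable def kapI (A B Nn : Finset ι) (R u v z : ℕ) : ℕ :=
  d.kapAB A B R u v z * TT R + d.nu Nn R u v z

end VD

open VD

structure PC {ι : Type} (d : VD ι) (s A B Nn : Finset ι) (R W m u v : ℕ) : Prop where
  vs : VS d s A B Nn R W m
  huv : u < v
  hv : v ≤ W
  good : AC R (d.col d.val A) (d.col d.val B) u v ∨
    HL R (d.col d.val A) (d.col d.val B) (d.cut A) (d.cut B) u v

theorem VS.fAB {ι : Type} {d : VD ι} {s A B Nn : Finset ι} {R W m : ℕ} (X : VS d s A B Nn R W m) (z : ℕ) :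
    d.col d.val A z + d.col d.val B z ≤ R := by
  have h1 := d.col_le d.val R z (fun i hi => (X.valA i hi).2)
  have h2 := d.col_le d.val R z (fun i hi => (X.valB i hi).2)
  rcases Nat.eq_zero_or_pos (d.col d.val A z) with h | h
  · omega
  rcases Nat.eq_zero_or_pos (d.col d.val B z) with h' | h'
  · omega
  obtain ⟨i, hi, hC, he⟩ := d.col_ex X.dA _ h
  obtain ⟨j, hj, hC', he'⟩ := d.col_ex X.dB _ h'
  rw [he, he']
  exact X.vAB i hi j hj z hC hC'

namespace PC
variable {ι : Type} {d : VD ι} {s A B Nn : Finset ι} {R W m u v : ℕ}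

theorem posA (X : PC d s A B Nn R W m u v) {i} (hi : i ∈ A) :
    0 < d.w i ∧ d.w i ≤ m ∧ d.x i + d.w i ≤ W ∧ d.a i < d.b i ∧ d.b i ≤ R :=
  X.vs.pos i ((X.vs.hs i).2 (Or.inl hi))
theorem posB (X : PC d s A B Nn R W m u v) {i} (hi : i ∈ B) :
    0 < d.w i ∧ d.w i ≤ m ∧ d.x i + d.w i ≤ W ∧ d.a i < d.b i ∧ d.b i ≤ R :=
  X.vs.pos i ((X.vs.hs i).2 (Or.inr (Or.inl hi)))
theorem aA (X : PC d s A B Nn R W m u v) : ∀ i ∈ A, d.a i ≤ R := fun i hi => by have := X.posA hi; omega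
theorem bA (X : PC d s A B Nn R W m u v) : ∀ i ∈ A, d.b i ≤ R := fun i hi => by have := X.posA hi; omega
theorem aB (X : PC d s A B Nn R W m u v) : ∀ i ∈ B, d.a i ≤ R := fun i hi => by have := X.posB hi; omega
theorem bB (X : PC d s A B Nn R W m u v) : ∀ i ∈ B, d.b i ≤ R := fun i hi => by have := X.posB hi; omega

theorem arr (X : PC d s A B Nn R W m u v) :
    Arr (Finset.Ico u v) (d.key R A u v) (d.key R B u v) (d.zst B) (NN R) m where
  hN := by unfold NN; omega
  hA := fun z _ => key_lt X.aA X.bA z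
  hB := fun z _ => key_lt X.aB X.bB z
  zle := fun z _ => by
    unfold zst
    split_ifs with h
    · obtain ⟨i, hi, hC⟩ := h
      rw [d.col_eq X.vs.dB _ hi hC]; exact hC.1
    · exact le_rfl
  zm := fun z _ h0 h1 => by
    unfold zst
    split_ifs with h
    · obtain ⟨i, hi, hC⟩ := h
      rw [d.col_eq X.vs.dB _ hi hC]
      have := X.posB hi
      have := hC.2
      omega
    · omega
  c0 := by
    unfold cntE
    rcases Finset.eq_empty_or_nonempty ((Finset.Ico u v).filter (fun z => d.key R B u v z = 0)) with h | ⟨z, hz⟩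
    · rw [h]; simp
    rw [Finset.mem_filter, Finset.mem_Ico] at hz
    obtain ⟨i, hi, hC, hx⟩ := (key_zero X.aB X.bB).1 hz.2
    refine le_trans ?_ (X.posB hi).2.1
    have e : d.w i = (Finset.Ico (d.x i) (d.x i + d.w i)).card := by rw [Nat.card_Ico]; omega
    rw [e]
    apply Finset.card_le_card
    intro z' hz'
    rw [Finset.mem_filter, Finset.mem_Ico] at hz'
    obtain ⟨j, hj, hC', hx'⟩ := (key_zero X.aB X.bB).1 hz'.2
    unfold C at hC hC'
    have : i = j := X.vs.dB i hi j hj u ⟨by omega, by omega⟩ ⟨by omega, by omega⟩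
    subst this
    rw [Finset.mem_Ico]; exact hC'
  c1 := by
    unfold cntE
    rcases Finset.eq_empty_or_nonempty ((Finset.Ico u v).filter (fun z => d.key R B u v z = NN R - 1)) with h | ⟨z, hz⟩
    · rw [h]; simp
    rw [Finset.mem_filter, Finset.mem_Ico] at hz
    obtain ⟨_, i, hi, hC, hx⟩ := (key_last X.aB X.bB).1 hz.2
    refine le_trans ?_ (X.posB hi).2.1
    have e : d.w i = (Finset.Ico (d.x i) (d.x i + d.w i)).card := by rw [Nat.card_Ico]; omega
    rw [e]
    apply Finset.card_le_card
    intro z' hz'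
    rw [Finset.mem_filter, Finset.mem_Ico] at hz'
    obtain ⟨_, j, hj, hC', hx'⟩ := (key_last X.aB X.bB).1 hz'.2
    unfold C at hC hC'
    have : i = j := X.vs.dB i hi j hj (v - 1) ⟨by omega, by omega⟩ ⟨by omega, by omega⟩
    subst this
    rw [Finset.mem_Ico]; exact hC'

theorem compat (X : PC d s A B Nn R W m u v) {i e q : ℕ}
    (h1 : cnt (Finset.Ico u v) (d.key R A u v) i ≤ q) (h2 : q < cnt (Finset.Ico u v) (d.key R A u v) (i + 1))
    (h3 : cnt (Finset.Ico u v) (d.kapB A B R u v) e ≤ q) (h4 : q < cnt (Finset.Ico u v) (d.kapB A B R u v) (e + 1)) :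
    ∃ z ∈ Finset.Ico u v, ∃ z' ∈ Finset.Ico u v, d.key R A u v z' = i ∧ d.key R B u v z = e % NN R ∧
      d.col d.val A z' + d.col d.val B z ≤ R := by
  refine X.arr.compat (comp := fun z' z => d.col d.val A z' + d.col d.val B z ≤ R) ?_ h1 h2 h3 h4
  rcases X.good with hg | hg
  · left
    intro z hz z' hz'
    rw [Finset.mem_Ico] at hz hz'
    exact hg z' z hz'.1 hz'.2 hz.1 hz.2
  right
  obtain ⟨⟨g1, g2⟩, g3, g4⟩ := hg
  refine ⟨?_, ?_, ?_⟩
  · intro z hz hk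
    rw [Finset.mem_Ico] at hz
    obtain ⟨_, j, hj, hC, hx⟩ := (key_last X.aB X.bB).1 hk
    exact g3 ⟨j, hj, by have := hC.1; omega, hx⟩
  · intro z hz z' hz' hk
    rw [Finset.mem_Ico] at hz hz'
    have hn : ∀ z, u ≤ z ∧ z < v → d.key R A u v z ≠ 0 := by
      intro z hz hk
      obtain ⟨j, hj, hC, hx⟩ := (key_zero X.aA X.bA).1 hk
      exact g1 ⟨j, hj, hx, by have := hC.2; omega⟩
    by_cases hl : d.key R A u v z' = NN R - 1
    · obtain ⟨_, j, hj, hC, hx⟩ := (key_last X.aA X.bA).1 hl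
      have h5 := g4 ⟨j, hj, by have := hC.1; omega, hx⟩ z hz.1 hz.2
      have hC' := hC
      unfold C at hC'
      rw [d.col_eq X.vs.dA _ hj (z := v - 1) ⟨by omega, by omega⟩] at h5
      rw [d.col_eq X.vs.dA _ hj hC]
      omega
    · have hl' : d.key R A u v z ≠ NN R - 1 := by
        have := key_lt (u := u) (v := v) X.aA X.bA z'
        omega
      rw [(key_norm X.aA X.bA (hn z hz) hl').1, (key_norm X.aA X.bA (hn z' hz') hl).1] at hk
      have := d.nkey_le X.aA X.bA (fun i hi => (X.vs.valA i hi).2) hk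
      have := X.vs.fAB z
      omega
  · intro z hz z' hz' hk
    rw [Finset.mem_Ico] at hz hz'
    obtain ⟨j, hj, hC, hx⟩ := (key_zero X.aB X.bB).1 hk
    have hC' := hC
    unfold C at hC'
    have h5 := g2 ⟨j, hj, hx, by omega⟩ z' hz'.1 hz'.2
    rw [d.col_eq X.vs.dB _ hj (z := u) ⟨by omega, by omega⟩] at h5
    rw [d.col_eq X.vs.dB _ hj hC]
    omega

/-- lengths for the nontall track -/
theorem len (X : PC d s A B Nn R W m u v) {θ : ℕ} (hθ : θ < NN R * NN R * TT R) :
    cnt (Finset.Ico u v) (d.kapB A B R u v) (θ / TT R) ≤ cnt (Finset.Ico u v) (d.kapI A B Nn R u v) θ + NN R * m ∧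
    cnt (Finset.Ico u v) (d.kapI A B Nn R u v) (θ + 1) ≤
      cnt (Finset.Ico u v) (d.kapB A B R u v) (θ / TT R + 1) + NN R * m := by
  have hT : 0 < TT R := Fintype.card_pos
  have hN : 2 ≤ NN R := by unfold NN; omega
  have h1 := run_div (P := Finset.Ico u v) (κ := d.kapI A B Nn R u v) (κ' := d.kapAB A B R u v) hT (by
    intro z _
    unfold kapI
    have : d.nu Nn R u v z < TT R := Fin.isLt _
    rw [Nat.add_comm, Nat.add_mul_div_right _ _ hT, Nat.div_eq_of_lt this, Nat.zero_add]) θ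
  have he : θ / TT R < NN R * NN R := by rwa [Nat.div_lt_iff_lt_mul hT]
  generalize hee : θ / TT R = e at *
  have hk : e / NN R < NN R := by rwa [Nat.div_lt_iff_lt_mul (by omega)]
  have hj : e % NN R < NN R := Nat.mod_lt _ (by omega)
  have hd : e / NN R * NN R + e % NN R = e := by rw [Nat.mul_comm]; exact Nat.div_add_mod e _
  have d1 := X.arr.dev1 (e / NN R) (e % NN R) hj.le hk
  have d2 := X.arr.dev2 (e / NN R) (e % NN R + 1) (by omega)
  rw [← Nat.add_assoc, hd] at d2
  rw [hd] at d1
  have d1' : cnt (Finset.Ico u v) (d.kapB A B R u v) e ≤ cnt (Finset.Ico u v) (d.kapAB A B R u v) e + NN R * m := d1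
  have d2' : cnt (Finset.Ico u v) (d.kapAB A B R u v) (e + 1) ≤ cnt (Finset.Ico u v) (d.kapB A B R u v) (e + 1) + NN R * m := d2
  omega

end PC


inductive IX : Type
  | a (k : ℕ) : IX
  | b (e : ℕ) : IX
  | n (θ α β : ℕ) : IX

namespace VD
variable {ι : Type} (d : VD ι)

noncomputable def pz (R : ℕ) (T : Finset ι) (u v k0 : ℕ) : ℕ := sInf {z | (u ≤ z ∧ z < v) ∧ d.key R T u v z = k0}

noncomputable def trk (R : ℕ) (T : Finset ι) (u v : ℕ) (κ : ℕ → ℕ) (k k0 : ℕ) : Rg :=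
  ⟨u + cnt (Finset.Ico u v) κ k, d.col d.a T (d.pz R T u v k0), cntE (Finset.Ico u v) κ k,
    d.col d.b T (d.pz R T u v k0) - d.col d.a T (d.pz R T u v k0)⟩

theorem trk_rows {R : ℕ} {T : Finset ι} (ha : ∀ i ∈ T, d.a i ≤ R) (hb : ∀ i ∈ T, d.b i ≤ R) (hT : d.Uq T)
    {u v z : ℕ} (κ : ℕ → ℕ) (k : ℕ) (hz : u ≤ z ∧ z < v) :
    (d.trk R T u v κ k (d.key R T u v z)).y = d.col d.a T z ∧
    (d.trk R T u v κ k (d.key R T u v z)).h = d.col d.b T z - d.col d.a T z := by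
  have hm : d.pz R T u v (d.key R T u v z) ∈ {z' | (u ≤ z' ∧ z' < v) ∧ d.key R T u v z' = d.key R T u v z} :=
    Nat.sInf_mem ⟨z, hz, rfl⟩
  obtain ⟨h1, h2⟩ := hm
  have := key_rows ha hb hT h1 hz h2
  unfold trk
  simp only [this.1, this.2, and_self]

theorem trk_run {R : ℕ} {T : Finset ι} {u v : ℕ} {κ : ℕ → ℕ} {k k0 q r : ℕ}
    (h : (d.trk R T u v κ k k0).Mem q r) :
    (u ≤ q ∧ q < v) ∧ cnt (Finset.Ico u v) κ k ≤ q - u ∧ q - u < cnt (Finset.Ico u v) κ (k + 1) := by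
  unfold Rg.Mem trk at h
  simp only at h
  have h1 := cnt_le (Finset.Ico u v) κ (k + 1)
  rw [Nat.card_Ico] at h1
  rw [cnt_succ] at *
  omega

theorem trk_item {R : ℕ} {T : Finset ι} (ha : ∀ i ∈ T, d.a i ≤ R) (hb : ∀ i ∈ T, d.b i ≤ R) (hT : d.Uq T)
    {u v z : ℕ} {κ : ℕ → ℕ} {k k0 q r : ℕ} (hz : u ≤ z ∧ z < v) (hk : d.key R T u v z = k0)
    (h : (d.trk R T u v κ k k0).Mem q r) : ∃ i ∈ T, d.C i z ∧ d.a i ≤ r ∧ r < d.b i ∧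
      (d.trk R T u v κ k k0).y = d.a i ∧ (d.trk R T u v κ k k0).h = d.b i - d.a i := by
  subst hk
  have e := d.trk_rows ha hb hT κ k hz
  obtain ⟨_, _, h3, h4⟩ := h
  rw [e.1] at h3 h4
  rw [e.2] at h4
  obtain ⟨i, hi, hC, hc⟩ := d.col_ex hT d.b (z := z) (by omega)
  rw [hc, hc] at e
  rw [hc] at h3
  rw [hc, hc] at h4
  exact ⟨i, hi, hC, h3, by omega, e⟩

noncomputable def lab (A B Nn : Finset ι) (R u v θ α β : ℕ) : Prop :=
  ∃ z, (u ≤ z ∧ z < v) ∧ d.kapI A B Nn R u v z = θ ∧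
    ∃ i ∈ Nn, u ≤ d.x i ∧ d.x i + d.w i ≤ v ∧ d.C i z ∧ d.a i = α ∧ d.b i = β

noncomputable def rn (A B Nn : Finset ι) (R u v θ α β : ℕ) : Rg :=
  ⟨u + max (cnt (Finset.Ico u v) (d.kapI A B Nn R u v) θ) (cnt (Finset.Ico u v) (d.kapB A B R u v) (θ / TT R)), α,
    min (cnt (Finset.Ico u v) (d.kapI A B Nn R u v) (θ + 1)) (cnt (Finset.Ico u v) (d.kapB A B R u v) (θ / TT R + 1))
    - max (cnt (Finset.Ico u v) (d.kapI A B Nn R u v) θ) (cnt (Finset.Ico u v) (d.kapB A B R u v) (θ / TT R)), β - α⟩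

noncomputable def full (A B Nn : Finset ι) (R u v : ℕ) : IX → Rg
  | .a k => d.trk R A u v (d.key R A u v) k k
  | .b e => d.trk R B u v (d.kapB A B R u v) e (e % NN R)
  | .n θ α β => if d.lab A B Nn R u v θ α β then d.rn A B Nn R u v θ α β else ⟨0, 0, 0, 0⟩

end VD

namespace PC
variable {ι : Type} {d : VD ι} {s A B Nn : Finset ι} {R W m u v : ℕ}

theorem posN (X : PC d s A B Nn R W m u v) {i} (hi : i ∈ Nn) :
    0 < d.w i ∧ d.w i ≤ m ∧ d.x i + d.w i ≤ W ∧ d.a i < d.b i ∧ d.b i ≤ R :=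
  X.vs.pos i ((X.vs.hs i).2 (Or.inr (Or.inr hi)))

theorem hT : 0 < TT R := Fintype.card_pos

theorem nu_lt (d : VD ι) (Nn : Finset ι) (R u v z : ℕ) : d.nu Nn R u v z < TT R := Fin.isLt _

theorem kI_div (d : VD ι) (A B Nn : Finset ι) (R u v z : ℕ) : d.kapAB A B R u v z = d.kapI A B Nn R u v z / TT R := by
  unfold kapI
  rw [Nat.add_comm, Nat.add_mul_div_right _ _ hT, Nat.div_eq_of_lt (nu_lt d Nn R u v z), Nat.zero_add]

theorem kAB_div (X : PC d s A B Nn R W m u v) (z : ℕ) : d.key R A u v z = d.kapAB A B R u v z / NN R := by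
  unfold kapAB
  have := key_lt (u := u) (v := v) X.aB X.bB z
  rw [Nat.add_comm, Nat.add_mul_div_right _ _ (by omega), Nat.div_eq_of_lt this, Nat.zero_add]

theorem kAB_mod (X : PC d s A B Nn R W m u v) (z : ℕ) : d.key R B u v z = d.kapAB A B R u v z % NN R := by
  unfold kapAB
  have := key_lt (u := u) (v := v) X.aB X.bB z
  rw [Nat.add_comm, Nat.add_mul_mod_self_right, Nat.mod_eq_of_lt this]

theorem kB_mod (X : PC d s A B Nn R W m u v) (z : ℕ) : d.key R B u v z = d.kapB A B R u v z % NN R := by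
  unfold kapB
  have := key_lt (u := u) (v := v) X.aB X.bB z
  rw [Nat.add_comm, Nat.add_mul_mod_self_right, Nat.mod_eq_of_lt this]

theorem lab_at (X : PC d s A B Nn R W m u v) {θ α β z : ℕ} (h : d.lab A B Nn R u v θ α β)
    (hz : d.kapI A B Nn R u v z = θ) :
    ∃ i ∈ Nn, u ≤ d.x i ∧ d.x i + d.w i ≤ v ∧ d.C i z ∧ d.a i = α ∧ d.b i = β := by
  obtain ⟨z', _, hk, i, hi, h1, h2, h3, h4, h5⟩ := h
  have hp := X.posN hi
  have he : d.nu Nn R u v z' = d.nu Nn R u v z := by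
    have e : d.kapI A B Nn R u v z' = d.kapI A B Nn R u v z := by rw [hk, hz]
    unfold kapI at e
    exact ((digits (nu_lt d Nn R u v z') (nu_lt d Nn R u v z) e.le).2 e).2
  unfold nu at he
  have he2 := (Fintype.equivFin _).injective (Fin.ext he)
  have hm : ((⟨α, by omega⟩, ⟨β, by omega⟩) : Fin (R + 1) × Fin (R + 1)) ∈ Finset.univ.filter
    (fun p : Fin (R + 1) × Fin (R + 1) => ∃ i ∈ Nn, u ≤ d.x i ∧ d.x i + d.w i ≤ v ∧ d.C i z' ∧ d.a i = p.1.val ∧ d.b i = p.2.val) := by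
    rw [Finset.mem_filter]
    exact ⟨Finset.mem_univ _, i, hi, h1, h2, h3, h4, h5⟩
  rw [he2, Finset.mem_filter] at hm
  exact hm.2

theorem cell_n (X : PC d s A B Nn R W m u v) {θ α β q r : ℕ} (h : (d.full A B Nn R u v (.n θ α β)).Mem q r) :
    (u ≤ q ∧ q < v) ∧ (cnt (Finset.Ico u v) (d.kapI A B Nn R u v) θ ≤ q - u ∧
      q - u < cnt (Finset.Ico u v) (d.kapI A B Nn R u v) (θ + 1)) ∧
    (cnt (Finset.Ico u v) (d.kapB A B R u v) (θ / TT R) ≤ q - u ∧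
      q - u < cnt (Finset.Ico u v) (d.kapB A B R u v) (θ / TT R + 1)) ∧
    (cnt (Finset.Ico u v) (d.key R A u v) (θ / TT R / NN R) ≤ q - u ∧
      q - u < cnt (Finset.Ico u v) (d.key R A u v) (θ / TT R / NN R + 1)) ∧
    ∃ z, (u ≤ z ∧ z < v) ∧ d.kapI A B Nn R u v z = θ ∧ d.key R A u v z = θ / TT R / NN R ∧
      d.key R B u v z = (θ / TT R) % NN R ∧
      ∃ i ∈ Nn, u ≤ d.x i ∧ d.x i + d.w i ≤ v ∧ d.C i z ∧ d.a i = α ∧ d.b i = β ∧ d.a i ≤ r ∧ r < d.b i := by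
  unfold full at h
  simp only at h
  split_ifs at h with hl
  swap
  · unfold Rg.Mem at h; simp at h
  obtain ⟨g1, g2, g3, g4⟩ := h
  unfold rn at g1 g2 g3 g4
  simp only at g1 g2 g3 g4
  have h1 := cnt_le (Finset.Ico u v) (d.kapI A B Nn R u v) (θ + 1)
  rw [Nat.card_Ico] at h1
  have r1 := run_div (P := Finset.Ico u v) (κ := d.kapI A B Nn R u v) (κ' := d.kapAB A B R u v) hT
    (fun z _ => kI_div d A B Nn R u v z) θ
  have r2 := run_div (P := Finset.Ico u v) (κ := d.kapAB A B R u v) (κ' := d.key R A u v)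
    (T := NN R) (by unfold NN; omega) (fun z _ => X.kAB_div z) (θ / TT R)
  refine ⟨by omega, by omega, by omega, by omega, ?_⟩
  obtain ⟨z, hz, hk⟩ := run_mem (P := Finset.Ico u v) (κ := d.kapI A B Nn R u v) (k := θ) (q := q - u) (by omega) (by omega)
  rw [Finset.mem_Ico] at hz
  obtain ⟨i, hi, e1, e2, e3, e4, e5⟩ := X.lab_at hl hk
  refine ⟨z, hz, hk, ?_, ?_, i, hi, e1, e2, e3, e4, e5, by omega, ?_⟩
  · rw [X.kAB_div, kI_div d A B Nn, hk]
  · rw [X.kAB_mod, kI_div d A B Nn, hk]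
  · have := X.posN hi
    omega

theorem memA (X : PC d s A B Nn R W m u v) {i} (hi : i ∈ A) : i ∈ s := (X.vs.hs i).2 (Or.inl hi)
theorem memB (X : PC d s A B Nn R W m u v) {i} (hi : i ∈ B) : i ∈ s := (X.vs.hs i).2 (Or.inr (Or.inl hi))
theorem memN (X : PC d s A B Nn R W m u v) {i} (hi : i ∈ Nn) : i ∈ s := (X.vs.hs i).2 (Or.inr (Or.inr hi))

theorem cd_ab (X : PC d s A B Nn R W m u v) (k e : ℕ) :
    (d.full A B Nn R u v (.a k)).CD (d.full A B Nn R u v (.b e)) := by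
  intro q r h1 h2
  obtain ⟨g1, g2, g3⟩ := d.trk_run h1
  obtain ⟨_, g4, g5⟩ := d.trk_run h2
  obtain ⟨z, hz, z', hz', e1, e2, e3⟩ := X.compat g2 g3 g4 g5
  rw [Finset.mem_Ico] at hz hz'
  obtain ⟨i, hi, hC, a1, a2, _⟩ := d.trk_item X.aA X.bA X.vs.dA hz' e1 h1
  obtain ⟨j, hj, hC', a3, a4, _⟩ := d.trk_item X.aB X.bB X.vs.dB hz e2 h2
  rw [d.col_eq X.vs.dA _ hi hC, d.col_eq X.vs.dB _ hj hC'] at e3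
  have := X.vs.vdis i hi j hj e3
  omega

theorem cd_an (X : PC d s A B Nn R W m u v) (k θ α β : ℕ) :
    (d.full A B Nn R u v (.a k)).CD (d.full A B Nn R u v (.n θ α β)) := by
  intro q r h1 h2
  obtain ⟨g1, g2, g3⟩ := d.trk_run h1
  obtain ⟨_, _, _, ⟨g4, g5⟩, z, hz, e1, e2, e3, j, hj, _, _, hC', _, _, a3, a4⟩ := X.cell_n h2
  have hk := run_unique g2 g3 g4 g5
  rw [← hk] at e2
  obtain ⟨i, hi, hC, a1, a2, _⟩ := d.trk_item X.aA X.bA X.vs.dA hz e2 h1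
  have := X.vs.dis i (X.memA hi) j (X.memN hj) z r hC hC' a1 a2 a3 a4
  subst this
  exact X.vs.nA i hi hj

theorem cd_bn (X : PC d s A B Nn R W m u v) (k θ α β : ℕ) :
    (d.full A B Nn R u v (.b k)).CD (d.full A B Nn R u v (.n θ α β)) := by
  intro q r h1 h2
  obtain ⟨g1, g2, g3⟩ := d.trk_run h1
  obtain ⟨_, _, ⟨g4, g5⟩, _, z, hz, e1, e2, e3, j, hj, _, _, hC', _, _, a3, a4⟩ := X.cell_n h2
  have hk := run_unique g2 g3 g4 g5
  rw [← hk] at e3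
  obtain ⟨i, hi, hC, a1, a2, _⟩ := d.trk_item X.aB X.bB X.vs.dB hz e3 h1
  have := X.vs.dis i (X.memB hi) j (X.memN hj) z r hC hC' a1 a2 a3 a4
  subst this
  exact X.vs.nB i hi hj

theorem cd (X : PC d s A B Nn R W m u v) (k k' : IX) (hne : k ≠ k') :
    (d.full A B Nn R u v k).CD (d.full A B Nn R u v k') := by
  rcases k with k | e | ⟨θ, α, β⟩ <;> rcases k' with k' | e' | ⟨θ', α', β'⟩
  · intro q r h1 h2
    obtain ⟨_, g2, g3⟩ := d.trk_run h1
    obtain ⟨_, g4, g5⟩ := d.trk_run h2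
    exact hne (by rw [run_unique g2 g3 g4 g5])
  · exact X.cd_ab _ _
  · exact X.cd_an _ _ _ _
  · exact (X.cd_ab _ _).symm
  · intro q r h1 h2
    obtain ⟨_, g2, g3⟩ := d.trk_run h1
    obtain ⟨_, g4, g5⟩ := d.trk_run h2
    exact hne (by rw [run_unique g2 g3 g4 g5])
  · exact X.cd_bn _ _ _ _
  · exact (X.cd_an _ _ _ _).symm
  · exact (X.cd_bn _ _ _ _).symm
  · intro q r h1 h2
    obtain ⟨_, ⟨g2, g3⟩, _, _, z, hz, e1, _, _, j, hj, _, _, hC, b1, b2, a1, a2⟩ := X.cell_n h1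
    obtain ⟨_, ⟨g4, g5⟩, _, _, z', hz', e1', _, _, _⟩ := X.cell_n h2
    have hk := run_unique g2 g3 g4 g5
    subst hk
    unfold full at h2
    simp only at h2
    split_ifs at h2 with hl
    swap
    · unfold Rg.Mem at h2; simp at h2
    obtain ⟨j', hj', _, _, hC', b3, b4⟩ := X.lab_at hl e1
    unfold rn Rg.Mem at h2
    simp only at h2
    have := X.posN hj'
    have := X.vs.dis j (X.memN hj) j' (X.memN hj') z r hC hC' a1 a2 (by omega) (by omega)
    subst this
    exact hne (by rw [← b1, ← b2, ← b3, ← b4])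

def zr (R : ℕ) : IX → Prop
  | .a k => k = 0 ∨ k = NN R - 1
  | .b e => e % NN R = 0 ∨ e % NN R = NN R - 1
  | .n _ _ _ => False

noncomputable def reg (d : VD ι) (A B Nn : Finset ι) (R u v : ℕ) (k : IX) : Rg :=
  if zr R k then ⟨0, 0, 0, 0⟩ else d.full A B Nn R u v k

theorem reg_mem {k : IX} {q r : ℕ} (h : (reg d A B Nn R u v k).Mem q r) :
    ¬ zr R k ∧ (d.full A B Nn R u v k).Mem q r ∧ reg d A B Nn R u v k = d.full A B Nn R u v k := by
  unfold reg at h ⊢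
  split_ifs at h ⊢ with hz
  · unfold Rg.Mem at h; simp at h
  · exact ⟨hz, h, rfl⟩

theorem reg_cd (X : PC d s A B Nn R W m u v) (k k' : IX) (hne : k ≠ k') :
    (reg d A B Nn R u v k).CD (reg d A B Nn R u v k') :=
  (X.cd k k' hne).mono (fun _ _ h => (reg_mem h).2.1) (fun _ _ h => (reg_mem h).2.1)

theorem reg_wit (X : PC d s A B Nn R W m u v) {k : IX} {q r : ℕ} (h : (reg d A B Nn R u v k).Mem q r) :
    (u ≤ q ∧ q < v) ∧ ∃ i ∈ s, u ≤ d.x i ∧ d.x i + d.w i ≤ v ∧ (reg d A B Nn R u v k).y = d.a i ∧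
      (reg d A B Nn R u v k).h = d.b i - d.a i := by
  obtain ⟨hz, hf, he⟩ := reg_mem h
  rw [he]
  rcases k with k | e | ⟨θ, α, β⟩
  · obtain ⟨g1, g2, g3⟩ := d.trk_run hf
    refine ⟨g1, ?_⟩
    obtain ⟨z, hzP, hk⟩ := run_mem g2 g3
    rw [Finset.mem_Ico] at hzP
    obtain ⟨i, hi, hC, _, _, hy⟩ := d.trk_item X.aA X.bA X.vs.dA hzP hk hf
    unfold zr at hz
    push Not at hz
    rw [← hk] at hz
    have := (key_norm X.aA X.bA hz.1 hz.2).2 i hi hC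
    exact ⟨i, X.memA hi, this.1, this.2, hy⟩
  · obtain ⟨g1, g2, g3⟩ := d.trk_run hf
    refine ⟨g1, ?_⟩
    obtain ⟨z, hzP, hk⟩ := run_mem g2 g3
    rw [Finset.mem_Ico] at hzP
    have hk2 : d.key R B u v z = e % NN R := by rw [X.kB_mod, hk]
    obtain ⟨i, hi, hC, _, _, hy⟩ := d.trk_item X.aB X.bB X.vs.dB hzP hk2 hf
    unfold zr at hz
    push Not at hz
    rw [← hk2] at hz
    have := (key_norm X.aB X.bB hz.1 hz.2).2 i hi hC
    exact ⟨i, X.memB hi, this.1, this.2, hy⟩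
  · obtain ⟨g1, _, _, _, z, hz, e1, _, _, j, hj, w1, w2, hC, b1, b2, a1, a2⟩ := X.cell_n hf
    refine ⟨g1, j, X.memN hj, w1, w2, ?_⟩
    unfold full at hf ⊢
    simp only at hf ⊢
    split_ifs at hf ⊢
    · simp only [rn, b1, b2, and_self]
    · unfold Rg.Mem at hf; simp at hf

theorem reg_cut (X : PC d s A B Nn R W m u v) {k : IX} {q r : ℕ} {i : ι} (hi : i ∈ A ∨ i ∈ B)
    (hw : ¬ (u ≤ d.x i ∧ d.x i + d.w i ≤ v)) (hC : d.C i q) (h1 : d.a i ≤ r) (h2 : r < d.b i)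
    (h : (reg d A B Nn R u v k).Mem q r) : False := by
  have hq := (X.reg_wit h).1
  obtain ⟨hz, hf, he⟩ := reg_mem h
  have key : ∀ k', zr R k' → (d.full A B Nn R u v k').Mem q r → False := by
    intro k' hz' hm
    by_cases hk : k = k'
    · subst hk; exact hz hz'
    · exact X.cd k k' hk q r hf hm
  have hC' := hC
  unfold C at hC'
  have hN : 2 ≤ NN R := by unfold NN; omega
  rcases hi with hi | hi
  · by_cases hx : d.x i < u
    · have hk : ∀ z, u ≤ z → z ≤ q → d.key R A u v z = 0 := fun z a b =>
        (key_zero X.aA X.bA).2 ⟨i, hi, ⟨by omega, by omega⟩, hx⟩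
      have hr := run_first (d.key R A u v) hq hk
      refine key (.a 0) (Or.inl rfl) ?_
      have hrow := d.trk_rows X.aA X.bA X.vs.dA (d.key R A u v) 0 hq
      rw [hk q hq.1 le_rfl, d.col_eq X.vs.dA _ hi hC, d.col_eq X.vs.dA _ hi hC] at hrow
      show (d.trk R A u v (d.key R A u v) 0 0).Mem q r
      unfold Rg.Mem
      rw [hrow.1, hrow.2]
      unfold trk
      simp only
      rw [cnt_succ] at hr
      omega
    · have hk : ∀ z, q ≤ z → z < v → d.key R A u v z = NN R - 1 := fun z a b => by
        refine (key_last X.aA X.bA).2 ⟨?_, ⟨i, hi, ⟨by omega, by omega⟩, by omega⟩⟩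
        rintro ⟨j, hj, hCj, hxj⟩
        have := X.vs.dA i hi j hj z ⟨by omega, by omega⟩ hCj
        subst this
        omega
      have hr := run_last (d.key R A u v) hq hk (fun z _ _ => by
        have := key_lt (u := u) (v := v) X.aA X.bA z
        omega)
      refine key (.a (NN R - 1)) (Or.inr rfl) ?_
      have hrow := d.trk_rows X.aA X.bA X.vs.dA (d.key R A u v) (NN R - 1) hq
      rw [hk q le_rfl hq.2, d.col_eq X.vs.dA _ hi hC, d.col_eq X.vs.dA _ hi hC] at hrow
      show (d.trk R A u v (d.key R A u v) (NN R - 1) (NN R - 1)).Mem q r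
      unfold Rg.Mem
      rw [hrow.1, hrow.2]
      unfold trk
      simp only
      rw [cnt_succ] at hr
      omega
  · by_cases hx : d.x i < u
    · have hk : ∀ z, u ≤ z → z ≤ q → d.key R B u v z = 0 := fun z a b =>
        (key_zero X.aB X.bB).2 ⟨i, hi, ⟨by omega, by omega⟩, hx⟩
      have hr := run_first (d.kapB A B R u v) hq (fun z a b => by
        unfold kapB gam
        rw [if_pos (hk z a b), hk z a b]; simp)
      have hmod : 0 % NN R = 0 := Nat.zero_mod _
      refine key (.b 0) (Or.inl hmod) ?_
      have hrow := d.trk_rows X.aB X.bB X.vs.dB (d.kapB A B R u v) 0 hq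
      rw [hk q hq.1 le_rfl, d.col_eq X.vs.dB _ hi hC, d.col_eq X.vs.dB _ hi hC] at hrow
      show (d.trk R B u v (d.kapB A B R u v) 0 (0 % NN R)).Mem q r
      rw [hmod]
      unfold Rg.Mem
      rw [hrow.1, hrow.2]
      unfold trk
      simp only
      rw [cnt_succ] at hr
      omega
    · have hk : ∀ z, q ≤ z → z < v → d.key R B u v z = NN R - 1 := fun z a b => by
        refine (key_last X.aB X.bB).2 ⟨?_, ⟨i, hi, ⟨by omega, by omega⟩, by omega⟩⟩
        rintro ⟨j, hj, hCj, hxj⟩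
        have := X.vs.dB i hi j hj z ⟨by omega, by omega⟩ hCj
        subst this
        omega
      have hr := run_last (K := NN R * NN R + (NN R - 1)) (d.kapB A B R u v) hq (fun z a b => by
        unfold kapB gam
        have := hk z a b
        rw [if_neg (by omega), if_pos this, this]) (fun z a b => by
        have g1 := key_lt (u := u) (v := v) X.aB X.bB z
        have g2 := X.arr.gam_le z (by rw [Finset.mem_Ico]; exact ⟨a, b⟩)
        have g3 := Nat.mul_le_mul_right (NN R) g2
        unfold kapB
        omega)
      have hmod : (NN R * NN R + (NN R - 1)) % NN R = NN R - 1 := by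
        rw [Nat.mul_add_mod, Nat.mod_eq_of_lt (by omega)]
      refine key (.b (NN R * NN R + (NN R - 1))) (Or.inr hmod) ?_
      have hrow := d.trk_rows X.aB X.bB X.vs.dB (d.kapB A B R u v) (NN R * NN R + (NN R - 1)) hq
      rw [hk q le_rfl hq.2, d.col_eq X.vs.dB _ hi hC, d.col_eq X.vs.dB _ hi hC] at hrow
      show (d.trk R B u v (d.kapB A B R u v) (NN R * NN R + (NN R - 1)) ((NN R * NN R + (NN R - 1)) % NN R)).Mem q r
      rw [hmod]
      unfold Rg.Mem
      rw [hrow.1, hrow.2]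
      unfold trk
      simp only
      rw [cnt_succ] at hr
      omega

end PC


namespace PC
variable {ι : Type} {d : VD ι} {s A B Nn : Finset ι} {R W m u v : ℕ}

noncomputable def KF (R : ℕ) : Finset IX :=
  (Finset.range (NN R)).image IX.a ∪ (Finset.range (NN R * (NN R + 1))).image IX.b ∪
  (Finset.range (NN R * NN R * TT R) ×ˢ Finset.range (R + 1) ×ˢ Finset.range (R + 1)).image (fun p => IX.n p.1 p.2.1 p.2.2)

def C0 (R T : ℕ) : ℕ := (R + 1) * (R + 1) * (NN R * NN R * T * (2 * NN R + 1))

theorem disj_of_uq {T : Finset ι} (hT : d.Uq T) {i j : ι} (hi : i ∈ T) (hj : j ∈ T) (hne : i ≠ j) :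
    Disjoint (Finset.Ico (d.x i) (d.x i + d.w i)) (Finset.Ico (d.x j) (d.x j + d.w j)) := by
  rw [Finset.disjoint_left]
  intro z h1 h2
  rw [Finset.mem_Ico] at h1 h2
  exact hne (hT i hi j hj z h1 h2)

theorem track_sum {T : Finset ι} (hT : d.Uq T) (κ : ℕ → ℕ) (hc : ∀ i ∈ T, ∀ z, d.C i z → κ z = κ (d.x i)) (k : ℕ) :
    ∑ i ∈ T with (u ≤ d.x i ∧ d.x i + d.w i ≤ v) ∧ κ (d.x i) = k, d.w i ≤ cntE (Finset.Ico u v) κ k := by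
  have h := sum_card_le (T.filter (fun i => (u ≤ d.x i ∧ d.x i + d.w i ≤ v) ∧ κ (d.x i) = k))
    (fun i => Finset.Ico (d.x i) (d.x i + d.w i)) ((Finset.Ico u v).filter (fun z => κ z = k)) ?_ ?_
  · refine le_trans (le_of_eq (Finset.sum_congr rfl fun i _ => ?_)) h
    rw [Nat.card_Ico]; omega
  · intro i hi j hj hne
    exact disj_of_uq hT (Finset.mem_filter.1 hi).1 (Finset.mem_filter.1 hj).1 hne
  · intro i hi z hz
    rw [Finset.mem_filter] at hi ⊢
    rw [Finset.mem_Ico] at hz ⊢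
    refine ⟨by omega, ?_⟩
    rw [hc i hi.1 z hz, hi.2.2]

theorem CB_item {T : Finset ι} (hw : ∀ i ∈ T, 0 < d.w i) (i : ι) (hi : i ∈ T) : d.C i (d.x i) :=
  ⟨le_rfl, by have := hw i hi; omega⟩

theorem kapB_item (X : PC d s A B Nn R W m u v) {i : ι} (hi : i ∈ B) {z z' : ℕ} (h1 : d.C i z) (h2 : d.C i z') :
    d.kapB A B R u v z = d.kapB A B R u v z' := by
  have e1 : d.key R B u v z = d.key R B u v z' := key_item X.vs.dB hi h1 h2
  have e2 : d.zst B z = d.zst B z' := by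
    unfold zst
    rw [if_pos ⟨i, hi, h1⟩, if_pos ⟨i, hi, h2⟩, d.col_eq X.vs.dB _ hi h1, d.col_eq X.vs.dB _ hi h2]
  unfold kapB gam
  rw [e1, e2]

theorem whole_key {T : Finset ι} (ha : ∀ i ∈ T, d.a i ≤ R) (hb : ∀ i ∈ T, d.b i ≤ R) (hT : d.Uq T) {i : ι} (hi : i ∈ T)
    (hw : u ≤ d.x i ∧ d.x i + d.w i ≤ v) {z : ℕ} (hz : d.C i z) :
    d.key R T u v z ≠ 0 ∧ d.key R T u v z ≠ NN R - 1 := by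
  constructor
  · intro h
    obtain ⟨j, hj, hC, hx⟩ := (key_zero ha hb).1 h
    have := hT i hi j hj z hz hC
    subst this; omega
  · intro h
    obtain ⟨_, j, hj, hC, hx⟩ := (key_last ha hb).1 h
    have := hT i hi j hj z hz hC
    subst this; omega

theorem kapI_lt (X : PC d s A B Nn R W m u v) (z : ℕ) : d.kapI A B Nn R u v z < NN R * NN R * TT R := by
  rw [← Nat.div_lt_iff_lt_mul hT, ← kI_div d A B Nn]
  have h1 := key_lt (u := u) (v := v) X.aB X.bB z
  rw [← Nat.div_lt_iff_lt_mul (by omega), ← X.kAB_div]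
  exact key_lt X.aA X.bA z

theorem fillN (X : PC d s A B Nn R W m u v) (α β : ℕ) : ∃ D ⊆ Nn, ∃ f : ι → ℕ,
    (∀ i ∈ D, (u ≤ d.x i ∧ d.x i + d.w i ≤ v) ∧ d.a i = α ∧ d.b i = β) ∧
    (∀ i ∈ Nn, (u ≤ d.x i ∧ d.x i + d.w i ≤ v) → d.a i = α → d.b i = β → i ∉ D →
      f i < NN R * NN R * TT R ∧ d.lab A B Nn R u v (f i) α β) ∧
    (∀ θ, θ < NN R * NN R * TT R → d.lab A B Nn R u v θ α β →
      ∑ i ∈ Nn with (u ≤ d.x i ∧ d.x i + d.w i ≤ v) ∧ d.a i = α ∧ d.b i = β ∧ i ∉ D ∧ f i = θ, d.w i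
        ≤ (d.rn A B Nn R u v θ α β).w) ∧
    ∑ i ∈ D, d.w i ≤ NN R * NN R * TT R * (2 * NN R + 1) * m := by
  set S := Nn.filter (fun i => (u ≤ d.x i ∧ d.x i + d.w i ≤ v) ∧ d.a i = α ∧ d.b i = β) with hS
  set Bn := (Finset.range (NN R * NN R * TT R)).filter (fun θ => d.lab A B Nn R u v θ α β) with hBn
  have hSm : ∀ i, i ∈ S ↔ i ∈ Nn ∧ (u ≤ d.x i ∧ d.x i + d.w i ≤ v) ∧ d.a i = α ∧ d.b i = β := by
    intro i; rw [hS, Finset.mem_filter]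
  have hBm : ∀ θ, θ ∈ Bn ↔ θ < NN R * NN R * TT R ∧ d.lab A B Nn R u v θ α β := by
    intro i; rw [hBn, Finset.mem_filter, Finset.mem_range]
  obtain ⟨D, hD, f, f1, f2, f3⟩ := fill S d.w m (fun i hi => (X.posN ((hSm i).1 hi).1).2.1) Bn
    (fun θ => (d.rn A B Nn R u v θ α β).w)
  refine ⟨D, fun i hi => ((hSm i).1 (hD hi)).1, f, fun i hi => ((hSm i).1 (hD hi)).2, ?_, ?_, ?_⟩
  · intro i hi hw ha hb hn
    exact (hBm _).1 (f1 i ((hSm i).2 ⟨hi, hw, ha, hb⟩) hn)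
  · intro θ h1 h2
    refine le_trans (le_of_eq ?_) (f2 θ ((hBm θ).2 ⟨h1, h2⟩))
    apply Finset.sum_congr _ (fun _ _ => rfl)
    ext i
    simp only [Finset.mem_filter, hSm]
    tauto
  · rcases f3 with f3 | f3
    · rw [f3]; simp
    have hsum : ∑ i ∈ S, d.w i ≤ ∑ θ ∈ Bn, cntE (Finset.Ico u v) (d.kapI A B Nn R u v) θ := by
      have h := sum_card_le S (fun i => Finset.Ico (d.x i) (d.x i + d.w i))
        ((Finset.Ico u v).filter (fun z => d.kapI A B Nn R u v z ∈ Bn)) ?_ ?_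
      · refine le_trans (le_of_eq (Finset.sum_congr rfl fun i _ => ?_)) (h.trans ?_)
        · rw [Nat.card_Ico]; omega
        · rw [Finset.card_eq_sum_card_fiberwise (f := d.kapI A B Nn R u v) (t := Bn)]
          · apply Finset.sum_le_sum
            intro θ _
            apply Finset.card_le_card
            intro z hz
            simp only [Finset.mem_filter] at hz ⊢
            exact ⟨hz.1.1, hz.2⟩
          · intro z hz
            simp only [Finset.coe_filter, Set.mem_setOf_eq] at hz
            exact hz.2
      · intro i hi j hj hne
        rw [hSm] at hi hj
        rw [Finset.disjoint_left]
        intro z h1 h2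
        rw [Finset.mem_Ico] at h1 h2
        have p1 := X.posN hi.1
        exact hne (X.vs.dis i (X.memN hi.1) j (X.memN hj.1) z (d.a i) h1 h2 le_rfl (by omega) (by omega) (by omega))
      · intro i hi z hz
        rw [hSm] at hi
        rw [Finset.mem_Ico] at hz
        rw [Finset.mem_filter, hBm, Finset.mem_Ico]
        exact ⟨by omega, X.kapI_lt z, z, by omega, rfl, i, hi.1, hi.2.1.1, hi.2.1.2, hz, hi.2.2⟩
    have hcap : ∑ θ ∈ Bn, cntE (Finset.Ico u v) (d.kapI A B Nn R u v) θ ≤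
        ∑ θ ∈ Bn, ((d.rn A B Nn R u v θ α β).w + 2 * NN R * m) := by
      apply Finset.sum_le_sum
      intro θ hθ
      have h1 := X.len ((hBm θ).1 hθ).1
      have h2 := cnt_succ (Finset.Ico u v) (d.kapI A B Nn R u v) θ
      unfold rn
      simp only
      have h4 := run_div (P := Finset.Ico u v) (κ := d.kapI A B Nn R u v) (κ' := d.kapAB A B R u v) hT
        (fun z _ => kI_div d A B Nn R u v z) θ
      have h3 : 2 * NN R * m = NN R * m + NN R * m := by ring
      have h5 := cnt_mono (Finset.Ico u v) (d.kapB A B R u v) (show θ / TT R ≤ θ / TT R + 1 by omega)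
      omega
    rw [Finset.sum_add_distrib, Finset.sum_const, smul_eq_mul] at hcap
    have hc : Bn.card ≤ NN R * NN R * TT R := by
      refine (Finset.card_filter_le _ _).trans ?_
      rw [Finset.card_range]
    have h6 : Bn.card * (2 * NN R * m) + Bn.card * m = Bn.card * ((2 * NN R + 1) * m) := by ring
    have h7 := Nat.mul_le_mul_right ((2 * NN R + 1) * m) hc
    have h8 : NN R * NN R * TT R * ((2 * NN R + 1) * m) = NN R * NN R * TT R * (2 * NN R + 1) * m := by ring
    omega

theorem piece (X : PC d s A B Nn R W m u v) : ∃ (rg : IX → Rg) (c : ι → IX) (D : Finset ι),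
    D ⊆ Nn ∧ (∀ i ∈ D, u ≤ d.x i ∧ d.x i + d.w i ≤ v) ∧ ∑ i ∈ D, d.w i ≤ C0 R (TT R) * m ∧
    (∀ k k', k ≠ k' → (rg k).CD (rg k')) ∧
    (∀ k q r, (rg k).Mem q r → (u ≤ q ∧ q < v) ∧ ∃ i ∈ s, u ≤ d.x i ∧ d.x i + d.w i ≤ v ∧ (rg k).y = d.a i ∧
      (rg k).h = d.b i - d.a i) ∧
    (∀ k q r i, i ∈ A ∨ i ∈ B → ¬ (u ≤ d.x i ∧ d.x i + d.w i ≤ v) → d.C i q → d.a i ≤ r → r < d.b i →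
      (rg k).Mem q r → False) ∧
    (∀ i ∈ s, (u ≤ d.x i ∧ d.x i + d.w i ≤ v) → i ∉ D → c i ∈ KF R ∧ (rg (c i)).y = d.a i ∧ (rg (c i)).h = d.b i - d.a i) ∧
    (∀ k, ∑ i ∈ s with (u ≤ d.x i ∧ d.x i + d.w i ≤ v) ∧ i ∉ D ∧ c i = k, d.w i ≤ (rg k).w) := by
  choose D hD f h1 h2 h3 h4 using X.fillN
  set c : ι → IX := fun i => if i ∈ A then IX.a (d.key R A u v (d.x i)) else
    if i ∈ B then IX.b (d.kapB A B R u v (d.x i)) else IX.n (f (d.a i) (d.b i) i) (d.a i) (d.b i) with hc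
  set DD := (Finset.range (R + 1) ×ˢ Finset.range (R + 1)).biUnion (fun p => D p.1 p.2) with hDD
  have hcA : ∀ i ∈ A, c i = IX.a (d.key R A u v (d.x i)) := fun i hi => by simp only [hc]; rw [if_pos hi]
  have hcB : ∀ i ∈ B, c i = IX.b (d.kapB A B R u v (d.x i)) := fun i hi => by
    simp only [hc]; rw [if_neg (fun h => X.vs.nAB i h hi), if_pos hi]
  have hcN : ∀ i ∈ Nn, c i = IX.n (f (d.a i) (d.b i) i) (d.a i) (d.b i) := fun i hi => by
    simp only [hc]; rw [if_neg (fun h => X.vs.nA i h hi), if_neg (fun h => X.vs.nB i h hi)]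
  have hDm : ∀ i ∈ DD, i ∈ D (d.a i) (d.b i) ∧ i ∈ Nn ∧ (u ≤ d.x i ∧ d.x i + d.w i ≤ v) := by
    intro i hi
    rw [hDD, Finset.mem_biUnion] at hi
    obtain ⟨p, _, hp⟩ := hi
    obtain ⟨w, e1, e2⟩ := h1 _ _ i hp
    rw [e1, e2]
    exact ⟨hp, hD _ _ hp, w⟩
  have hDm' : ∀ i ∈ Nn, i ∉ DD → i ∉ D (d.a i) (d.b i) := by
    intro i hi hn hd
    apply hn
    have := X.posN hi
    rw [hDD, Finset.mem_biUnion]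
    exact ⟨(d.a i, d.b i), by simp only [Finset.mem_product, Finset.mem_range]; omega, hd⟩
  have hN : 2 ≤ NN R := by unfold NN; omega
  have CA : ∀ i ∈ A, d.C i (d.x i) := CB_item (fun i hi => (X.posA hi).1)
  have CB : ∀ i ∈ B, d.C i (d.x i) := CB_item (fun i hi => (X.posB hi).1)
  have hprop : ∀ i ∈ s, (u ≤ d.x i ∧ d.x i + d.w i ≤ v) → i ∉ DD → c i ∈ KF R ∧ ¬ zr R (c i) ∧
      (d.full A B Nn R u v (c i)).y = d.a i ∧ (d.full A B Nn R u v (c i)).h = d.b i - d.a i := by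
    intro i hi hw hn
    have hx : u ≤ d.x i ∧ d.x i < v := by
      have := X.vs.pos i hi
      omega
    rcases (X.vs.hs i).1 hi with h | h | h
    · rw [hcA i h]
      have hk := whole_key X.aA X.bA X.vs.dA h hw (CA i h)
      refine ⟨?_, ?_, ?_⟩
      · unfold KF
        simp only [Finset.mem_union, Finset.mem_image, Finset.mem_range]
        exact Or.inl (Or.inl ⟨_, key_lt X.aA X.bA _, rfl⟩)
      · unfold zr; push Not; exact hk
      · have := d.trk_rows X.aA X.bA X.vs.dA (d.key R A u v) (d.key R A u v (d.x i)) hx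
        rw [d.col_eq X.vs.dA _ h (CA i h), d.col_eq X.vs.dA _ h (CA i h)] at this
        exact this
    · rw [hcB i h]
      have hk := whole_key X.aB X.bB X.vs.dB h hw (CB i h)
      refine ⟨?_, ?_, ?_⟩
      · unfold KF
        simp only [Finset.mem_union, Finset.mem_image, Finset.mem_range]
        refine Or.inl (Or.inr ⟨_, ?_, rfl⟩)
        have g1 := key_lt (u := u) (v := v) X.aB X.bB (d.x i)
        have g2 := X.arr.gam_le (d.x i) (by rw [Finset.mem_Ico]; exact hx)
        have g3 := Nat.mul_le_mul_right (NN R) g2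
        have g4 : NN R * (NN R + 1) = NN R * NN R + NN R := by ring
        unfold kapB
        omega
      · unfold zr; push Not; rw [← X.kB_mod]; exact hk
      · have := d.trk_rows X.aB X.bB X.vs.dB (d.kapB A B R u v) (d.kapB A B R u v (d.x i)) hx
        rw [d.col_eq X.vs.dB _ h (CB i h), d.col_eq X.vs.dB _ h (CB i h), X.kB_mod] at this
        exact this
    · rw [hcN i h]
      have hl := h2 _ _ i h hw rfl rfl (hDm' i h hn)
      have := X.posN h
      refine ⟨?_, fun h => h, ?_⟩
      · unfold KF
        simp only [Finset.mem_union, Finset.mem_image, Finset.mem_range, Finset.mem_product, Prod.exists]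
        exact Or.inr ⟨_, _, _, ⟨hl.1, by omega, by omega⟩, rfl⟩
      · unfold full
        simp only
        rw [if_pos hl.2]
        exact ⟨rfl, rfl⟩
  have hreg : ∀ k, ¬ zr R k → reg d A B Nn R u v k = d.full A B Nn R u v k := fun k hk => by
    unfold reg; rw [if_neg hk]
  refine ⟨reg d A B Nn R u v, c, DD, fun i hi => (hDm i hi).2.1, fun i hi => (hDm i hi).2.2, ?_, X.reg_cd,
    fun k q r h => X.reg_wit h, fun k q r i hi hw hC a1 a2 h => X.reg_cut hi hw hC a1 a2 h, ?_, ?_⟩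
  · refine (sum_biUnion_le' _ _ _).trans ?_
    refine (Finset.sum_le_sum (fun p _ => h4 p.1 p.2)).trans ?_
    rw [Finset.sum_const, smul_eq_mul, Finset.card_product, Finset.card_range]
    unfold C0
    apply le_of_eq; ring
  · intro i hi hw hn
    obtain ⟨g1, g2, g3⟩ := hprop i hi hw hn
    rw [hreg _ g2]
    exact ⟨g1, g3⟩
  · intro k
    rcases Finset.eq_empty_or_nonempty (s.filter (fun i => (u ≤ d.x i ∧ d.x i + d.w i ≤ v) ∧ i ∉ DD ∧ c i = k)) with h | ⟨i0, hi0⟩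
    · rw [h]; simp
    rw [Finset.mem_filter] at hi0
    obtain ⟨hi0, hw0, hn0, rfl⟩ := hi0
    obtain ⟨g1, g2, g3⟩ := hprop i0 hi0 hw0 hn0
    rw [hreg _ g2]
    generalize hk : c i0 = k at *
    rcases k with k | e | ⟨θ, α, β⟩
    · refine le_trans (Finset.sum_le_sum_of_subset ?_) (track_sum (T := A) (u := u) (v := v) X.vs.dA (d.key R A u v) ?_ k)
      · intro i hi
        rw [Finset.mem_filter] at hi ⊢
        obtain ⟨h1', h2', h3', h4'⟩ := hi
        rcases (X.vs.hs i).1 h1' with h | h | h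
        · rw [hcA i h] at h4'
          exact ⟨h, h2', IX.a.inj h4'⟩
        · rw [hcB i h] at h4'; cases h4'
        · rw [hcN i h] at h4'; cases h4'
      · intro i hi z hz
        exact key_item X.vs.dA hi hz (CA i hi)
    · refine le_trans (Finset.sum_le_sum_of_subset ?_) (track_sum (T := B) (u := u) (v := v) X.vs.dB (d.kapB A B R u v) ?_ e)
      · intro i hi
        rw [Finset.mem_filter] at hi ⊢
        obtain ⟨h1', h2', h3', h4'⟩ := hi
        rcases (X.vs.hs i).1 h1' with h | h | h
        · rw [hcA i h] at h4'; cases h4'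
        · rw [hcB i h] at h4'
          exact ⟨h, h2', IX.b.inj h4'⟩
        · rw [hcN i h] at h4'; cases h4'
      · intro i hi z hz
        exact X.kapB_item hi hz (CB i hi)
    · have hNi : i0 ∈ Nn := by
        rcases (X.vs.hs i0).1 hi0 with h | h | h
        · rw [hcA i0 h] at hk; cases hk
        · rw [hcB i0 h] at hk; cases hk
        · exact h
      rw [hcN i0 hNi] at hk
      obtain ⟨e1, e2, e3⟩ := IX.n.inj hk
      have hl := h2 _ _ i0 hNi hw0 rfl rfl (hDm' i0 hNi hn0)
      rw [e1, e2, e3] at hl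
      unfold full
      simp only
      rw [if_pos hl.2]
      refine le_trans (Finset.sum_le_sum_of_subset ?_) (h3 α β θ hl.1 hl.2)
      intro i hi
      rw [Finset.mem_filter] at hi ⊢
      obtain ⟨h1', h2', h3', h4'⟩ := hi
      rcases (X.vs.hs i).1 h1' with h | h | h
      · rw [hcA i h] at h4'; cases h4'
      · rw [hcB i h] at h4'; cases h4'
      · rw [hcN i h] at h4'
        obtain ⟨a1, a2, a3⟩ := IX.n.inj h4'
        have := hDm' i h h3'
        rw [a2, a3] at this
        rw [a2, a3] at a1
        exact ⟨h, h2', a2, a3, this, a1⟩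

end PC


noncomputable def CV (R : ℕ) : ℕ := 10 * (R + 1) * ((PC.KF R).card + R + PC.C0 R (TT R))

structure VOut {ι : Type} (d : VD ι) (s Nn : Finset ι) (W m L : ℕ) (X0 : Finset ℕ) where
  KK : Finset ((ℕ × IX) ⊕ ι)
  reg : (ℕ × IX) ⊕ ι → Rg
  c : ι → (ℕ × IX) ⊕ ι
  D : Finset ι
  hcard : KK.card ≤ L
  hD : D ⊆ Nn
  hDs : ∑ i ∈ D, d.w i ≤ L * m
  cd : ∀ k ∈ KK, ∀ k' ∈ KK, k ≠ k' → (reg k).CD (reg k')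
  wit : ∀ k ∈ KK, ∀ q r, (reg k).Mem q r → q < W ∧ ∃ i ∈ s, (reg k).y = d.a i ∧ (reg k).h = d.b i - d.a i ∧
    ∃ z, d.C i z ∧ ∀ l ∈ X0, l ≤ z ↔ l ≤ q
  asg : ∀ i ∈ s, i ∉ D → c i ∈ KK ∧ (reg (c i)).y = d.a i ∧ (reg (c i)).h = d.b i - d.a i
  sum : ∀ k ∈ KK, ∑ i ∈ s with i ∉ D ∧ c i = k, d.w i ≤ (reg k).w

theorem vprime {ι : Type} {d : VD ι} {s A B Nn : Finset ι} {R W m : ℕ} (V : VS d s A B Nn R W m)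
    (X0 : Finset ℕ) (h0 : 0 ∈ X0) (hWX : W ∈ X0) (hX0 : ∀ z ∈ X0, z ≤ W) :
    Nonempty (VOut d s Nn W m (CV R * X0.card) X0) := by
  obtain ⟨X2, hsub, hX2, hcard, hgood⟩ := cuts R W X0 h0 hWX hX0 (d.col d.val A) (d.col d.val B) (d.cut A) (d.cut B)
    V.fAB (fun z h => d.cut_eq V.dA _ h) (fun z h => d.cut_eq V.dB _ h)
  have h02 := hsub h0
  have hW2 := hsub hWX
  have hlo : ∀ u ∈ X2, lo X2 u = u := fun u hu => le_antisymm (lo_mem h02 u).2 (le_lo hu le_rfl)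
  have hloq : ∀ u ∈ X2, ∀ q, u ≤ q → q < hi X2 u → lo X2 q = u := by
    intro u hu q h1 h2
    rw [lo_eq_of h02 (y := u) (by rw [hlo u hu]; exact h1) h2, hlo u hu]
  have hP : ∀ u, ∃ (rg : IX → Rg) (c : ι → IX) (D : Finset ι), u ∈ X2 ∧ u < W →
    D ⊆ Nn ∧ (∀ i ∈ D, u ≤ d.x i ∧ d.x i + d.w i ≤ hi X2 u) ∧ ∑ i ∈ D, d.w i ≤ PC.C0 R (TT R) * m ∧
    (∀ k k', k ≠ k' → (rg k).CD (rg k')) ∧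
    (∀ k q r, (rg k).Mem q r → (u ≤ q ∧ q < hi X2 u) ∧ ∃ i ∈ s, u ≤ d.x i ∧ d.x i + d.w i ≤ hi X2 u ∧ (rg k).y = d.a i ∧
      (rg k).h = d.b i - d.a i) ∧
    (∀ k q r i, i ∈ A ∨ i ∈ B → ¬ (u ≤ d.x i ∧ d.x i + d.w i ≤ hi X2 u) → d.C i q → d.a i ≤ r → r < d.b i →
      (rg k).Mem q r → False) ∧
    (∀ i ∈ s, (u ≤ d.x i ∧ d.x i + d.w i ≤ hi X2 u) → i ∉ D → c i ∈ PC.KF R ∧ (rg (c i)).y = d.a i ∧ (rg (c i)).h = d.b i - d.a i) ∧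
    (∀ k, ∑ i ∈ s with (u ≤ d.x i ∧ d.x i + d.w i ≤ hi X2 u) ∧ i ∉ D ∧ c i = k, d.w i ≤ (rg k).w) := by
    intro u
    by_cases hu : u ∈ X2 ∧ u < W
    swap
    · exact ⟨fun _ => ⟨0, 0, 0, 0⟩, fun _ => IX.a 0, ∅, fun h => absurd h hu⟩
    obtain ⟨g1, g2⟩ := hi_mem hW2 hu.2
    have hg := hgood u hu.2
    rw [hlo u hu.1] at hg
    have main : (∃ X : PC d s A B Nn R W m u (hi X2 u), True) ∨ (∃ X : PC d s B A Nn R W m u (hi X2 u), True) := by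
      rcases hg with h | h | h
      · exact Or.inl ⟨⟨V, g2, hX2 _ g1, Or.inl h⟩, trivial⟩
      · exact Or.inl ⟨⟨V, g2, hX2 _ g1, Or.inr h⟩, trivial⟩
      · exact Or.inr ⟨⟨V.swap, g2, hX2 _ g1, Or.inr h⟩, trivial⟩
    rcases main with ⟨X, -⟩ | ⟨X, -⟩
    · obtain ⟨rg, c, D, hh⟩ := X.piece
      exact ⟨rg, c, D, fun _ => hh⟩
    · obtain ⟨rg, c, D, p1, p2, p3, p4, p5, p6, p7, p8⟩ := X.piece
      exact ⟨rg, c, D, fun _ => ⟨p1, p2, p3, p4, p5, fun k q r i hi => p6 k q r i hi.symm, p7, p8⟩⟩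
  choose rg cc DU hPP using hP
  set crs : ι → Prop := fun i => ∃ l ∈ X2, d.x i < l ∧ l < d.x i + d.w i with hcrs
  set CR := s.filter crs with hCR
  set Up := X2.filter (fun u => u < W) with hUp
  have hUm : ∀ u, u ∈ Up ↔ u ∈ X2 ∧ u < W := fun u => by rw [hUp, Finset.mem_filter]
  have hUc : Up.card ≤ X2.card := Finset.card_filter_le _ _
  -- crossing count
  have hCRc : CR.card ≤ X2.card * R := by
    have hl : ∀ i, ∃ l, i ∈ CR → l ∈ X2 ∧ d.x i < l ∧ l < d.x i + d.w i := by
      intro i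
      by_cases h : i ∈ CR
      · obtain ⟨l, hl⟩ := (Finset.mem_filter.1 h).2
        exact ⟨l, fun _ => hl⟩
      · exact ⟨0, fun h' => absurd h' h⟩
    choose l hl using hl
    have := Finset.card_le_card_of_injOn (s := CR) (t := X2 ×ˢ Finset.range R) (fun i => (l i, d.a i)) ?_ ?_
    · rwa [Finset.card_product, Finset.card_range] at this
    · intro i hi
      have hi' := Finset.mem_coe.1 hi
      have := V.pos i (Finset.mem_filter.1 hi').1
      simp only [Finset.coe_product, Set.mem_prod, Finset.mem_coe, Finset.mem_range]
      exact ⟨(hl i hi').1, by omega⟩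
    · intro i hi j hj he
      have hi' := Finset.mem_coe.1 hi
      have hj' := Finset.mem_coe.1 hj
      simp only [Prod.mk.injEq] at he
      have p1 := V.pos i (Finset.mem_filter.1 hi').1
      have p2 := V.pos j (Finset.mem_filter.1 hj').1
      have l1 := hl i hi'
      have l2 := hl j hj'
      rw [← he.1] at l2
      exact V.dis i (Finset.mem_filter.1 hi').1 j (Finset.mem_filter.1 hj').1 (l i) (d.a i) ⟨by omega, by omega⟩
        ⟨by omega, by omega⟩ le_rfl (by omega) (by omega) (by omega)
  set CT := CR.filter (fun i => i ∉ Nn) with hCT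
  set CN := CR.filter (fun i => i ∈ Nn) with hCN
  have hCTm : ∀ i, i ∈ CT ↔ i ∈ s ∧ crs i ∧ i ∉ Nn := fun i => by rw [hCT, Finset.mem_filter, hCR, Finset.mem_filter, and_assoc]
  have hCNm : ∀ i, i ∈ CN ↔ i ∈ s ∧ crs i ∧ i ∈ Nn := fun i => by rw [hCN, Finset.mem_filter, hCR, Finset.mem_filter, and_assoc]
  have hCTc : CT.card ≤ X2.card * R := (Finset.card_filter_le _ _).trans hCRc
  have hCNc : CN.card ≤ X2.card * R := (Finset.card_filter_le _ _).trans hCRc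
  -- whole vs crossing
  have hwhole : ∀ i ∈ s, ¬ crs i → lo X2 (d.x i) ∈ Up ∧ lo X2 (d.x i) ≤ d.x i ∧ d.x i + d.w i ≤ hi X2 (lo X2 (d.x i)) := by
    intro i hi hc
    have p := V.pos i hi
    obtain ⟨g1, g2⟩ := lo_mem h02 (d.x i)
    refine ⟨(hUm _).2 ⟨g1, by omega⟩, g2, ?_⟩
    by_contra hlt
    obtain ⟨g3, g4⟩ := hi_mem hW2 (show lo X2 (d.x i) < W by omega)
    apply hc
    refine ⟨_, g3, ?_, by omega⟩
    by_contra h5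
    have := le_lo g3 (not_lt.1 h5)
    omega
  have hnw : ∀ i, crs i → ∀ u ∈ Up, ¬ (u ≤ d.x i ∧ d.x i + d.w i ≤ hi X2 u) := by
    rintro i ⟨l, hl, h1, h2⟩ u hu ⟨h3, h4⟩
    have := hi_le hl (show u < l by omega)
    omega
  set reg : (ℕ × IX) ⊕ ι → Rg := fun k => match k with
    | .inl p => rg p.1 p.2
    | .inr i => ⟨d.x i, d.a i, d.w i, d.b i - d.a i⟩ with hreg
  set c : ι → (ℕ × IX) ⊕ ι := fun i => if i ∈ CT then .inr i else .inl (lo X2 (d.x i), cc (lo X2 (d.x i)) i) with hc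
  set D := CN ∪ Up.biUnion DU with hDdef
  have hcT : ∀ i ∈ CT, c i = .inr i := fun i hi => by simp only [hc]; rw [if_pos hi]
  have hcO : ∀ i, i ∉ CT → c i = .inl (lo X2 (d.x i), cc (lo X2 (d.x i)) i) := fun i hi => by
    simp only [hc]; rw [if_neg hi]
  have hnc : ∀ i ∈ s, i ∉ D → i ∉ CT → ¬ crs i := by
    intro i hi h1 h2 h3
    by_cases hn : i ∈ Nn
    · exact h1 (Finset.mem_union_left _ ((hCNm i).2 ⟨hi, h3, hn⟩))
    · exact h2 ((hCTm i).2 ⟨hi, h3, hn⟩)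
  have hDU : ∀ i, i ∉ D → ∀ u ∈ Up, i ∉ DU u := fun i h1 u hu h2 =>
    h1 (Finset.mem_union_right _ (Finset.mem_biUnion.2 ⟨u, hu, h2⟩))
  have hbig : X2.card * ((PC.KF R).card + R + PC.C0 R (TT R)) ≤ CV R * X0.card := by
    refine (Nat.mul_le_mul_right _ hcard).trans (le_of_eq ?_)
    unfold CV; ring
  have hAB : ∀ i ∈ s, i ∉ Nn → i ∈ A ∨ i ∈ B := fun i hi hn => by
    rcases (V.hs i).1 hi with h | h | h
    · exact Or.inl h
    · exact Or.inr h
    · exact absurd h hn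
  have cdmix : ∀ u ∈ Up, ∀ k, ∀ i ∈ CT, (rg u k).CD ⟨d.x i, d.a i, d.w i, d.b i - d.a i⟩ := by
    intro u hu k i hi q r h1 h2
    obtain ⟨_, _, _, _, _, p6, _, _⟩ := hPP u ((hUm u).1 hu)
    rw [hCTm] at hi
    unfold Rg.Mem at h2
    simp only at h2
    exact p6 k q r i (hAB i hi.1 hi.2.2) (hnw i hi.2.1 u hu) ⟨by omega, by omega⟩ (by omega) (by omega) h1
  refine ⟨⟨(Up ×ˢ PC.KF R).disjSum CT, reg, c, D, ?_, ?_, ?_, ?_, ?_, ?_, ?_⟩⟩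
  · rw [Finset.card_disjSum, Finset.card_product]
    refine le_trans ?_ hbig
    have := Nat.mul_le_mul_right (PC.KF R).card hUc
    rw [Nat.mul_add, Nat.mul_add]
    omega
  · intro i hi
    rw [hDdef, Finset.mem_union, Finset.mem_biUnion] at hi
    rcases hi with hi | ⟨u, hu, hi⟩
    · exact ((hCNm i).1 hi).2.2
    · exact (hPP u ((hUm u).1 hu)).1 hi
  · refine (sum_union_le' _ _ _).trans ?_
    have e1 : ∑ i ∈ CN, d.w i ≤ X2.card * R * m := by
      refine (Finset.sum_le_card_nsmul _ _ m (fun i hi => (V.pos i ((hCNm i).1 hi).1).2.1)).trans ?_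
      rw [smul_eq_mul]
      exact Nat.mul_le_mul_right _ hCNc
    have e2 : ∑ i ∈ Up.biUnion DU, d.w i ≤ X2.card * (PC.C0 R (TT R) * m) := by
      refine (sum_biUnion_le' _ _ _).trans ?_
      refine (Finset.sum_le_card_nsmul _ _ (PC.C0 R (TT R) * m) (fun u hu => (hPP u ((hUm u).1 hu)).2.2.1)).trans ?_
      rw [smul_eq_mul]
      exact Nat.mul_le_mul_right _ hUc
    have e3 := Nat.mul_le_mul_right m hbig
    have e4 : X2.card * R * m + X2.card * (PC.C0 R (TT R) * m) ≤
        X2.card * ((PC.KF R).card + R + PC.C0 R (TT R)) * m := by nlinarith [Nat.zero_le (X2.card * (PC.KF R).card * m)]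
    omega
  · intro k hk k' hk' hne
    rcases k with ⟨u, k⟩ | i <;> rcases k' with ⟨u', k'⟩ | i'
    · rw [Finset.inl_mem_disjSum, Finset.mem_product] at hk hk'
      by_cases huu : u = u'
      · subst huu
        exact (hPP u ((hUm u).1 hk.1)).2.2.2.1 k k' (fun h => hne (by rw [h]))
      · intro q r h1 h2
        have a1 := ((hPP u ((hUm u).1 hk.1)).2.2.2.2.1 k q r h1).1
        have a2 := ((hPP u' ((hUm u').1 hk'.1)).2.2.2.2.1 k' q r h2).1
        apply huu
        rw [← hloq u ((hUm u).1 hk.1).1 q a1.1 a1.2, hloq u' ((hUm u').1 hk'.1).1 q a2.1 a2.2]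
    · rw [Finset.inl_mem_disjSum, Finset.mem_product] at hk
      rw [Finset.inr_mem_disjSum] at hk'
      exact cdmix u hk.1 k i' hk'
    · rw [Finset.inl_mem_disjSum, Finset.mem_product] at hk'
      rw [Finset.inr_mem_disjSum] at hk
      exact (cdmix u' hk'.1 k' i hk).symm
    · rw [Finset.inr_mem_disjSum] at hk hk'
      intro q r h1 h2
      simp only [hreg, Rg.Mem] at h1 h2
      apply hne
      rw [V.dis i ((hCTm i).1 hk).1 i' ((hCTm i').1 hk').1 q r ⟨by omega, by omega⟩ ⟨by omega, by omega⟩ (by omega) (by omega) (by omega) (by omega)]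
  · intro k hk q r h1
    rcases k with ⟨u, k⟩ | i
    · rw [Finset.inl_mem_disjSum, Finset.mem_product] at hk
      obtain ⟨a1, i, hi, a2, a3, a4, a5⟩ := (hPP u ((hUm u).1 hk.1)).2.2.2.2.1 k q r h1
      obtain ⟨g1, g2⟩ := hi_mem hW2 ((hUm u).1 hk.1).2
      have := hX2 _ g1
      have p := V.pos i hi
      refine ⟨by omega, i, hi, a4, a5, d.x i, ⟨le_rfl, by omega⟩, ?_⟩
      intro l hl
      rcases Nat.lt_or_ge u l with h | h
      · have := hi_le (hsub hl) h
        omega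
      · omega
    · rw [Finset.inr_mem_disjSum] at hk
      simp only [hreg, Rg.Mem] at h1
      have hi := ((hCTm i).1 hk).1
      have p := V.pos i hi
      exact ⟨by omega, i, hi, rfl, rfl, q, ⟨by omega, by omega⟩, fun l _ => Iff.rfl⟩
  · intro i hi hn
    by_cases hT : i ∈ CT
    · rw [hcT i hT]
      exact ⟨by rw [Finset.inr_mem_disjSum]; exact hT, rfl, rfl⟩
    · rw [hcO i hT]
      obtain ⟨w1, w2, w3⟩ := hwhole i hi (hnc i hi hn hT)
      obtain ⟨p1, p2⟩ := (hPP _ ((hUm _).1 w1)).2.2.2.2.2.2.1 i hi ⟨w2, w3⟩ (hDU i hn _ w1)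
      exact ⟨by rw [Finset.inl_mem_disjSum, Finset.mem_product]; exact ⟨w1, p1⟩, p2⟩
  · intro k hk
    rcases k with ⟨u, k⟩ | i
    · rw [Finset.inl_mem_disjSum, Finset.mem_product] at hk
      refine le_trans (Finset.sum_le_sum_of_subset ?_) ((hPP u ((hUm u).1 hk.1)).2.2.2.2.2.2.2 k)
      intro i hi
      simp only [Finset.mem_filter] at hi ⊢
      obtain ⟨h1, h2, h3⟩ := hi
      by_cases hT : i ∈ CT
      · rw [hcT i hT] at h3; cases h3
      · rw [hcO i hT] at h3
        have h4 := Sum.inl.inj h3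
        obtain ⟨h5, h6⟩ := Prod.mk.inj h4
        obtain ⟨w1, w2, w3⟩ := hwhole i h1 (hnc i h1 h2 hT)
        subst h5
        exact ⟨h1, ⟨w2, w3⟩, hDU i h2 _ w1, h6⟩
    · have hs : (s.filter (fun j => j ∉ D ∧ c j = Sum.inr i)) ⊆ {i} := by
        intro j hj
        simp only [Finset.mem_filter] at hj
        rw [Finset.mem_singleton]
        by_cases hT : j ∈ CT
        · have := hj.2.2
          rw [hcT j hT] at this
          exact Sum.inr.inj this
        · have := hj.2.2
          rw [hcO j hT] at this; cases this
      refine le_trans (Finset.sum_le_sum_of_subset hs) ?_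
      rw [Finset.sum_singleton]


structure VFin {ι κo : Type} (r : ι → Rg) (V : Finset ι) (obs : κo → Rg) (W H1 K : ℕ) where
  KK : Finset (((ℕ × IX) ⊕ ι) ⊕ ι)
  reg : ((ℕ × IX) ⊕ ι) ⊕ ι → Rg
  c : ι → ((ℕ × IX) ⊕ ι) ⊕ ι
  D : Finset ι
  hcard : KK.card ≤ K
  hD : D ⊆ V
  hDh : ∀ i ∈ D, 3 * (r i).h ≤ H1
  hDs : 10 * ∑ i ∈ D, (r i).w ≤ W
  cd : ∀ k ∈ KK, ∀ k' ∈ KK, k ≠ k' → (reg k).CD (reg k')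
  cdo : ∀ k ∈ KK, ∀ o, (reg k).CD (obs o)
  inn : ∀ k ∈ KK, (reg k).Sub ⟨0, 0, W, H1⟩
  asg : ∀ i ∈ V, i ∉ D → c i ∈ KK ∧ (reg (c i)).h = (r i).h
  sum : ∀ k ∈ KK, ∑ i ∈ V with i ∉ D ∧ c i = k, (r i).w ≤ (reg k).w
  area : ∑ k ∈ KK, (reg k).w * (reg k).h ≤ ∑ i ∈ V, (r i).w * (r i).h

theorem vfin_vs {ι : Type} (r : ι → Rg) (a b : ι → ℕ) (s : Finset ι) (W H1 g R m : ℕ) (hg : 0 < g)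
    (hR : H1 ≤ g * R)
    (hV : ∀ i ∈ s, 0 < (r i).w ∧ (r i).w ≤ m ∧ (r i).x + (r i).w ≤ W ∧ a i < b i ∧ (r i).y = g * a i ∧
      (r i).y + (r i).h = g * b i ∧ g * b i ≤ H1)
    (hcd : ∀ i ∈ s, ∀ j ∈ s, i ≠ j → (r i).CD (r j)) :
    ∃ (d : VD ι) (A B : Finset ι), d.x = (fun i => (r i).x) ∧ d.w = (fun i => (r i).w) ∧ d.a = a ∧ d.b = b ∧
      VS d s A B (s.filter (fun i => 3 * (r i).h ≤ H1)) R W m := by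
  obtain ⟨p, hp1, hp2⟩ : ∃ p, 3 * p ≤ H1 ∧ H1 ≤ 3 * p + 2 := ⟨H1 / 3, by omega, by omega⟩
  obtain ⟨ρ1, hρ1⟩ : ∃ ρ1, ρ1 = p / g := ⟨_, rfl⟩
  obtain ⟨ρ2, hρ2⟩ : ∃ ρ2, ρ2 = (2 * p + 1) / g := ⟨_, rfl⟩
  have hle : ρ1 ≤ ρ2 := by rw [hρ1, hρ2]; exact Nat.div_le_div_right (by omega)
  set A := s.filter (fun i => H1 < 3 * (r i).h ∧ a i ≤ ρ1 ∧ ρ1 < b i) with hA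
  set B := s.filter (fun i => H1 < 3 * (r i).h ∧ ¬ (a i ≤ ρ1 ∧ ρ1 < b i)) with hB
  have hbR : ∀ i ∈ s, b i ≤ R := fun i hi =>
    Nat.le_of_mul_le_mul_left ((hV i hi).2.2.2.2.2.2.trans hR) hg
  have hAm : ∀ i, i ∈ A ↔ i ∈ s ∧ H1 < 3 * (r i).h ∧ a i ≤ ρ1 ∧ ρ1 < b i := by
    intro i; simp only [hA, Finset.mem_filter]
  have hBm : ∀ i, i ∈ B ↔ i ∈ s ∧ H1 < 3 * (r i).h ∧ ¬ (a i ≤ ρ1 ∧ ρ1 < b i) := by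
    intro i; simp only [hB, Finset.mem_filter]
  have hB2 : ∀ i ∈ B, ρ1 < a i ∧ a i ≤ ρ2 ∧ ρ2 < b i := by
    intro i hi
    obtain ⟨hi, h1, h2⟩ := (hBm i).1 hi
    obtain ⟨v1, v2, v3, v4, v5, v6, v7⟩ := hV i hi
    have key : (a i ≤ ρ1 ∧ ρ1 < b i) ∨ (a i ≤ ρ2 ∧ ρ2 < b i) := by
      have e1 : ∀ t, (a i ≤ t / g ↔ g * a i ≤ t) ∧ (t / g < b i ↔ t < g * b i) := by
        intro t
        rw [Nat.le_div_iff_mul_le hg, Nat.div_lt_iff_lt_mul hg, mul_comm (a i), mul_comm (b i)]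
        exact ⟨Iff.rfl, Iff.rfl⟩
      rw [hρ1, hρ2, (e1 _).1, (e1 _).2, (e1 _).1, (e1 _).2]
      omega
    rcases key with h | h
    · exact absurd h h2
    · refine ⟨?_, h⟩
      omega
  have hdis : ∀ i ∈ s, ∀ j ∈ s, ∀ z q, ((r i).x ≤ z ∧ z < (r i).x + (r i).w) → ((r j).x ≤ z ∧ z < (r j).x + (r j).w) →
      a i ≤ q → q < b i → a j ≤ q → q < b j → i = j := by
    intro i hi j hj z q h1 h2 h3 h4 h5 h6
    by_contra hne
    have vi := hV i hi
    have vj := hV j hj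
    refine hcd i hi j hj hne z (g * q) ⟨h1.1, h1.2, ?_, ?_⟩ ⟨h2.1, h2.2, ?_, ?_⟩
    · rw [vi.2.2.2.2.1]; exact Nat.mul_le_mul_left _ h3
    · rw [vi.2.2.2.2.2.1]; exact Nat.mul_lt_mul_of_pos_left h4 hg
    · rw [vj.2.2.2.2.1]; exact Nat.mul_le_mul_left _ h5
    · rw [vj.2.2.2.2.2.1]; exact Nat.mul_lt_mul_of_pos_left h6 hg
  refine ⟨⟨fun i => (r i).x, fun i => (r i).w, a, b, fun i => if i ∈ A then b i else R - a i⟩, A, B, rfl, rfl, rfl, rfl, ?_⟩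
  have nAB : ∀ i, i ∈ A → i ∉ B := by
    intro i h1 h2
    exact ((hBm i).1 h2).2.2 ((hAm i).1 h1).2.2
  have vA : ∀ i ∈ A, (if i ∈ A then b i else R - a i) = b i := fun i h => if_pos h
  have vB : ∀ i ∈ B, (if i ∈ A then b i else R - a i) = R - a i := fun i h => if_neg (fun h' => nAB i h' h)
  refine ⟨?_, ?_, ?_, ?_, ?_, ?_, ?_, ?_, ?_, ?_, ?_, ?_⟩
  · intro i
    rw [hAm, hBm]
    simp only [Finset.mem_filter]
    by_cases hi : i ∈ s
    · simp only [hi, true_and]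
      simp only [true_iff]
      by_cases h : H1 < 3 * (r i).h
      · by_cases h' : a i ≤ ρ1 ∧ ρ1 < b i
        · exact Or.inl ⟨h, h'⟩
        · exact Or.inr (Or.inl ⟨h, h'⟩)
      · exact Or.inr (Or.inr (not_lt.1 h))
    · simp [hi]
  · intro i hi
    obtain ⟨v1, v2, v3, v4, v5, v6, v7⟩ := hV i hi
    exact ⟨v1, v2, v3, v4, hbR i hi⟩
  · intro i hi j hj z q h1 h2 h3 h4 h5 h6
    exact hdis i hi j hj z q h1 h2 h3 h4 h5 h6
  · intro i hi j hj z h1 h2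
    have e1 := (hAm i).1 hi
    have e2 := (hAm j).1 hj
    exact hdis i e1.1 j e2.1 z ρ1 h1 h2 e1.2.2.1 e1.2.2.2 e2.2.2.1 e2.2.2.2
  · intro i hi j hj z h1 h2
    have e1 := hB2 i hi
    have e2 := hB2 j hj
    exact hdis i ((hBm i).1 hi).1 j ((hBm j).1 hj).1 z ρ2 h1 h2 e1.2.1 e1.2.2 e2.2.1 e2.2.2
  · first | exact nAB | (intro i; exact nAB i)
  · intro i h1 h2
    simp only [Finset.mem_filter] at h2
    have := ((hAm i).1 h1).2.1
    omega
  · intro i h1 h2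
    simp only [Finset.mem_filter] at h2
    have := ((hBm i).1 h1).2.1
    omega
  · intro i hi
    show 1 ≤ (if i ∈ A then b i else R - a i) ∧ (if i ∈ A then b i else R - a i) ≤ R
    rw [vA i hi]
    have e := (hAm i).1 hi
    have := hbR i e.1
    omega
  · intro i hi
    show 1 ≤ (if i ∈ A then b i else R - a i) ∧ (if i ∈ A then b i else R - a i) ≤ R
    rw [vB i hi]
    have e := (hBm i).1 hi
    have := hbR i e.1
    have := (hV i e.1).2.2.2.1
    omega
  · intro i hi j hj z h1 h2
    show (if i ∈ A then b i else R - a i) + (if j ∈ A then b j else R - a j) ≤ R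
    rw [vA i hi, vB j hj]
    have e1 := (hAm i).1 hi
    have e2 := (hBm j).1 hj
    have e3 := hB2 j hj
    have := hbR j e2.1
    by_contra hc
    have := hdis i e1.1 j e2.1 z (a j) h1 h2 (by omega) (by omega) le_rfl (by omega)
    subst this
    exact nAB i hi hj
  · intro i hi j hj h1
    replace h1 : (if i ∈ A then b i else R - a i) + (if j ∈ A then b j else R - a j) ≤ R := h1
    rw [vA i hi, vB j hj] at h1
    have e2 := (hBm j).1 hj
    have := hbR j e2.1
    have := (hV j e2.1).2.2.2.1
    have : b i ≤ a j := by omega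
    show b i ≤ a j ∨ b j ≤ a i
    omega


/-- moving a cell of a vertical region to the column of a witness item -/
theorem obs_move (o : Rg) (W : ℕ) (X0 : Finset ℕ) (h1 : o.x ≤ W → o.x ∈ X0)
    (h2 : o.x + o.w ≤ W → o.x + o.w ∈ X0) (q z ρ : ℕ) (hq : q < W) (hz : z < W)
    (hl : ∀ l ∈ X0, l ≤ z ↔ l ≤ q) (hm : o.Mem q ρ) : o.Mem z ρ := by
  obtain ⟨m1, m2, m3, m4⟩ := hm
  have e1 := hl _ (h1 (by omega))
  refine ⟨e1.2 m1, ?_, m3, m4⟩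
  by_cases h : o.x + o.w ≤ W
  · have := hl _ (h2 h)
    omega
  · omega

theorem vfin (R L : ℕ) : ∃ K : ℕ, ∀ (ι κo : Type) (_ : Fintype κo) (r : ι → Rg) (a b : ι → ℕ) (V : Finset ι)
    (obs : κo → Rg) (W H1 g : ℕ), 0 < W → 0 < g → H1 ≤ g * R → Fintype.card κo ≤ L →
    (∀ i ∈ V, 0 < (r i).w ∧ (r i).x + (r i).w ≤ W ∧ a i < b i ∧ (r i).y = g * a i ∧
      (r i).y + (r i).h = g * b i ∧ g * b i ≤ H1) →
    (∀ i ∈ V, ∀ j ∈ V, i ≠ j → (r i).CD (r j)) →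
    (∀ i ∈ V, ∀ o, (obs o).CD (r i)) →
    Nonempty (VFin r V obs W H1 K) := by
  obtain ⟨N, hN⟩ := threshold R (20 * CV R * (L + 1) + 1)
  refine ⟨CV R * (2 + 2 * L + 2 * N) + N, ?_⟩
  intro ι κo _ r a b V obs W H1 g hW hg hR hL hV hcd hobs
  have hinV : ∀ i ∈ V, (r i).Sub ⟨0, 0, W, H1⟩ := by
    intro i hi q ρ hm
    obtain ⟨v1, v2, v3, v4, v5, v6⟩ := hV i hi
    obtain ⟨m1, m2, m3, m4⟩ := hm
    refine ⟨Nat.zero_le _, ?_, Nat.zero_le _, ?_⟩ <;> simp only [zero_add] <;> omega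
  have hh : ∀ i ∈ V, (r i).h = g * (b i - a i) := by
    intro i hi
    obtain ⟨v1, v2, v3, v4, v5, v6⟩ := hV i hi
    rw [Nat.mul_sub]; omega
  have hsumW : ∑ i ∈ V, (r i).w ≤ R * W := by
    have h1 := sum_area_le V r ⟨0, 0, W, H1⟩ hcd hinV
    have h2 : g * ∑ i ∈ V, (r i).w ≤ ∑ i ∈ V, (r i).w * (r i).h := by
      rw [Finset.mul_sum]
      apply Finset.sum_le_sum
      intro i hi
      rw [hh i hi, mul_comm]
      apply Nat.mul_le_mul_left
      have := (hV i hi).2.2.1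
      exact Nat.le_mul_of_pos_right _ (by omega)
    apply Nat.le_of_mul_le_mul_left _ hg
    calc g * ∑ i ∈ V, (r i).w ≤ W * H1 := h2.trans h1
      _ ≤ W * (g * R) := Nat.mul_le_mul_left _ hR
      _ = g * (R * W) := by ring
  obtain ⟨m, hm1, hm2⟩ := hN ι V (fun i => (r i).w) W hW hsumW
  obtain ⟨Bg, hBg⟩ : ∃ Bg, Bg = V.filter (fun i => m < (r i).w) := ⟨_, rfl⟩
  obtain ⟨s, hs⟩ : ∃ s, s = V.filter (fun i => ¬ m < (r i).w) := ⟨_, rfl⟩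
  have hcardB : (V.filter (fun i => m < (r i).w)).card = Bg.card := by rw [hBg]
  rw [hcardB] at hm1 hm2
  have hBm : ∀ i, i ∈ Bg ↔ i ∈ V ∧ m < (r i).w := by
    intro i; rw [hBg]; simp only [Finset.mem_filter]
  have hsm : ∀ i, i ∈ s ↔ i ∈ V ∧ ¬ m < (r i).w := by
    intro i; rw [hs]; simp only [Finset.mem_filter]
  obtain ⟨d, A, B, dx, dw, da, db, VSd⟩ := vfin_vs r a b s W H1 g R m hg hR
    (fun i hi => by
      obtain ⟨h1, h2⟩ := (hsm i).1 hi
      obtain ⟨v1, v2, v3, v4, v5, v6⟩ := hV i h1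
      exact ⟨v1, not_lt.1 h2, v2, v3, v4, v5, v6⟩)
    (fun i hi j hj => hcd i ((hsm i).1 hi).1 j ((hsm j).1 hj).1)
  set X1 : Finset ℕ := ({0, W} : Finset ℕ) ∪ ((Finset.univ.image (fun o => (obs o).x) ∪ Finset.univ.image (fun o => (obs o).x + (obs o).w))
    ∪ (Bg.image (fun i => (r i).x) ∪ Bg.image (fun i => (r i).x + (r i).w))) with hX1
  set X0 := X1.filter (fun z => z ≤ W) with hX0
  have hX0m : ∀ z, z ∈ X0 ↔ z ∈ X1 ∧ z ≤ W := by
    intro z; simp only [hX0, Finset.mem_filter]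
  have hcX : X0.card ≤ 2 + 2 * L + 2 * Bg.card := by
    have c0 := Finset.card_le_two (a := 0) (b := W)
    have c1 : (Finset.univ.image (fun o => (obs o).x)).card ≤ L := Finset.card_image_le.trans hL
    have c2 : (Finset.univ.image (fun o => (obs o).x + (obs o).w)).card ≤ L := Finset.card_image_le.trans hL
    have c3 : (Bg.image (fun i => (r i).x)).card ≤ Bg.card := Finset.card_image_le
    have c4 : (Bg.image (fun i => (r i).x + (r i).w)).card ≤ Bg.card := Finset.card_image_le
    have c5 : X0.card ≤ X1.card := Finset.card_filter_le _ _
    have c6 := Finset.card_union_le ({0, W} : Finset ℕ) ((Finset.univ.image (fun o => (obs o).x) ∪ Finset.univ.image (fun o => (obs o).x + (obs o).w))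
      ∪ (Bg.image (fun i => (r i).x) ∪ Bg.image (fun i => (r i).x + (r i).w)))
    have c7 := Finset.card_union_le (Finset.univ.image (fun o => (obs o).x) ∪ Finset.univ.image (fun o => (obs o).x + (obs o).w))
      (Bg.image (fun i => (r i).x) ∪ Bg.image (fun i => (r i).x + (r i).w))
    have c8 := Finset.card_union_le (Finset.univ.image (fun o => (obs o).x)) (Finset.univ.image (fun o => (obs o).x + (obs o).w))
    have c9 := Finset.card_union_le (Bg.image (fun i => (r i).x)) (Bg.image (fun i => (r i).x + (r i).w))
    rw [← hX1] at c6
    omega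
  have hXo : ∀ o, (obs o).x ∈ X1 ∧ (obs o).x + (obs o).w ∈ X1 := by
    intro o
    simp only [hX1, Finset.mem_union, Finset.mem_image]
    exact ⟨Or.inr (Or.inl (Or.inl ⟨o, Finset.mem_univ _, rfl⟩)), Or.inr (Or.inl (Or.inr ⟨o, Finset.mem_univ _, rfl⟩))⟩
  have hXb : ∀ o ∈ Bg, (r o).x ∈ X1 ∧ (r o).x + (r o).w ∈ X1 := by
    intro o ho
    simp only [hX1, Finset.mem_union, Finset.mem_image]
    exact ⟨Or.inr (Or.inr (Or.inl ⟨o, ho, rfl⟩)), Or.inr (Or.inr (Or.inr ⟨o, ho, rfl⟩))⟩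
  obtain ⟨O⟩ := vprime VSd X0 ((hX0m 0).2 ⟨by simp [hX1], Nat.zero_le _⟩) ((hX0m W).2 ⟨by simp [hX1], le_rfl⟩)
    (fun z hz => ((hX0m z).1 hz).2)
  obtain ⟨S, hS⟩ : ∃ S : (ℕ × IX) ⊕ ι → ℕ, S = fun k => ∑ i ∈ s with i ∉ O.D ∧ O.c i = k, (r i).w := ⟨_, rfl⟩
  have hSle : ∀ k ∈ O.KK, S k ≤ (O.reg k).w := by
    intro k hk
    have := O.sum k hk
    rw [dw] at this
    rw [hS]; exact this
  obtain ⟨rg, hrg⟩ : ∃ rg : ((ℕ × IX) ⊕ ι) ⊕ ι → Rg, rg = fun k => match k with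
    | Sum.inl k => ⟨(O.reg k).x, g * (O.reg k).y, S k, g * (O.reg k).h⟩
    | Sum.inr i => r i := ⟨_, rfl⟩
  have hrl : ∀ k, rg (Sum.inl k) = ⟨(O.reg k).x, g * (O.reg k).y, S k, g * (O.reg k).h⟩ := by intro k; rw [hrg]
  have hrr : ∀ i, rg (Sum.inr i) = r i := by intro i; rw [hrg]
  obtain ⟨c, hc⟩ : ∃ c : ι → ((ℕ × IX) ⊕ ι) ⊕ ι, c = fun i => if i ∈ Bg then Sum.inr i else Sum.inl (O.c i) := ⟨_, rfl⟩
  have hcB : ∀ i ∈ Bg, c i = Sum.inr i := by intro i hi; rw [hc]; exact if_pos hi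
  have hcs : ∀ i ∉ Bg, c i = Sum.inl (O.c i) := by intro i hi; rw [hc]; exact if_neg hi
  have hDs : O.D ⊆ s := fun i hi => (Finset.mem_filter.1 (O.hD hi)).1
  have hsB : ∀ i, i ∈ s → i ∉ Bg := fun i h1 h2 => ((hsm i).1 h1).2 ((hBm i).1 h2).2
  have hVs : ∀ i, i ∈ V → i ∉ Bg → i ∈ s := fun i h1 h2 =>
    (hsm i).2 ⟨h1, fun h => h2 ((hBm i).2 ⟨h1, h⟩)⟩
  have hmem : ∀ k ∈ O.KK, ∀ q ρ, (rg (Sum.inl k)).Mem q ρ → (O.reg k).Mem q (ρ / g) := by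
    intro k hk q ρ hm
    rw [hrl] at hm
    obtain ⟨m1, m2, m3, m4⟩ := hm
    simp only at m1 m2 m3 m4
    have := hSle k hk
    refine ⟨m1, by omega, ?_, ?_⟩
    · rw [Nat.le_div_iff_mul_le hg, mul_comm]; exact m3
    · rw [Nat.div_lt_iff_lt_mul hg, mul_comm, Nat.mul_add]; exact m4
  -- move to a cell of an item
  have hmove : ∀ k ∈ O.KK, ∀ q ρ, (rg (Sum.inl k)).Mem q ρ → q < W ∧ ∃ i ∈ s, ∃ z, (r i).Mem z ρ ∧ ∀ l ∈ X0, l ≤ z ↔ l ≤ q := by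
    intro k hk q ρ hm
    obtain ⟨h1, i, hi, h2, h3, z, h4, h5⟩ := O.wit k hk q _ (hmem k hk q ρ hm)
    refine ⟨h1, i, hi, z, ?_, h5⟩
    have hiV := ((hsm i).1 hi).1
    obtain ⟨v1, v2, v3, v4, v5, v6⟩ := hV i hiV
    have hhi := hh i hiV
    rw [hrl] at hm
    obtain ⟨m1, m2, m3, m4⟩ := hm
    simp only at m1 m2 m3 m4
    rw [h2, da] at m3
    rw [h2, h3, da, db] at m4
    unfold VD.C at h4
    rw [dx, dw] at h4
    exact ⟨h4.1, h4.2, by rw [v4]; exact m3, by rw [v4, hhi]; exact m4⟩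
  have hcdX : ∀ k ∈ O.KK, ∀ o : Rg, o.x ∈ X1 → o.x + o.w ∈ X1 → (∀ i ∈ s, o.CD (r i)) → (rg (Sum.inl k)).CD o := by
    intro k hk o h1 h2 h3 q ρ m1 m2
    obtain ⟨hq, i, hi, z, hz, hl⟩ := hmove k hk q ρ m1
    have := hinV i ((hsm i).1 hi).1 _ _ hz
    have hz' : z < W := by have := this.2.1; simpa using this
    exact h3 i hi z ρ (obs_move o W X0 (fun h => (hX0m _).2 ⟨h1, h⟩) (fun h => (hX0m _).2 ⟨h2, h⟩) q z ρ hq hz' hl m2) hz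
  have hL' : O.KK.card ≤ CV R * (2 + 2 * L + 2 * Bg.card) := O.hcard.trans (Nat.mul_le_mul_left _ hcX)
  refine ⟨⟨O.KK.disjSum Bg, rg, c, O.D, ?_, ?_, ?_, ?_, ?_, ?_, ?_, ?_, ?_, ?_⟩⟩
  · rw [Finset.card_disjSum]
    have : CV R * (2 + 2 * L + 2 * Bg.card) ≤ CV R * (2 + 2 * L + 2 * N) := Nat.mul_le_mul_left _ (by omega)
    omega
  · exact fun i hi => ((hsm i).1 (hDs hi)).1
  · intro i hi
    have := O.hD hi
    simp only [Finset.mem_filter] at this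
    exact this.2
  · have h1 := O.hDs
    rw [dw] at h1
    calc 10 * ∑ i ∈ O.D, (r i).w ≤ 10 * (CV R * X0.card * m) := Nat.mul_le_mul_left _ h1
      _ ≤ 10 * (CV R * (2 + 2 * L + 2 * Bg.card) * m) := by gcongr
      _ = (20 * CV R * (L + 1) + 20 * CV R * Bg.card) * m := by ring
      _ ≤ ((20 * CV R * (L + 1) + 1) * (20 * CV R * (L + 1) + 1 + Bg.card)) * m := by
        apply Nat.mul_le_mul_right
        have e : 20 * CV R * Bg.card ≤ 20 * CV R * (L + 1) * Bg.card := by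
          apply Nat.mul_le_mul_right
          exact Nat.le_mul_of_pos_right _ (by omega)
        generalize 20 * CV R * (L + 1) = P at e ⊢
        generalize 20 * CV R * Bg.card = Q at e ⊢
        have e2 : (P + 1) * (P + 1 + Bg.card) = P * P + 2 * P + 1 + P * Bg.card + Bg.card := by ring
        rw [e2]
        have := Nat.zero_le (P * P)
        omega
      _ ≤ W := hm1
  · intro k hk k' hk' hne
    rcases k with k | i <;> rcases k' with k' | i'
    · rw [Finset.inl_mem_disjSum] at hk hk'
      intro q ρ h1 h2
      exact O.cd k hk k' hk' (fun h => hne (by rw [h])) _ _ (hmem k hk q ρ h1) (hmem k' hk' q ρ h2)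
    · rw [Finset.inl_mem_disjSum] at hk
      rw [Finset.inr_mem_disjSum] at hk'
      rw [hrr]
      exact hcdX k hk _ (hXb i' hk').1 (hXb i' hk').2 (fun j hj => hcd i' ((hBm i').1 hk').1 j ((hsm j).1 hj).1
        (fun h => hsB j hj (h ▸ hk')))
    · rw [Finset.inl_mem_disjSum] at hk'
      rw [Finset.inr_mem_disjSum] at hk
      rw [hrr]
      exact (hcdX k' hk' _ (hXb i hk).1 (hXb i hk).2 (fun j hj => hcd i ((hBm i).1 hk).1 j ((hsm j).1 hj).1
        (fun h => hsB j hj (h ▸ hk)))).symm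
    · rw [Finset.inr_mem_disjSum] at hk hk'
      rw [hrr, hrr]
      exact hcd i ((hBm i).1 hk).1 i' ((hBm i').1 hk').1 (fun h => hne (by rw [h]))
  · intro k hk o
    rcases k with k | i
    · rw [Finset.inl_mem_disjSum] at hk
      exact hcdX k hk _ (hXo o).1 (hXo o).2 (fun i hi => hobs i ((hsm i).1 hi).1 o)
    · rw [Finset.inr_mem_disjSum] at hk
      rw [hrr]
      exact (hobs i ((hBm i).1 hk).1 o).symm
  · intro k hk
    rcases k with k | i
    · rw [Finset.inl_mem_disjSum] at hk
      intro q ρ hm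
      obtain ⟨hq, i, hi, z, hz, hl⟩ := hmove k hk q ρ hm
      have := hinV i ((hsm i).1 hi).1 _ _ hz
      exact ⟨Nat.zero_le _, by simpa using hq, this.2.2⟩
    · rw [Finset.inr_mem_disjSum] at hk
      rw [hrr]
      exact hinV i ((hBm i).1 hk).1
  · intro i hi hD
    by_cases hb : i ∈ Bg
    · rw [hcB i hb, hrr]
      exact ⟨by rw [Finset.inr_mem_disjSum]; exact hb, rfl⟩
    · rw [hcs i hb, hrl]
      obtain ⟨h1, h2, h3⟩ := O.asg i (hVs i hi hb) hD
      refine ⟨by rw [Finset.inl_mem_disjSum]; exact h1, ?_⟩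
      simp only
      rw [h3, hh i hi, da, db]
  · intro k hk
    rcases k with k | i
    · rw [hrl, hS]
      apply le_of_eq
      apply Finset.sum_congr _ (fun _ _ => rfl)
      ext i
      simp only [Finset.mem_filter]
      constructor
      · rintro ⟨h1, h2, h3⟩
        have hb : i ∉ Bg := by intro hb; rw [hcB i hb] at h3; cases h3
        rw [hcs i hb] at h3
        exact ⟨hVs i h1 hb, h2, Sum.inl.inj h3⟩
      · rintro ⟨h1, h2, h3⟩
        exact ⟨((hsm i).1 h1).1, h2, by rw [hcs i (hsB i h1), h3]⟩
    · rw [hrr]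
      have hsub : (V.filter (fun j => j ∉ O.D ∧ c j = Sum.inr i)) ⊆ {i} := by
        intro j hj
        simp only [Finset.mem_filter] at hj
        rw [Finset.mem_singleton]
        by_cases hb : j ∈ Bg
        · have := hj.2.2
          rw [hcB j hb] at this
          exact Sum.inr.inj this
        · have := hj.2.2
          rw [hcs j hb] at this; cases this
      refine le_trans (Finset.sum_le_sum_of_subset hsub) ?_
      rw [Finset.sum_singleton]
  · rw [Finset.sum_disjSum]
    have hVsum : ∑ i ∈ V, (r i).w * (r i).h = ∑ i ∈ s, (r i).w * (r i).h + ∑ i ∈ Bg, (r i).w * (r i).h := by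
      rw [hs, hBg, add_comm, Finset.sum_filter_add_sum_filter_not]
    rw [hVsum]
    apply Nat.add_le_add
    · have hle : ∑ i ∈ s.filter (fun i => i ∉ O.D), (r i).w * (r i).h ≤ ∑ i ∈ s, (r i).w * (r i).h :=
        Finset.sum_le_sum_of_subset (Finset.filter_subset _ _)
      refine le_trans (le_of_eq ?_) hle
      rw [← Finset.sum_fiberwise_of_maps_to (s := s.filter (fun i => i ∉ O.D)) (t := O.KK) (g := O.c)
        (fun i hi => by
          simp only [Finset.mem_filter] at hi
          exact (O.asg i hi.1 hi.2).1)]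
      apply Finset.sum_congr rfl
      intro k hk
      rw [hrl]
      simp only [hS]
      rw [Finset.sum_mul]
      have : (s.filter (fun i => i ∉ O.D)).filter (fun i => O.c i = k) = s.filter (fun i => i ∉ O.D ∧ O.c i = k) := by
        ext i; simp only [Finset.mem_filter]; tauto
      rw [this]
      apply Finset.sum_congr rfl
      intro i hi
      simp only [Finset.mem_filter] at hi
      obtain ⟨h1, h2, h3⟩ := O.asg i hi.1 hi.2.1
      rw [hi.2.2] at h3
      rw [h3, da, db, hh i ((hsm i).1 hi.1).1]
    · apply le_of_eq
      apply Finset.sum_congr rfl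
      intro i _
      rw [hrr]


def NonSm {ι : Type} (w h : ι → ℕ) (W H d : ℕ) (i : ι) : Prop := H < d * h i ∨ W < d * w i

structure MainOut {ι : Type} [Fintype ι] (w h : ι → ℕ) (W H e d K : ℕ) where
  H1 : ℕ
  κ : Type
  KK : Finset κ
  reg : κ → Rg
  vert : κ → Prop
  c : ι → κ
  Dv : Finset ι
  Dw : Finset ι
  hcard : KK.card ≤ K
  hH : H ≤ H1
  hH1 : e * H1 ≤ (e + 1) * H
  inn : ∀ k ∈ KK, (reg k).x + (reg k).w ≤ W ∧ (reg k).y + (reg k).h ≤ H1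
  rd : ∀ k ∈ KK, ∀ k' ∈ KK, k ≠ k' → RectDisjoint (reg k).x (reg k).y (reg k).w (reg k).h (reg k').x (reg k').y (reg k').w (reg k').h
  asg : ∀ i, NonSm w h W H d i → i ∉ Dv → i ∉ Dw → c i ∈ KK ∧ (vert (c i) → h i ≤ (reg (c i)).h) ∧
    (¬ vert (c i) → w i ≤ (reg (c i)).w)
  sumv : ∀ k ∈ KK, vert k → ∑ i with NonSm w h W H d i ∧ i ∉ Dv ∧ i ∉ Dw ∧ c i = k, w i ≤ (reg k).w
  sumh : ∀ k ∈ KK, ¬ vert k → ∑ i with NonSm w h W H d i ∧ i ∉ Dv ∧ i ∉ Dw ∧ c i = k, h i ≤ (reg k).h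
  hDv : ∀ i ∈ Dv, 3 * h i ≤ H1
  hDvs : 10 * ∑ i ∈ Dv, w i ≤ W
  hDws : e * ∑ i ∈ Dw, h i ≤ H
  area : ∑ k ∈ KK, (reg k).w * (reg k).h + ∑ i with ¬ NonSm w h W H d i, w i * h i ≤ W * H1

theorem fcong {ι : Type} [Fintype ι] (f : ι → ℕ) (p q : ι → Prop) {_ : DecidablePred p} {_ : DecidablePred q} (h : ∀ i, p i ↔ q i) :
    ∑ i with p i, f i = ∑ i with q i, f i := by
  apply Finset.sum_congr _ (fun _ _ => rfl)
  ext i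
  simp only [Finset.mem_filter, h]

theorem sub_box {a : Rg} {W H : ℕ} (h : a.Sub ⟨0, 0, W, H⟩) (h1 : 0 < a.w) (h2 : 0 < a.h) :
    a.x + a.w ≤ W ∧ a.y + a.h ≤ H := by
  have := h (a.x + a.w - 1) (a.y + a.h - 1) ⟨by omega, by omega, by omega, by omega⟩
  unfold Rg.Mem at this
  simp only at this
  omega

theorem main_out (e d : ℕ) (he : 0 < e) (hd : 0 < d) : ∃ K : ℕ, ∀ (ι : Type) [Fintype ι] (w h x y : ι → ℕ)
    (W H : ℕ), 0 < W → 0 < H → (∀ i, 0 < w i ∧ 0 < h i) → IsPacking w h x y W H →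
    Nonempty (MainOut w h W H e d K) := by
  obtain ⟨K1, hK1⟩ := wtotal d (2 * e) (16 * d * e) hd (by omega)
  obtain ⟨K2, hK2⟩ := vfin (16 * d * e) K1
  refine ⟨K1 + K2, ?_⟩
  intro ι _ w h x y W H hW hH hpos hpk
  obtain ⟨g, H1, r, a, b, hg, hH1, heH, hHR, hr, hcd⟩ := rounding e d W H he hd hH (fun i => ⟨x i, y i, w i, h i⟩)
    hpos (fun i => hpk.1 i) (fun i j hij => Rg.CD.of_rect (hpk.2 hij))
  simp only at hr
  have hrw : ∀ i, (r i).w = w i := fun i => (hr i).2.1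
  have hin : ∀ i, 0 < (r i).w ∧ 0 < (r i).h ∧ (r i).x + (r i).w ≤ W ∧ (r i).y + (r i).h ≤ H1 := by
    intro i
    have h1 := hr i
    have h2 := hpos i
    have h3 := hpk.1 i
    omega
  obtain ⟨O⟩ := hK1 ι r (fun i => H < d * h i) (fun i => ¬ H < d * h i ∧ W < d * w i) W H1 g hW (by omega) hg hHR hin hcd
    (fun i h1 h2 => h2.1 h1) (fun i h1 => by rw [hrw]; exact h1.2)
    (fun i h1 => by
      obtain ⟨h2, h3, h4⟩ := (hr i).2.2.2.2.2 h1
      rw [h4, h3]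
      exact ⟨dvd_mul_right _ _, dvd_mul_right _ _⟩)
  obtain ⟨V, hVdef⟩ : ∃ V : Finset ι, V = Finset.univ.filter (fun i => H < d * h i) := ⟨_, rfl⟩
  have hVm : ∀ i, i ∈ V ↔ H < d * h i := by intro i; rw [hVdef]; simp only [Finset.mem_filter, Finset.mem_univ, true_and]
  obtain ⟨P⟩ := hK2 ι O.κo O.fo r a b V O.obs W H1 g hW hg hHR O.cardo
    (fun i hi => by
      obtain ⟨h2, h3, h4⟩ := (hr i).2.2.2.2.2 ((hVm i).1 hi)
      have := hin i
      exact ⟨this.1, this.2.2.1, h2, h3, h4, by omega⟩)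
    (fun i _ j _ => hcd i j) (fun i hi o => O.obsV i ((hVm i).1 hi) o)
  letI := O.fκ
  obtain ⟨rg0, hrg0⟩ : ∃ rg0 : O.κ ⊕ (((ℕ × IX) ⊕ ι) ⊕ ι) → Rg, rg0 = Sum.elim O.reg P.reg := ⟨_, rfl⟩
  have r0l : ∀ k, rg0 (Sum.inl k) = O.reg k := by intro k; rw [hrg0]; rfl
  have r0r : ∀ k, rg0 (Sum.inr k) = P.reg k := by intro k; rw [hrg0]; rfl
  obtain ⟨T, hT⟩ : ∃ T : Finset (O.κ ⊕ (((ℕ × IX) ⊕ ι) ⊕ ι)), T = (Finset.univ : Finset O.κ).disjSum P.KK := ⟨_, rfl⟩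
  have hTl : ∀ k, Sum.inl k ∈ T := by intro k; rw [hT, Finset.inl_mem_disjSum]; exact Finset.mem_univ _
  have hTr : ∀ k, Sum.inr k ∈ T ↔ k ∈ P.KK := by intro k; rw [hT, Finset.inr_mem_disjSum]
  have cd0 : ∀ k ∈ T, ∀ k' ∈ T, k ≠ k' → (rg0 k).CD (rg0 k') := by
    have mix : ∀ k, ∀ k' ∈ P.KK, (O.reg k).CD (P.reg k') := by
      intro k k' hk'
      rcases O.sub k with h1 | ⟨o, h1⟩
      · exact zero_cd_left _ _ (Or.inl h1)
      · exact ((P.cdo k' hk' o).symm).mono h1 (fun _ _ h => h)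
    intro k hk k' hk' hne
    rcases k with k | k <;> rcases k' with k' | k'
    · rw [r0l, r0l]; exact O.cd k k' (fun h => hne (by rw [h]))
    · rw [r0l, r0r]; exact mix k k' ((hTr k').1 hk')
    · rw [r0l, r0r]; exact (mix k' k ((hTr k).1 hk)).symm
    · rw [r0r, r0r]; exact P.cd k ((hTr k).1 hk) k' ((hTr k').1 hk') (fun h => hne (by rw [h]))
  have inn0 : ∀ k ∈ T, (rg0 k).Sub ⟨0, 0, W, H1⟩ := by
    intro k hk
    rcases k with k | k
    · rw [r0l]; exact O.inn k
    · rw [r0r]; exact P.inn k ((hTr k).1 hk)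
  obtain ⟨rg, hrg⟩ : ∃ rg : O.κ ⊕ (((ℕ × IX) ⊕ ι) ⊕ ι) → Rg, rg = fun k => if 0 < (rg0 k).w ∧ 0 < (rg0 k).h then rg0 k else ⟨0, 0, 0, 0⟩ := ⟨_, rfl⟩
  have hrgp : ∀ k, 0 < (rg0 k).w → 0 < (rg0 k).h → rg k = rg0 k := by
    intro k h1 h2; rw [hrg]; exact if_pos ⟨h1, h2⟩
  have hrgn : ∀ k, ¬ (0 < (rg0 k).w ∧ 0 < (rg0 k).h) → rg k = ⟨0, 0, 0, 0⟩ := by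
    intro k h1; rw [hrg]; exact if_neg h1
  obtain ⟨c, hc⟩ : ∃ c : ι → O.κ ⊕ (((ℕ × IX) ⊕ ι) ⊕ ι), c = fun i => if H < d * h i then Sum.inr (P.c i) else Sum.inl (O.c i) := ⟨_, rfl⟩
  have hcV : ∀ i, H < d * h i → c i = Sum.inr (P.c i) := by intro i hi; rw [hc]; exact if_pos hi
  have hcW : ∀ i, ¬ H < d * h i → c i = Sum.inl (O.c i) := by intro i hi; rw [hc]; exact if_neg hi
  have sumP : ∀ k ∈ P.KK, ∑ i with NonSm w h W H d i ∧ i ∉ P.D ∧ i ∉ O.D ∧ c i = Sum.inr k, w i ≤ (P.reg k).w := by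
    intro k hk
    refine le_trans ?_ (P.sum k hk)
    simp only [hrw]
    apply Finset.sum_le_sum_of_subset
    intro i hi
    simp only [Finset.mem_filter, Finset.mem_univ, true_and] at hi ⊢
    obtain ⟨h1, h2, h3, h4⟩ := hi
    have hv : H < d * h i := by
      by_contra hn; rw [hcW i hn] at h4; cases h4
    rw [hcV i hv] at h4
    exact ⟨(hVm i).2 hv, h2, Sum.inr.inj h4⟩
  have sumO : ∀ k, ∑ i with NonSm w h W H d i ∧ i ∉ P.D ∧ i ∉ O.D ∧ c i = Sum.inl k, h i ≤ (O.reg k).h := by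
    intro k
    refine le_trans ?_ (O.hh k)
    refine le_trans (Finset.sum_le_sum (fun i _ => (hr i).2.2.1)) ?_
    apply Finset.sum_le_sum_of_subset
    intro i hi
    simp only [Finset.mem_filter, Finset.mem_univ, true_and] at hi ⊢
    obtain ⟨h1, h2, h3, h4⟩ := hi
    have hv : ¬ H < d * h i := by
      intro hn; rw [hcV i hn] at h4; cases h4
    rw [hcW i hv] at h4
    exact ⟨⟨hv, h1.resolve_left hv⟩, h3, Sum.inl.inj h4⟩
  -- satisfied items sit in nondegenerate regions
  have asg0 : ∀ i, NonSm w h W H d i → i ∉ P.D → i ∉ O.D → c i ∈ T ∧ rg (c i) = rg0 (c i) ∧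
      (H < d * h i → h i ≤ (rg0 (c i)).h) ∧ (¬ H < d * h i → w i ≤ (rg0 (c i)).w) := by
    intro i h1 h2 h3
    have hp := hpos i
    by_cases hv : H < d * h i
    · have hci := hcV i hv
      obtain ⟨p1, p2⟩ := P.asg i ((hVm i).2 hv) h2
      have hs := sumP _ p1
      have hle : w i ≤ ∑ j with NonSm w h W H d j ∧ j ∉ P.D ∧ j ∉ O.D ∧ c j = Sum.inr (P.c i), w j :=
        Finset.single_le_sum (f := w) (fun _ _ => Nat.zero_le _) (by simp only [Finset.mem_filter, Finset.mem_univ, true_and]; exact ⟨h1, h2, h3, hci⟩)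
      have h4 := (hr i).2.2.1
      rw [hci, r0r]
      refine ⟨(hTr _).2 p1, ?_, fun _ => by omega, fun h => absurd hv h⟩
      rw [← r0r]
      apply hrgp <;> rw [r0r] <;> omega
    · have hci := hcW i hv
      have p1 := O.hw i ⟨hv, h1.resolve_left hv⟩ h3
      rw [hrw] at p1
      have hs := sumO (O.c i)
      have hle : h i ≤ ∑ j with NonSm w h W H d j ∧ j ∉ P.D ∧ j ∉ O.D ∧ c j = Sum.inl (O.c i), h j :=
        Finset.single_le_sum (f := h) (fun _ _ => Nat.zero_le _) (by simp only [Finset.mem_filter, Finset.mem_univ, true_and]; exact ⟨h1, h2, h3, hci⟩)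
      rw [hci, r0l]
      refine ⟨hTl _, ?_, fun h => absurd h hv, fun _ => p1⟩
      rw [← r0l]
      apply hrgp <;> rw [r0l] <;> omega
  have vert_iff : ∀ i, (∃ kk, c i = Sum.inr kk) ↔ H < d * h i := by
    intro i
    constructor
    · rintro ⟨kk, hk⟩
      by_contra hn; rw [hcW i hn] at hk; cases hk
    · intro hv; exact ⟨_, hcV i hv⟩
  -- degenerate region has no assigned item
  have sum_deg : ∀ (f : ι → ℕ) (k), rg k ≠ rg0 k → ∑ i with NonSm w h W H d i ∧ i ∉ P.D ∧ i ∉ O.D ∧ c i = k, f i = 0 := by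
    intro f k hk
    apply Finset.sum_eq_zero
    intro i hi
    simp only [Finset.mem_filter, Finset.mem_univ, true_and] at hi
    obtain ⟨h1, h2, h3, h4⟩ := hi
    exact absurd (h4 ▸ (asg0 i h1 h2 h3).2.1) hk
  refine ⟨⟨H1, _, T, rg, fun k => ∃ kk, k = Sum.inr kk, c, P.D, O.D, ?_, hH1, heH, ?_, ?_, ?_, ?_, ?_, ?_, ?_, ?_, ?_⟩⟩
  · rw [hT, Finset.card_disjSum, Finset.card_univ]
    exact Nat.add_le_add O.cardk P.hcard
  · intro k hk
    by_cases hz : 0 < (rg0 k).w ∧ 0 < (rg0 k).h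
    · rw [hrgp k hz.1 hz.2]
      exact sub_box (inn0 k hk) hz.1 hz.2
    · rw [hrgn k hz]
      exact ⟨Nat.zero_le _, Nat.zero_le _⟩
  · intro k hk k' hk' hne
    by_cases hz : 0 < (rg0 k).w ∧ 0 < (rg0 k).h
    · by_cases hz' : 0 < (rg0 k').w ∧ 0 < (rg0 k').h
      · rw [hrgp k hz.1 hz.2, hrgp k' hz'.1 hz'.2]
        exact (cd0 k hk k' hk' hne).rect hz.1 hz.2 hz'.1 hz'.2
      · rw [hrgn k' hz']
        exact Or.inr (Or.inl (Nat.zero_le _))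
    · rw [hrgn k hz]
      exact Or.inl (Nat.zero_le _)
  · intro i h1 h2 h3
    obtain ⟨a1, a2, a3, a4⟩ := asg0 i h1 h2 h3
    rw [a2, vert_iff]
    exact ⟨a1, a3, a4⟩
  · rintro k hk ⟨kk, rfl⟩
    by_cases hz : rg (Sum.inr kk) = rg0 (Sum.inr kk)
    · rw [hz, r0r]; exact le_trans (le_of_eq (fcong _ _ _ (fun _ => Iff.rfl))) (sumP kk ((hTr kk).1 hk))
    · exact le_trans (le_of_eq (fcong _ _ _ (fun _ => Iff.rfl))) (le_trans (le_of_eq (sum_deg w _ hz)) (Nat.zero_le _))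
  · intro k hk hn
    rcases k with k | k
    · by_cases hz : rg (Sum.inl k) = rg0 (Sum.inl k)
      · rw [hz, r0l]; exact le_trans (le_of_eq (fcong _ _ _ (fun _ => Iff.rfl))) (sumO k)
      · exact le_trans (le_of_eq (fcong _ _ _ (fun _ => Iff.rfl))) (le_trans (le_of_eq (sum_deg h _ hz)) (Nat.zero_le _))
    · exact absurd ⟨k, rfl⟩ hn
  · intro i hi
    have h1 := P.hDh i hi
    have h2 := (hr i).2.2.1
    omega
  · have := P.hDs
    simp only [hrw] at this
    exact this
  · have h1 := O.dis
    have h2 : ∑ i ∈ O.D, h i ≤ ∑ i ∈ O.D, (r i).h := Finset.sum_le_sum (fun i _ => (hr i).2.2.1)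
    have h3 : H1 ≤ 2 * H := by
      apply Nat.le_of_mul_le_mul_left _ he
      calc e * H1 ≤ (e + 1) * H := heH
        _ ≤ (e + e) * H := Nat.mul_le_mul_right _ (by omega)
        _ = e * (2 * H) := by ring
    have h4 : 2 * (e * ∑ i ∈ O.D, h i) ≤ 2 * e * ∑ i ∈ O.D, (r i).h := by
      rw [← mul_assoc]; exact Nat.mul_le_mul_left _ h2
    omega
  · have h1 : ∑ k ∈ T, (rg k).w * (rg k).h ≤ ∑ k ∈ T, (rg0 k).w * (rg0 k).h := by
      apply Finset.sum_le_sum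
      intro k _
      by_cases hz : 0 < (rg0 k).w ∧ 0 < (rg0 k).h
      · rw [hrgp k hz.1 hz.2]
      · rw [hrgn k hz]; simp
    have h2 : ∑ k ∈ T, (rg0 k).w * (rg0 k).h = ∑ k, (O.reg k).w * (O.reg k).h + ∑ k ∈ P.KK, (P.reg k).w * (P.reg k).h := by
      rw [hT, Finset.sum_disjSum]
      simp only [r0l, r0r]
    have h3 : ∑ k, (O.reg k).w * (O.reg k).h ≤ ∑ i with (¬ H < d * h i ∧ W < d * w i), (r i).w * (r i).h :=
      le_trans O.area (le_of_eq (fcong _ _ _ (fun _ => Iff.rfl)))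
    have h4 := P.area
    have h5 := sum_area_le (Finset.univ : Finset ι) r ⟨0, 0, W, H1⟩ (fun i _ j _ => hcd i j)
      (fun i _ q ρ hm => by have := hin i; unfold Rg.Mem at *; simp only; omega)
    simp only at h5
    have h6 : ∑ i, (r i).w * (r i).h = ∑ i ∈ V, (r i).w * (r i).h + ∑ i with (¬ H < d * h i ∧ W < d * w i), (r i).w * (r i).h
        + ∑ i with ¬ NonSm w h W H d i, w i * h i := by
      rw [hVdef, ← Finset.sum_filter_add_sum_filter_not Finset.univ (fun i => H < d * h i), add_assoc]
      congr 1
      rw [← Finset.sum_filter_add_sum_filter_not (Finset.univ.filter (fun i => ¬ H < d * h i)) (fun i => W < d * w i), Finset.filter_filter, Finset.filter_filter]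
      congr 1
      apply Finset.sum_congr
      · ext i
        simp only [Finset.mem_filter, Finset.mem_univ, true_and]
        unfold NonSm
        tauto
      · intro i hi
        simp only [Finset.mem_filter, Finset.mem_univ, true_and] at hi
        unfold NonSm at hi
        rw [hrw, (hr i).2.2.2.2.1 (by tauto)]
    omega


theorem sub_coord {a b : Rg} (h : a.Sub b) (h1 : 0 < a.w) (h2 : 0 < a.h) :
    b.x ≤ a.x ∧ a.x + a.w ≤ b.x + b.w ∧ b.y ≤ a.y ∧ a.y + a.h ≤ b.y + b.h := by
  have e1 := h (a.x + a.w - 1) (a.y + a.h - 1) ⟨by omega, by omega, by omega, by omega⟩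
  have e2 := h a.x a.y ⟨by omega, by omega, by omega, by omega⟩
  unfold Rg.Mem at e1 e2
  omega

/-- `PR w h p i` is rectangle `i` placed at `p i`. -/
def PR {ι : Type} (w h : ι → ℕ) (p : ι → ℕ × ℕ) (i : ι) : Rg := ⟨(p i).1, (p i).2, w i, h i⟩

theorem glue {ι Ω : Type} [Fintype ι] (w h : ι → ℕ) (cl : ι → Ω) (Z : Ω → Rg) (vert isC : Ω → Prop) (p0 : ι → ℕ × ℕ)
    (hv : ∀ i, isC (cl i) → vert (cl i) → h i ≤ (Z (cl i)).h)
    (hvs : ∀ o, isC o → vert o → ∑ i with cl i = o, w i ≤ (Z o).w)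
    (hh : ∀ i, isC (cl i) → ¬ vert (cl i) → w i ≤ (Z (cl i)).w)
    (hhs : ∀ o, isC o → ¬ vert o → ∑ i with cl i = o, h i ≤ (Z o).h)
    (hnc : ∀ i, ¬ isC (cl i) → (PR w h p0 i).Sub (Z (cl i)))
    (hnd : ∀ i j, i ≠ j → ¬ isC (cl i) → cl i = cl j → (PR w h p0 i).CD (PR w h p0 j))
    (hcd : ∀ i j, cl i ≠ cl j → (Z (cl i)).CD (Z (cl j))) :
    ∃ p : ι → ℕ × ℕ, (∀ i j, i ≠ j → (PR w h p i).CD (PR w h p j)) ∧ (∀ i, (PR w h p i).Sub (Z (cl i))) ∧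
      ∀ i j, i ≠ j → cl i = cl j → isC (cl i) →
        (vert (cl i) → (p i).1 + w i ≤ (p j).1 ∨ (p j).1 + w j ≤ (p i).1) ∧
        (¬ vert (cl i) → (p i).2 + h i ≤ (p j).2 ∨ (p j).2 + h j ≤ (p i).2) := by
  have hst := fun o : Ω => stack (Finset.univ.filter (fun i => cl i = o)) (if vert o then w else h)
  choose pos hp1 hp2 using hst
  have hm : ∀ i, i ∈ Finset.univ.filter (fun j => cl j = cl i) := by
    intro i; simp only [Finset.mem_filter, Finset.mem_univ, true_and]
  obtain ⟨p, hp⟩ : ∃ p : ι → ℕ × ℕ, p = fun i => if isC (cl i) then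
      (if vert (cl i) then ((Z (cl i)).x + pos (cl i) i, (Z (cl i)).y) else ((Z (cl i)).x, (Z (cl i)).y + pos (cl i) i)) else p0 i := ⟨_, rfl⟩
  have pv : ∀ i, isC (cl i) → vert (cl i) → p i = ((Z (cl i)).x + pos (cl i) i, (Z (cl i)).y) := by
    intro i h1 h2; rw [hp]; simp only [h1, h2, if_true]
  have ph : ∀ i, isC (cl i) → ¬ vert (cl i) → p i = ((Z (cl i)).x, (Z (cl i)).y + pos (cl i) i) := by
    intro i h1 h2; rw [hp]; simp only [h1, h2, if_true, if_false]
  have pn : ∀ i, ¬ isC (cl i) → p i = p0 i := by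
    intro i h1; rw [hp]; simp only [h1, if_false]
  have hsub : ∀ i, (PR w h p i).Sub (Z (cl i)) := by
    intro i
    by_cases h1 : isC (cl i)
    · have e1 := hp1 (cl i) i (hm i)
      by_cases h2 : vert (cl i)
      · have e2 := hv i h1 h2
        have e3 := hvs _ h1 h2
        simp only [h2, if_true] at e1
        intro q r hq
        unfold PR Rg.Mem at hq
        rw [pv i h1 h2] at hq
        unfold Rg.Mem
        simp only at hq
        omega
      · have e2 := hh i h1 h2
        have e3 := hhs _ h1 h2
        simp only [h2, if_false] at e1
        intro q r hq
        unfold PR Rg.Mem at hq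
        rw [ph i h1 h2] at hq
        unfold Rg.Mem
        simp only at hq
        omega
    · have := hnc i h1
      unfold PR at this ⊢
      rw [pn i h1]; exact this
  have hint : ∀ i j, i ≠ j → cl i = cl j → isC (cl i) →
        (vert (cl i) → (p i).1 + w i ≤ (p j).1 ∨ (p j).1 + w j ≤ (p i).1) ∧
        (¬ vert (cl i) → (p i).2 + h i ≤ (p j).2 ∨ (p j).2 + h j ≤ (p i).2) := by
    intro i j hij hc h1
    have e := hp2 (cl i) i (hm i) j (by rw [hc]; exact hm j) hij
    constructor
    · intro h2
      rw [pv i h1 h2, pv j (hc ▸ h1) (hc ▸ h2), ← hc]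
      simp only [h2, if_true] at e
      simp only
      omega
    · intro h2
      rw [ph i h1 h2, ph j (hc ▸ h1) (hc ▸ h2), ← hc]
      simp only [h2, if_false] at e
      simp only
      omega
  refine ⟨p, ?_, hsub, hint⟩
  intro i j hij
  by_cases hc : cl i = cl j
  · by_cases h1 : isC (cl i)
    · have := hint i j hij hc h1
      intro q r m1 m2
      unfold PR Rg.Mem at m1 m2
      simp only at m1 m2
      by_cases h2 : vert (cl i)
      · have := this.1 h2; omega
      · have := this.2 h2; omega
    · have := hnd i j hij h1 hc
      unfold PR at this ⊢
      rw [pn i h1, pn j (hc ▸ h1)]; exact this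
  · exact (hcd i j hc).mono (hsub i) (hsub j)

inductive Om (κ : Type) where
  | mn (k : κ)
  | dv
  | dw
  | md
  | tn
  | ti (f : ℕ × ℕ)

theorem box_loss (a b w h : ℕ) : a * b ≤ (a - w) * (b - h) + w * b + h * a := by
  rcases Nat.le_total a w with h1 | h1
  · have : a * b ≤ w * b := Nat.mul_le_mul_right _ h1
    omega
  · rcases Nat.le_total b h with h2 | h2
    · have : a * b ≤ a * h := Nat.mul_le_mul_left _ h2
      rw [mul_comm h a]; omega
    · obtain ⟨s, rfl⟩ := Nat.exists_eq_add_of_le h1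
      obtain ⟨t, rfl⟩ := Nat.exists_eq_add_of_le h2
      rw [Nat.add_sub_cancel_left, Nat.add_sub_cancel_left]
      nlinarith [Nat.zero_le (w * h)]

/-- packing of medium items -/
theorem medium_pack {ι : Type} (M : Finset ι) (w h : ι → ℕ) (W H d q T : ℕ) (bx : Rg) (hd : 100 ≤ d)
    (hM : ∀ i ∈ M, 0 < w i ∧ 0 < h i ∧ d * h i ≤ H ∧ d * w i ≤ W) (harea : 20 * ∑ i ∈ M, w i * h i ≤ W * H)
    (hq : W < 10 * q + 10) (hT : H ≤ 3 * T + 2) (hb1 : bx.w = 4 * q) (hb2 : bx.h = T) :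
    ∃ p : ι → ℕ × ℕ, (∀ i ∈ M, (PR w h p i).Sub bx) ∧
      (∀ i ∈ M, ∀ j ∈ M, i ≠ j → (PR w h p i).CD (PR w h p j)) := by
  rcases M.eq_empty_or_nonempty with rfl | ⟨i0, hi0⟩
  · exact ⟨fun _ => (0, 0), by simp, by simp⟩
  obtain ⟨m1, m2, m3, m4⟩ := hM i0 hi0
  have hW : d ≤ W := le_trans (Nat.le_mul_of_pos_right _ m1) m4
  have hH : d ≤ H := le_trans (Nat.le_mul_of_pos_right _ m2) m3
  have hd0 : 0 < d := by omega
  have w0 : 100 * (W / d) ≤ W := le_trans (Nat.mul_le_mul_right _ hd) (Nat.mul_div_le W d)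
  have h0 : 100 * (H / d) ≤ H := le_trans (Nat.mul_le_mul_right _ hd) (Nat.mul_div_le H d)
  obtain ⟨x, y, f, h1, h2⟩ := nfdh_multi M w h (W / d) (H / d)
    (fun i hi => ⟨(hM i hi).1, (Nat.le_div_iff_mul_le hd0).2 (by rw [mul_comm]; exact (hM i hi).2.2.2)⟩)
    (fun i hi => ⟨(hM i hi).2.1, (Nat.le_div_iff_mul_le hd0).2 (by rw [mul_comm]; exact (hM i hi).2.2.1)⟩)
    (Finset.univ : Finset Unit) (fun _ => bx) (fun f _ f' _ hne => absurd (Subsingleton.elim f f') hne)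
    (by
      rw [Fintype.sum_unique, hb1, hb2]
      have e1 : 3 * W ≤ 10 * (4 * q - W / d) := by omega
      have e2 : 3 * H ≤ 10 * (T - H / d) := by omega
      have e3 := Nat.mul_le_mul e1 e2
      have e4 : 3 * W * (3 * H) = 9 * (W * H) := by ring
      have e5 : 10 * (4 * q - W / d) * (10 * (T - H / d)) = 100 * ((4 * q - W / d) * (T - H / d)) := by ring
      rw [e4, e5] at e3
      omega)
  exact ⟨fun i => (x i, y i), fun i hi => (h1 i hi).2, h2⟩

/-- packing of tiny items -/
theorem tiny_pack {ι : Type} (M : Finset ι) (w h : ι → ℕ) (W H H1 d q T B : ℕ) (F : Finset (ℕ × ℕ)) (bx : ℕ × ℕ → Rg) (tb : Rg)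
    (hd : 100 ≤ d) (hdB : 100 * B ≤ d) (hFB : F.card ≤ B) (hH1 : H ≤ H1) (hH2 : H1 ≤ 2 * H)
    (hF : ∀ f ∈ F, (bx f).x + (bx f).w ≤ W ∧ (bx f).y + (bx f).h ≤ H1)
    (hcd : ∀ f ∈ F, ∀ f' ∈ F, f ≠ f' → (bx f).CD (bx f'))
    (htb : H1 ≤ tb.y)
    (hM : ∀ i ∈ M, 0 < w i ∧ 0 < h i ∧ d * h i ≤ H ∧ d * w i ≤ W) (harea : ∑ i ∈ M, w i * h i ≤ ∑ f ∈ F, (bx f).w * (bx f).h)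
    (hq : W < 10 * q + 10) (hT : H ≤ 3 * T + 2) (hb1 : tb.w = 5 * q) (hb2 : tb.h = T) :
    ∃ (p : ι → ℕ × ℕ) (fc : ι → Option (ℕ × ℕ)), (∀ i ∈ M, (∀ f, fc i = some f → f ∈ F ∧ (PR w h p i).Sub (bx f)) ∧
        (fc i = none → (PR w h p i).Sub tb)) ∧
      (∀ i ∈ M, ∀ j ∈ M, i ≠ j → (PR w h p i).CD (PR w h p j)) := by
  rcases M.eq_empty_or_nonempty with rfl | ⟨i0, hi0⟩
  · exact ⟨fun _ => (0, 0), fun _ => none, by simp, by simp⟩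
  obtain ⟨m1, m2, m3, m4⟩ := hM i0 hi0
  have hW : d ≤ W := le_trans (Nat.le_mul_of_pos_right _ m1) m4
  have hH : d ≤ H := le_trans (Nat.le_mul_of_pos_right _ m2) m3
  have hd0 : 0 < d := by omega
  have w0 : d * (W / d) ≤ W := Nat.mul_div_le W d
  have h0 : d * (H / d) ≤ H := Nat.mul_div_le H d
  have w1 : 100 * (W / d) ≤ W := le_trans (Nat.mul_le_mul_right _ hd) w0
  have h1 : 100 * (H / d) ≤ H := le_trans (Nat.mul_le_mul_right _ hd) h0
  have w2 : 100 * (B * (W / d)) ≤ W := by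
    rw [← mul_assoc]; exact le_trans (Nat.mul_le_mul_right _ hdB) w0
  have h2 : 100 * (B * (H / d)) ≤ H := by
    rw [← mul_assoc]; exact le_trans (Nat.mul_le_mul_right _ hdB) h0
  have hbxt : ∀ f ∈ F, (bx f).CD tb := by
    intro f hf q r e1 e2
    have := hF f hf
    unfold Rg.Mem at e1 e2
    omega
  obtain ⟨x, y, f, g1, g2⟩ := nfdh_multi M w h (W / d) (H / d)
    (fun i hi => ⟨(hM i hi).1, (Nat.le_div_iff_mul_le hd0).2 (by rw [mul_comm]; exact (hM i hi).2.2.2)⟩)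
    (fun i hi => ⟨(hM i hi).2.1, (Nat.le_div_iff_mul_le hd0).2 (by rw [mul_comm]; exact (hM i hi).2.2.1)⟩)
    (Finset.insertNone F) (fun o => o.elim tb bx)
    (by
      intro f hf f' hf' hne
      rcases f with _ | f <;> rcases f' with _ | f'
      · exact absurd rfl hne
      · exact (hbxt f' (Finset.some_mem_insertNone.1 hf')).symm
      · exact hbxt f (Finset.some_mem_insertNone.1 hf)
      · exact hcd f (Finset.some_mem_insertNone.1 hf) f' (Finset.some_mem_insertNone.1 hf') (fun h => hne (by rw [h])))
    (by
      rw [Finset.sum_insertNone]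
      simp only [Option.elim]
      rw [hb1, hb2]
      have e1 : 3 * W ≤ 10 * (5 * q - W / d) := by omega
      have e2 : 3 * H ≤ 10 * (T - H / d) := by omega
      have e3 := Nat.mul_le_mul e1 e2
      have e4 : 3 * W * (3 * H) = 9 * (W * H) := by ring
      have e5 : 10 * (5 * q - W / d) * (10 * (T - H / d)) = 100 * ((5 * q - W / d) * (T - H / d)) := by ring
      rw [e4, e5] at e3
      have e6 : ∑ f ∈ F, (bx f).w * (bx f).h ≤ ∑ f ∈ F, ((bx f).w - W / d) * ((bx f).h - H / d) + B * (W / d * H1 + H / d * W) := by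
        calc ∑ f ∈ F, (bx f).w * (bx f).h ≤ ∑ f ∈ F, (((bx f).w - W / d) * ((bx f).h - H / d) + (W / d * H1 + H / d * W)) := by
              apply Finset.sum_le_sum
              intro f hf
              have a1 := box_loss (bx f).w (bx f).h (W / d) (H / d)
              have a2 : W / d * (bx f).h ≤ W / d * H1 := Nat.mul_le_mul_left _ (by have := hF f hf; omega)
              have a3 : H / d * (bx f).w ≤ H / d * W := Nat.mul_le_mul_left _ (by have := hF f hf; omega)
              omega
          _ = ∑ f ∈ F, ((bx f).w - W / d) * ((bx f).h - H / d) + F.card * (W / d * H1 + H / d * W) := by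
              rw [Finset.sum_add_distrib, Finset.sum_const, smul_eq_mul]
          _ ≤ _ := by gcongr
      have e7 : B * (W / d * H1 + H / d * W) = B * (W / d) * H1 + B * (H / d) * W := by ring
      have e8 : 100 * (B * (W / d) * H1) ≤ 2 * (W * H) := by
        calc 100 * (B * (W / d) * H1) = 100 * (B * (W / d)) * H1 := by ring
          _ ≤ W * (2 * H) := Nat.mul_le_mul w2 hH2
          _ = 2 * (W * H) := by ring
      have e9 : 100 * (B * (H / d) * W) ≤ W * H := by
        calc 100 * (B * (H / d) * W) = 100 * (B * (H / d)) * W := by ring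
          _ ≤ H * W := Nat.mul_le_mul_right _ h2
          _ = W * H := by ring
      rw [e7] at e6
      omega)
  refine ⟨fun i => (x i, y i), f, ?_, g2⟩
  intro i hi
  have := g1 i hi
  constructor
  · intro f' hf'
    rw [hf'] at this
    exact ⟨Finset.some_mem_insertNone.1 this.1, this.2⟩
  · intro hf'
    rw [hf'] at this
    exact this.2


theorem assemble {ι : Type} [Fintype ι] (w h : ι → ℕ) (W H e d d' K : ℕ) (he : 0 < e)
    (hd : 100 ≤ d) (hdd : d ≤ d') (hd' : 100 * (2 * K + 2) ^ 2 ≤ d')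
    (hpos : ∀ i, 0 < w i ∧ 0 < h i ∧ w i ≤ W) (M : MainOut w h W H e d K)
    (hmed : 20 * ∑ i with (¬ NonSm w h W H d i ∧ NonSm w h W H d' i), w i * h i ≤ W * H) :
    ∃ (Ω : Type) (CC : Finset Ω) (Z : Ω → Rg) (vert : Ω → Prop) (cl : ι → Ω) (p : ι → ℕ × ℕ) (Ht : ℕ),
      CC.card ≤ K + 2 ∧ 3 * e * Ht ≤ (4 * e + 7) * H ∧
      (∀ o ∈ CC, (Z o).x + (Z o).w ≤ W ∧ (Z o).y + (Z o).h ≤ Ht) ∧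
      (∀ o ∈ CC, ∀ o' ∈ CC, o ≠ o' → RectDisjoint (Z o).x (Z o).y (Z o).w (Z o).h (Z o').x (Z o').y (Z o').w (Z o').h) ∧
      (∀ i, (p i).1 + w i ≤ W ∧ (p i).2 + h i ≤ Ht) ∧
      (∀ i j, i ≠ j → (PR w h p i).CD (PR w h p j)) ∧
      (∀ i, NonSm w h W H d i → cl i ∈ CC ∧ (PR w h p i).Sub (Z (cl i))) ∧
      (∀ i j, NonSm w h W H d i → NonSm w h W H d j → i ≠ j → cl i = cl j →
        (vert (cl i) → (p i).1 + w i ≤ (p j).1 ∨ (p j).1 + w j ≤ (p i).1) ∧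
        (¬ vert (cl i) → (p i).2 + h i ≤ (p j).2 ∨ (p j).2 + h j ≤ (p i).2)) := by
  obtain ⟨H1, κ, KK, reg, vert, c, Dv, Dw, hcard, hH, hH1, inn, rd, asg, sumv, sumh, hDv, hDvs, hDws, area⟩ := M
  obtain ⟨S, hS⟩ : ∃ S, S = ∑ i ∈ Dw, h i := ⟨_, rfl⟩
  rw [← hS] at hDws
  obtain ⟨q, hq1, hq2⟩ : ∃ q, 10 * q ≤ W ∧ W < 10 * q + 10 := ⟨W / 10, by omega, by omega⟩
  obtain ⟨T, hT1, hT2⟩ : ∃ T, 3 * T ≤ H1 ∧ H1 ≤ 3 * T + 2 := ⟨H1 / 3, by omega, by omega⟩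
  have hH2 : H1 ≤ 2 * H := by
    apply Nat.le_of_mul_le_mul_left _ he
    calc e * H1 ≤ (e + 1) * H := hH1
      _ ≤ (e + e) * H := Nat.mul_le_mul_right _ (by omega)
      _ = e * (2 * H) := by ring
  obtain ⟨F, bx, hFc, hFin, hFcd, hFr, hFa⟩ := free_decomp KK reg W H1 inn
  have hmono : ∀ i, NonSm w h W H d i → NonSm w h W H d' i := by
    intro i hi
    rcases hi with hi | hi
    · exact Or.inl (lt_of_lt_of_le hi (Nat.mul_le_mul_right _ hdd))
    · exact Or.inr (lt_of_lt_of_le hi (Nat.mul_le_mul_right _ hdd))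
  obtain ⟨pm, hpm1, hpm2⟩ := medium_pack (Finset.univ.filter (fun i => ¬ NonSm w h W H d i ∧ NonSm w h W H d' i)) w h W H d q T
    ⟨q, H1 + S, 4 * q, T⟩ hd
    (by
      intro i hi
      simp only [Finset.mem_filter, Finset.mem_univ, true_and] at hi
      have hp := hpos i
      have := hi.1
      unfold NonSm at this
      push Not at this
      exact ⟨hp.1, hp.2.1, this.1, this.2⟩) hmed hq2 (by omega) rfl rfl
  obtain ⟨pt, fc, hpt1, hpt2⟩ := tiny_pack (Finset.univ.filter (fun i => ¬ NonSm w h W H d' i)) w h W H H1 d' q T ((2 * K + 2) ^ 2) F bx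
    ⟨5 * q, H1 + S, 5 * q, T⟩ (by omega) hd' (hFc.trans (Nat.pow_le_pow_left (by omega) 2)) hH hH2 hFin hFcd (by simp only; omega)
    (by
      intro i hi
      simp only [Finset.mem_filter, Finset.mem_univ, true_and] at hi
      have hp := hpos i
      unfold NonSm at hi
      push Not at hi
      exact ⟨hp.1, hp.2.1, hi.1, hi.2⟩)
    (by
      have h1 : ∑ i with ¬ NonSm w h W H d' i, w i * h i ≤ ∑ i with ¬ NonSm w h W H d i, w i * h i := by
        apply Finset.sum_le_sum_of_subset
        intro i hi
        simp only [Finset.mem_filter, Finset.mem_univ, true_and] at hi ⊢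
        exact fun h => hi (hmono i h)
      omega) hq2 (by omega) rfl rfl
  simp only [Finset.mem_filter, Finset.mem_univ, true_and] at hpm1 hpm2 hpt1 hpt2
  obtain ⟨Z, hZ⟩ : ∃ Z : Om κ → Rg, Z = fun o => match o with
    | Om.mn k => reg k
    | Om.dv => ⟨0, H1 + S, q, T⟩
    | Om.dw => ⟨0, H1, W, S⟩
    | Om.md => ⟨q, H1 + S, 4 * q, T⟩
    | Om.tn => ⟨5 * q, H1 + S, 5 * q, T⟩
    | Om.ti f => bx f := ⟨_, rfl⟩
  have z1 : ∀ k, Z (Om.mn k) = reg k := by intro k; rw [hZ]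
  have z2 : Z Om.dv = ⟨0, H1 + S, q, T⟩ := by rw [hZ]
  have z3 : Z Om.dw = ⟨0, H1, W, S⟩ := by rw [hZ]
  have z4 : Z Om.md = ⟨q, H1 + S, 4 * q, T⟩ := by rw [hZ]
  have z5 : Z Om.tn = ⟨5 * q, H1 + S, 5 * q, T⟩ := by rw [hZ]
  have z6 : ∀ f, Z (Om.ti f) = bx f := by intro f; rw [hZ]
  obtain ⟨vt, hvt⟩ : ∃ vt : Om κ → Prop, vt = fun o => match o with
    | Om.mn k => vert k
    | Om.dv => True
    | _ => False := ⟨_, rfl⟩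
  obtain ⟨isC, hisC⟩ : ∃ isC : Om κ → Prop, isC = fun o => match o with
    | Om.mn _ => True
    | Om.dv => True
    | Om.dw => True
    | _ => False := ⟨_, rfl⟩
  obtain ⟨val, hval⟩ : ∃ val : Om κ → Prop, val = fun o => match o with
    | Om.mn k => k ∈ KK
    | Om.ti f => f ∈ F
    | _ => True := ⟨_, rfl⟩
  have v1 : ∀ k, vt (Om.mn k) ↔ vert k := by intro k; rw [hvt]
  have v2 : vt Om.dv := by rw [hvt]; trivial
  have v3 : ¬ vt Om.dw := by rw [hvt]; exact id
  have c1 : ∀ k, isC (Om.mn k) := by intro k; rw [hisC]; trivial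
  have c2 : isC Om.dv := by rw [hisC]; trivial
  have c3 : isC Om.dw := by rw [hisC]; trivial
  have c4 : ¬ isC Om.md := by rw [hisC]; exact id
  have c5 : ¬ isC Om.tn := by rw [hisC]; exact id
  have c6 : ∀ f, ¬ isC (Om.ti f) := by intro f; rw [hisC]; exact id
  have l1 : ∀ k, val (Om.mn k) ↔ k ∈ KK := by intro k; rw [hval]
  have l6 : ∀ f, val (Om.ti f) ↔ f ∈ F := by intro k; rw [hval]
  -- validity implies inclusion
  have hZin : ∀ o, val o → (Z o).x + (Z o).w ≤ W ∧ (Z o).y + (Z o).h ≤ H1 + S + T := by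
    intro o ho
    rcases o with k | _ | _ | _ | _ | f
    · rw [z1]; have := inn k ((l1 k).1 ho); omega
    · rw [z2]; simp only; omega
    · rw [z3]; simp only; omega
    · rw [z4]; simp only; omega
    · rw [z5]; simp only; omega
    · rw [z6]; have := hFin f ((l6 f).1 ho); omega
  have hbot1 : ∀ k, val (Om.mn k) → (Z (Om.mn k)).y + (Z (Om.mn k)).h ≤ H1 := by
    intro k ho; rw [z1]; exact (inn k ((l1 k).1 ho)).2
  have hbot2 : ∀ f, val (Om.ti f) → (Z (Om.ti f)).y + (Z (Om.ti f)).h ≤ H1 := by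
    intro k ho; rw [z6]; exact (hFin k ((l6 k).1 ho)).2
  have hZcd : ∀ o o', val o → val o' → o ≠ o' → (Z o).CD (Z o') := by
    intro o o' ho ho' hne
    rcases o with k | _ | _ | _ | _ | f <;> rcases o' with k' | _ | _ | _ | _ | f' <;>
      first
      | exact absurd rfl hne
      | (rw [z1, z1]; exact Rg.CD.of_rect (rd k ((l1 k).1 ho) k' ((l1 k').1 ho') (fun h => hne (by rw [h]))))
      | (rw [z6, z6]; exact hFcd f ((l6 f).1 ho) f' ((l6 f').1 ho') (fun h => hne (by rw [h])))
      | (rw [z6, z1]; exact hFr f ((l6 f).1 ho) k' ((l1 k').1 ho'))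
      | (rw [z6, z1]; exact (hFr f' ((l6 f').1 ho') k ((l1 k).1 ho)).symm)
      | (have e1 := hbot1 _ ho
         intro q r m1 m2
         simp only [z2, z3, z4, z5, Rg.Mem] at e1 m1 m2
         omega)
      | (have e1 := hbot1 _ ho'
         intro q r m1 m2
         simp only [z2, z3, z4, z5, Rg.Mem] at e1 m1 m2
         omega)
      | (have e1 := hbot2 _ ho
         intro q r m1 m2
         simp only [z2, z3, z4, z5, Rg.Mem] at e1 m1 m2
         omega)
      | (have e1 := hbot2 _ ho'
         intro q r m1 m2
         simp only [z2, z3, z4, z5, Rg.Mem] at e1 m1 m2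
         omega)
      | (intro q r m1 m2
         simp only [z2, z3, z4, z5, Rg.Mem] at m1 m2
         omega)
  obtain ⟨CC, hCC⟩ : ∃ CC : Finset (Om κ), CC = KK.image Om.mn ∪ {Om.dv, Om.dw} := ⟨_, rfl⟩
  have hCm : ∀ o, o ∈ CC ↔ (∃ k ∈ KK, o = Om.mn k) ∨ o = Om.dv ∨ o = Om.dw := by
    intro o
    rw [hCC]
    simp only [Finset.mem_union, Finset.mem_image, Finset.mem_insert, Finset.mem_singleton]
    constructor
    · rintro (⟨k, hk, rfl⟩ | h)
      · exact Or.inl ⟨k, hk, rfl⟩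
      · exact Or.inr h
    · rintro (⟨k, hk, rfl⟩ | h)
      · exact Or.inl ⟨k, hk, rfl⟩
      · exact Or.inr h
  have hCval : ∀ o ∈ CC, val o := by
    intro o ho
    rcases (hCm o).1 ho with ⟨k, hk, rfl⟩ | rfl | rfl
    · exact (l1 k).2 hk
    · rw [hval]; trivial
    · rw [hval]; trivial
  -- classes
  obtain ⟨cl, hcl⟩ : ∃ cl : ι → Om κ, cl = fun i => if NonSm w h W H d i then
      (if i ∈ Dv then Om.dv else if i ∈ Dw then Om.dw else Om.mn (c i))
      else if NonSm w h W H d' i then Om.md else (fc i).elim Om.tn Om.ti := ⟨_, rfl⟩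
  have k1 : ∀ i, NonSm w h W H d i → i ∈ Dv → cl i = Om.dv := by
    intro i a1 a2; rw [hcl]; simp only [a1, a2, if_true]
  have k2 : ∀ i, NonSm w h W H d i → i ∉ Dv → i ∈ Dw → cl i = Om.dw := by
    intro i a1 a2 a3; rw [hcl]; simp only [a1, a2, a3, if_true, if_false]
  have k3 : ∀ i, NonSm w h W H d i → i ∉ Dv → i ∉ Dw → cl i = Om.mn (c i) := by
    intro i a1 a2 a3; rw [hcl]; simp only [a1, a2, a3, if_true, if_false]
  have k4 : ∀ i, ¬ NonSm w h W H d i → NonSm w h W H d' i → cl i = Om.md := by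
    intro i a1 a2; rw [hcl]; simp only [a1, a2, if_true, if_false]
  have k5 : ∀ i, ¬ NonSm w h W H d' i → cl i = (fc i).elim Om.tn Om.ti := by
    intro i a2
    have a1 : ¬ NonSm w h W H d i := fun a => a2 (hmono i a)
    rw [hcl]; simp only [a1, a2, if_false]
  have hcC : ∀ i, NonSm w h W H d i → cl i ∈ CC := by
    intro i hi
    rw [hCm]
    by_cases a1 : i ∈ Dv
    · rw [k1 i hi a1]; exact Or.inr (Or.inl rfl)
    · by_cases a2 : i ∈ Dw
      · rw [k2 i hi a1 a2]; exact Or.inr (Or.inr rfl)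
      · rw [k3 i hi a1 a2]; exact Or.inl ⟨c i, (asg i hi a1 a2).1, rfl⟩
  have hnC : ∀ i, ¬ NonSm w h W H d i → ¬ isC (cl i) := by
    intro i hi
    by_cases h1 : NonSm w h W H d' i
    · rw [k4 i hi h1]; exact c4
    · rw [k5 i h1]
      rcases fc i with _ | f
      · exact c5
      · exact c6 f
  have hclval : ∀ i, val (cl i) := by
    intro i
    by_cases h1 : NonSm w h W H d i
    · exact hCval _ (hcC i h1)
    · by_cases h2 : NonSm w h W H d' i
      · rw [k4 i h1 h2, hval]; trivial
      · rw [k5 i h2]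
        have := (hpt1 i h2).1
        rcases hf : fc i with _ | f
        · rw [hval]; trivial
        · exact (l6 f).2 (this f hf).1
  obtain ⟨p0, hp0⟩ : ∃ p0 : ι → ℕ × ℕ, p0 = fun i => if NonSm w h W H d' i then pm i else pt i := ⟨_, rfl⟩
  have p01 : ∀ i, NonSm w h W H d' i → PR w h p0 i = PR w h pm i := by
    intro i hi; unfold PR; rw [hp0]; simp only [hi, if_true]
  have p02 : ∀ i, ¬ NonSm w h W H d' i → PR w h p0 i = PR w h pt i := by
    intro i hi; unfold PR; rw [hp0]; simp only [hi, if_false]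
  have hvc : ∀ i, isC (cl i) → NonSm w h W H d i := by
    intro i hi; by_contra hn; exact hnC i hn hi
  obtain ⟨p, g1, g2, g3⟩ := glue w h cl Z vt isC p0
    (by
      intro i hi hv
      have hn := hvc i hi
      have hp := hpos i
      by_cases a1 : i ∈ Dv
      · rw [k1 i hn a1, z2]; have := hDv i a1; simp only; omega
      · by_cases a2 : i ∈ Dw
        · rw [k2 i hn a1 a2] at hv; exact absurd hv v3
        · rw [k3 i hn a1 a2] at hv ⊢
          rw [z1]; exact (asg i hn a1 a2).2.1 ((v1 _).1 hv))
    (by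
      intro o ho hv
      rcases o with k | _ | _ | _ | _ | f
      · rw [z1]
        by_cases hk : k ∈ KK
        · refine le_trans (Finset.sum_le_sum_of_subset ?_) (sumv k hk ((v1 k).1 hv))
          intro i hi
          simp only [Finset.mem_filter, Finset.mem_univ, true_and] at hi ⊢
          have hn := hvc i (by rw [hi]; exact ho)
          by_cases a1 : i ∈ Dv
          · rw [k1 i hn a1] at hi; cases hi
          · by_cases a2 : i ∈ Dw
            · rw [k2 i hn a1 a2] at hi; cases hi
            · rw [k3 i hn a1 a2] at hi
              exact ⟨hn, a1, a2, Om.mn.inj hi⟩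
        · apply le_of_eq_of_le _ (Nat.zero_le _)
          apply Finset.sum_eq_zero
          intro i hi
          simp only [Finset.mem_filter, Finset.mem_univ, true_and] at hi
          have := hclval i
          rw [hi] at this
          exact absurd ((l1 k).1 this) hk
      · rw [z2]
        simp only
        have : ∑ i with cl i = Om.dv, w i ≤ ∑ i ∈ Dv, w i := by
          apply Finset.sum_le_sum_of_subset
          intro i hi
          simp only [Finset.mem_filter, Finset.mem_univ, true_and] at hi
          have hn := hvc i (by rw [hi]; exact ho)
          by_contra a1
          by_cases a2 : i ∈ Dw
          · rw [k2 i hn a1 a2] at hi; cases hi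
          · rw [k3 i hn a1 a2] at hi; cases hi
        omega
      · exact absurd hv v3
      · exact absurd ho c4
      · exact absurd ho c5
      · exact absurd ho (c6 f))
    (by
      intro i hi hv
      have hn := hvc i hi
      have hp := hpos i
      by_cases a1 : i ∈ Dv
      · rw [k1 i hn a1] at hv; exact absurd v2 hv
      · by_cases a2 : i ∈ Dw
        · rw [k2 i hn a1 a2, z3]; exact hp.2.2
        · rw [k3 i hn a1 a2] at hv ⊢
          rw [z1]; exact (asg i hn a1 a2).2.2 (fun h => hv ((v1 _).2 h)))
    (by
      intro o ho hv
      rcases o with k | _ | _ | _ | _ | f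
      · rw [z1]
        by_cases hk : k ∈ KK
        · refine le_trans (Finset.sum_le_sum_of_subset ?_) (sumh k hk (fun h => hv ((v1 k).2 h)))
          intro i hi
          simp only [Finset.mem_filter, Finset.mem_univ, true_and] at hi ⊢
          have hn := hvc i (by rw [hi]; exact ho)
          by_cases a1 : i ∈ Dv
          · rw [k1 i hn a1] at hi; cases hi
          · by_cases a2 : i ∈ Dw
            · rw [k2 i hn a1 a2] at hi; cases hi
            · rw [k3 i hn a1 a2] at hi
              exact ⟨hn, a1, a2, Om.mn.inj hi⟩
        · apply le_of_eq_of_le _ (Nat.zero_le _)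
          apply Finset.sum_eq_zero
          intro i hi
          simp only [Finset.mem_filter, Finset.mem_univ, true_and] at hi
          have := hclval i
          rw [hi] at this
          exact absurd ((l1 k).1 this) hk
      · exact absurd v2 hv
      · rw [z3]
        simp only
        rw [hS]
        apply Finset.sum_le_sum_of_subset
        intro i hi
        simp only [Finset.mem_filter, Finset.mem_univ, true_and] at hi
        have hn := hvc i (by rw [hi]; exact ho)
        by_contra a2
        by_cases a1 : i ∈ Dv
        · rw [k1 i hn a1] at hi; cases hi
        · rw [k3 i hn a1 a2] at hi; cases hi
      · exact absurd ho c4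
      · exact absurd ho c5
      · exact absurd ho (c6 f))
    (by
      intro i hi
      have h1 : ¬ NonSm w h W H d i := by
        intro hn
        apply hi
        rcases (hCm _).1 (hcC i hn) with ⟨k, _, hk⟩ | hk | hk <;> rw [hk]
        · exact c1 k
        · exact c2
        · exact c3
      by_cases h2 : NonSm w h W H d' i
      · rw [p01 i h2, k4 i h1 h2, z4]; exact hpm1 i ⟨h1, h2⟩
      · rw [p02 i h2, k5 i h2]
        obtain ⟨b1, b2⟩ := hpt1 i h2
        rcases hf : fc i with _ | f
        · show (PR w h pt i).Sub (Z Om.tn)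
          rw [z5]; exact b2 hf
        · show (PR w h pt i).Sub (Z (Om.ti f))
          rw [z6]; exact (b1 f hf).2)
    (by
      intro i j hij hi hc
      have hns : ∀ i, ¬ isC (cl i) → ¬ NonSm w h W H d i := by
        intro i hi hn
        apply hi
        rcases (hCm _).1 (hcC i hn) with ⟨k, _, hk⟩ | hk | hk <;> rw [hk]
        · exact c1 k
        · exact c2
        · exact c3
      have h1 := hns i hi
      have h1' := hns j (hc ▸ hi)
      by_cases h2 : NonSm w h W H d' i <;> by_cases h3 : NonSm w h W H d' j
      · rw [p01 i h2, p01 j h3]; exact hpm2 i ⟨h1, h2⟩ j ⟨h1', h3⟩ hij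
      · rw [k4 i h1 h2, k5 j h3] at hc
        rcases hf : fc j with _ | f <;> rw [hf] at hc <;> cases hc
      · rw [k5 i h2, k4 j h1' h3] at hc
        rcases hf : fc i with _ | f <;> rw [hf] at hc <;> cases hc
      · rw [p02 i h2, p02 j h3]; exact hpt2 i h2 j h3 hij)
    (fun i j hij => hZcd _ _ (hclval i) (hclval j) hij)
  refine ⟨Om κ, CC, Z, vt, cl, p, H1 + S + T, ?_, ?_, ?_, ?_, ?_, g1, ?_, ?_⟩
  · rw [hCC]
    have e1 := Finset.card_union_le (KK.image Om.mn) ({Om.dv, Om.dw} : Finset (Om κ))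
    have e2 : (KK.image Om.mn : Finset (Om κ)).card ≤ KK.card := Finset.card_image_le
    have e3 : ({Om.dv, Om.dw} : Finset (Om κ)).card ≤ 2 := Finset.card_le_two
    omega
  · have e1 : 3 * e * (H1 + S + T) = 3 * (e * H1) + 3 * (e * S) + e * (3 * T) := by ring
    have e2 : e * (3 * T) ≤ e * H1 := Nat.mul_le_mul_left _ hT1
    have e3 : (4 * e + 7) * H = 4 * ((e + 1) * H) + 3 * H := by ring
    omega
  · exact fun o ho => hZin o (hCval o ho)
  · intro o ho o' ho' hne
    have q1 := hZin o (hCval o ho)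
    rcases (hCm o).1 ho with ⟨k, hk, rfl⟩ | rfl | rfl <;> rcases (hCm o').1 ho' with ⟨k', hk', rfl⟩ | rfl | rfl
    · rw [z1, z1]; exact rd k hk k' hk' (fun h => hne (by rw [h]))
    · have := hbot1 _ ((l1 k).2 hk); rw [z2]; unfold RectDisjoint; simp only; omega
    · have := hbot1 _ ((l1 k).2 hk); rw [z3]; unfold RectDisjoint; simp only; omega
    · have := hbot1 _ ((l1 k').2 hk'); rw [z2]; unfold RectDisjoint; simp only; omega
    · exact absurd rfl hne
    · rw [z2, z3]; unfold RectDisjoint; simp only; omega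
    · have := hbot1 _ ((l1 k').2 hk'); rw [z3]; unfold RectDisjoint; simp only; omega
    · rw [z2, z3]; unfold RectDisjoint; simp only; omega
    · exact absurd rfl hne
  · intro i
    have e1 := sub_coord (g2 i) (hpos i).1 (hpos i).2.1
    have e2 := hZin _ (hclval i)
    unfold PR at e1
    simp only at e1
    omega
  · exact fun i hi => ⟨hcC i hi, g2 i⟩
  · intro i j hi hj hij hc
    refine g3 i j hij hc ?_
    rcases (hCm _).1 (hcC i hi) with ⟨k, _, hk⟩ | hk | hk <;> rw [hk]
    · exact c1 k
    · exact c2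
    · exact c3


theorem pigeon {ι : Type} [Fintype ι] (w h : ι → ℕ) (W H : ℕ) (D : ℕ → ℕ) (hD : Monotone D)
    (harea : ∑ i, w i * h i ≤ W * H) :
    ∃ n < 20, 20 * ∑ i with (¬ NonSm w h W H (D n) i ∧ NonSm w h W H (D (n + 1)) i), w i * h i ≤ W * H := by
  by_contra hc
  push Not at hc
  have hmono : ∀ a b, a ≤ b → ∀ i, NonSm w h W H a i → NonSm w h W H b i := by
    intro a b hab i hi
    rcases hi with hi | hi
    · exact Or.inl (lt_of_lt_of_le hi (Nat.mul_le_mul_right _ hab))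
    · exact Or.inr (lt_of_lt_of_le hi (Nat.mul_le_mul_right _ hab))
  obtain ⟨M, hM⟩ : ∃ M : ℕ → Finset ι, M = fun n => Finset.univ.filter (fun i => ¬ NonSm w h W H (D n) i ∧ NonSm w h W H (D (n + 1)) i) := ⟨_, rfl⟩
  have hMm : ∀ n i, i ∈ M n ↔ ¬ NonSm w h W H (D n) i ∧ NonSm w h W H (D (n + 1)) i := by
    intro n i; rw [hM]; simp only [Finset.mem_filter, Finset.mem_univ, true_and]
  have hlt : ∀ n m, n < m → ∀ i, i ∈ M n → i ∈ M m → False := by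
    intro n m hnm i h1 h2
    exact ((hMm m i).1 h2).1 (hmono _ _ (hD hnm) i ((hMm n i).1 h1).2)
  have h1 : ∑ n ∈ Finset.range 20, ∑ i ∈ M n, w i * h i ≤ ∑ i, w i * h i := by
    rw [← Finset.sum_biUnion]
    · exact Finset.sum_le_sum_of_subset (Finset.subset_univ _)
    · intro n _ m _ hnm
      show Disjoint (M n) (M m)
      rw [Finset.disjoint_left]
      intro i a1 a2
      rcases lt_or_gt_of_ne hnm with h | h
      · exact hlt n m h i a1 a2
      · exact hlt m n h i a2 a1
  have h2 : ∑ n ∈ Finset.range 20, (W * H + 1) ≤ ∑ n ∈ Finset.range 20, 20 * ∑ i ∈ M n, w i * h i := by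
    apply Finset.sum_le_sum
    intro n hn
    have := hc n (Finset.mem_range.1 hn)
    rw [hM]
    exact this
  rw [← Finset.mul_sum, Finset.sum_const, Finset.card_range, smul_eq_mul] at h2
  omega

/-- Structural form of the main theorem (Theorem 1): for every `ε ∈ (0,1)` there is a
constant `K = K(ε)` such that whenever a family of rectangles of width at most `W` admits a
feasible packing into `[0,W]×[0,H]`, ALL the rectangles can be feasibly packed into
`[0,W]×[0,⌈(4/3+ε)·H⌉]` so that every non-small rectangle (with `h_i > ε·H` or
`w_i > ε·W`) lies in one of at most `K` horizontal/vertical containers with pairwise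
disjoint interiors. -/
theorem strip_packing_four_thirds
    (ε : ℝ) (hε : ε ∈ Set.Ioo (0 : ℝ) 1) :
    ∃ K : ℕ, 0 < K ∧
      ∀ (W H : ℕ), 0 < W → 0 < H →
      ∀ (ι : Type) (_ : Fintype ι) (w h : ι → ℕ),
        (∀ i, 0 < w i ∧ 0 < h i ∧ w i ≤ W) →
        (∃ x y : ι → ℕ, IsPacking w h x y W H) →
        ∃ (x y : ι → ℕ) (n : ℕ) (cx cy cw ch : ℕ → ℝ) (vert : ℕ → Bool) (c : ι → ℕ),
          IsPacking w h x y W ⌈(4 / 3 + ε) * H⌉₊ ∧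
          n ≤ K ∧
          (∀ m < n, 0 ≤ cx m ∧ 0 ≤ cy m ∧ 0 ≤ cw m ∧ 0 ≤ ch m ∧
            cx m + cw m ≤ W ∧ cy m + ch m ≤ (⌈(4 / 3 + ε) * H⌉₊ : ℝ)) ∧
          (∀ m < n, ∀ m' < n, m ≠ m' →
            RegionDisjoint (cx m) (cy m) (cw m) (ch m) (cx m') (cy m') (cw m') (ch m')) ∧
          (∀ i, (ε * H < (h i : ℝ) ∨ ε * W < (w i : ℝ)) →
            c i < n ∧
            InRegion (x i) (y i) (w i) (h i) (cx (c i)) (cy (c i)) (cw (c i)) (ch (c i))) ∧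
          (∀ i j, (ε * H < (h i : ℝ) ∨ ε * W < (w i : ℝ)) →
            (ε * H < (h j : ℝ) ∨ ε * W < (w j : ℝ)) → i ≠ j → c i = c j →
            (vert (c i) = true → x i + w i ≤ x j ∨ x j + w j ≤ x i) ∧
            (vert (c i) = false → y i + h i ≤ y j ∨ y j + h j ≤ y i)) := by
  obtain ⟨hε0, hε1⟩ := hε
  obtain ⟨e, he⟩ := exists_nat_ge (3 / ε)
  have he3 : 3 ≤ e * ε := by rwa [div_le_iff₀ hε0] at he
  have he0 : 0 < e := by
    rcases Nat.eq_zero_or_pos e with h | h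
    · rw [h] at he3; norm_num at he3
    · exact h
  obtain ⟨d0, hd0⟩ := exists_nat_ge (1 / ε)
  have hd01 : 1 ≤ d0 * ε := by rwa [div_le_iff₀ hε0] at hd0
  have hKe : ∀ d : ℕ, ∃ K : ℕ, 0 < d → ∀ (ι : Type) [Fintype ι] (w h x y : ι → ℕ)
      (W H : ℕ), 0 < W → 0 < H → (∀ i, 0 < w i ∧ 0 < h i) → IsPacking w h x y W H →
      Nonempty (MainOut w h W H e d K) := by
    intro d
    rcases Nat.eq_zero_or_pos d with h | h
    · exact ⟨0, fun h' => absurd h' (by omega)⟩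
    · obtain ⟨K, hK⟩ := main_out e d he0 h
      exact ⟨K, fun _ => hK⟩
  choose Kf hKf using hKe
  obtain ⟨D, hD0, hDs⟩ : ∃ D : ℕ → ℕ, D 0 = 100 + d0 ∧ ∀ n, D (n + 1) = D n + 100 * (2 * Kf (D n) + 2) ^ 2 :=
    ⟨fun n => Nat.rec (100 + d0) (fun _ r => r + 100 * (2 * Kf r + 2) ^ 2) n, rfl, fun n => rfl⟩
  have hDm : Monotone D := monotone_nat_of_le_succ (fun n => by rw [hDs]; exact Nat.le_add_right _ _)
  refine ⟨∑ n ∈ Finset.range 20, Kf (D n) + 2, by omega, ?_⟩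
  intro W H hW hH ι _ w h hpos hpack
  obtain ⟨x0, y0, hpk⟩ := hpack
  have harea : ∑ i, w i * h i ≤ W * H :=
    sum_area_le Finset.univ (fun i => (⟨x0 i, y0 i, w i, h i⟩ : Rg)) ⟨0, 0, W, H⟩
      (fun i _ j _ hij => Rg.CD.of_rect (hpk.2 hij))
      (fun i _ q r hm => by have := hpk.1 i; unfold Rg.Mem at *; simp only at *; omega)
  obtain ⟨n, hn, hmed⟩ := pigeon w h W H D hDm harea
  have hdn : 100 + d0 ≤ D n := hD0 ▸ hDm (Nat.zero_le n)
  obtain ⟨M⟩ := hKf (D n) (by omega) ι w h x0 y0 W H hW hH (fun i => ⟨(hpos i).1, (hpos i).2.1⟩) hpk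
  obtain ⟨Ω, CC, Z, vert, cl, p, Ht, hcard, hHt, hZin, hZrd, hpin, hpcd, hnon, hint⟩ :=
    assemble w h W H e (D n) (D (n + 1)) (Kf (D n)) he0 (by omega) (hDm (Nat.le_succ n))
      (by rw [hDs]; exact Nat.le_add_left _ _) hpos M hmed
  have hHc : Ht ≤ ⌈(4 / 3 + ε) * H⌉₊ := by
    have h1 : (3 * e * Ht : ℝ) ≤ (4 * e + 7) * H := by exact_mod_cast hHt
    have hHr : (0 : ℝ) < H := by exact_mod_cast hH
    have her : (0 : ℝ) < e := by exact_mod_cast he0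
    have h2 : (Ht : ℝ) ≤ (4 / 3 + ε) * H := by
      have h3 : (3 * e : ℝ) * Ht ≤ 3 * e * ((4 / 3 + ε) * H) := by nlinarith
      exact le_of_mul_le_mul_left h3 (by positivity)
    exact_mod_cast h2.trans (Nat.le_ceil _)
  have hns : ∀ i, (ε * H < (h i : ℝ) ∨ ε * W < (w i : ℝ)) → NonSm w h W H (D n) i := by
    intro i hi
    have hdr : 1 ≤ (D n : ℝ) * ε := by
      have : (d0 : ℝ) ≤ D n := by exact_mod_cast (by omega : d0 ≤ D n)
      nlinarith
    have hdp : (0 : ℝ) < D n := by exact_mod_cast (by omega : 0 < D n)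
    have key : ∀ a b : ℕ, ε * a < (b : ℝ) → a < D n * b := by
      intro a b hab
      have h1 : (D n : ℝ) * (ε * a) < D n * b := mul_lt_mul_of_pos_left hab hdp
      have ha : (0 : ℝ) ≤ a := Nat.cast_nonneg a
      have h2 : (a : ℝ) < D n * b := by nlinarith
      exact_mod_cast h2
    rcases hi with hi | hi
    · exact Or.inl (key _ _ hi)
    · exact Or.inr (key _ _ hi)
  have eqv := CC.equivFin
  obtain ⟨om, hom⟩ : ∃ om : Fin CC.card → Ω, om = fun m => (eqv.symm m).1 := ⟨_, rfl⟩
  have homC : ∀ m, om m ∈ CC := by intro m; rw [hom]; exact (eqv.symm m).2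
  have hominj : ∀ m m', om m = om m' → m = m' := by
    intro m m' hmm
    rw [hom] at hmm
    exact eqv.symm.injective (Subtype.ext hmm)
  have homsurj : ∀ o ∈ CC, ∃ m, om m = o := by
    intro o ho
    refine ⟨eqv ⟨o, ho⟩, ?_⟩
    rw [hom]; simp
  obtain ⟨zz, hzz⟩ : ∃ zz : ℕ → Rg, zz = fun m => if hm : m < CC.card then Z (om ⟨m, hm⟩) else ⟨0, 0, 0, 0⟩ := ⟨_, rfl⟩
  have hzz1 : ∀ m (hm : m < CC.card), zz m = Z (om ⟨m, hm⟩) := by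
    intro m hm; rw [hzz]; exact dif_pos hm
  have hcl : ∀ i, ∃ m : ℕ, NonSm w h W H (D n) i → ∃ hm : m < CC.card, om ⟨m, hm⟩ = cl i := by
    intro i
    by_cases hi : NonSm w h W H (D n) i
    · obtain ⟨m, hm⟩ := homsurj _ (hnon i hi).1
      exact ⟨m.1, fun _ => ⟨m.2, hm⟩⟩
    · exact ⟨0, fun h => absurd h hi⟩
  choose c hc using hcl
  refine ⟨fun i => (p i).1, fun i => (p i).2, CC.card, fun m => (zz m).x, fun m => (zz m).y, fun m => (zz m).w,
    fun m => (zz m).h, fun m => decide (∃ hm : m < CC.card, vert (om ⟨m, hm⟩)), c, ?_, ?_, ?_, ?_, ?_, ?_⟩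
  · refine ⟨fun i => ⟨(hpin i).1, (hpin i).2.trans hHc⟩, ?_⟩
    intro i j hij
    exact (hpcd i j hij).rect (hpos i).1 (hpos i).2.1 (hpos j).1 (hpos j).2.1
  · refine hcard.trans (Nat.add_le_add_right ?_ 2)
    exact Finset.single_le_sum (f := fun n => Kf (D n)) (fun _ _ => Nat.zero_le _) (Finset.mem_range.2 hn)
  · intro m hm
    have e1 := hZin _ (homC ⟨m, hm⟩)
    rw [← hzz1 m hm] at e1
    refine ⟨Nat.cast_nonneg _, Nat.cast_nonneg _, Nat.cast_nonneg _, Nat.cast_nonneg _, ?_, ?_⟩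
    · simp only
      exact_mod_cast e1.1
    · simp only
      exact_mod_cast e1.2.trans hHc
  · intro m hm m' hm' hne
    have e1 := hZrd _ (homC ⟨m, hm⟩) _ (homC ⟨m', hm'⟩) (fun hh => hne (by
      have := hominj _ _ hh
      exact Fin.mk.inj_iff.1 this))
    rw [← hzz1 m hm, ← hzz1 m' hm'] at e1
    unfold RegionDisjoint
    unfold RectDisjoint at e1
    simp only
    exact_mod_cast e1
  · intro i hi
    have hi' := hns i hi
    obtain ⟨hm, hm2⟩ := hc i hi'
    have e1 := sub_coord (hnon i hi').2 (hpos i).1 (hpos i).2.1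
    rw [← hm2, ← hzz1 _ hm] at e1
    refine ⟨hm, ?_⟩
    unfold InRegion
    unfold PR at e1
    simp only at e1 ⊢
    exact_mod_cast e1
  · intro i j hi hj hij hcc
    have hi' := hns i hi
    have hj' := hns j hj
    obtain ⟨hm, hm2⟩ := hc i hi'
    obtain ⟨hm', hm2'⟩ := hc j hj'
    have hcl' : cl i = cl j := by
      rw [← hm2, ← hm2']
      congr 1
      exact Fin.ext hcc
    obtain ⟨g1, g2⟩ := hint i j hi' hj' hij hcl'
    constructor
    · intro hv
      simp only [decide_eq_true_eq] at hv
      obtain ⟨_, hv⟩ := hv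
      rw [hm2] at hv
      exact g1 hv
    · intro hv
      simp only [decide_eq_false_iff_not] at hv
      exact g2 (fun h => hv ⟨hm, by rw [hm2]; exact h⟩)
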